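/- For every integer k ≥ 3 there is an integer n₀ = n₀(k) such that every digraph G on n ≥ n₀ vertices with minimum semidegree δ⁰(G) ≥ ⌈(n + k)/2⌉ − 1 is k-ordered Hamiltonian: for every sequence s₁, …, s_k of distinct vertices there is a Hamilton cycle (a directed cycle through all vertices) which encounters s₁, …, s_k in this cyclic order. -/

import Mathlib

/-- The outdegree of a vertex `x` in the digraph with adjacency relation `G`. -/
noncomputable def outDeg {V : Type*} (G : V → V → Prop) (x : V) : ℕ :=
  Nat.card {y : V // G x y}

/-- The indegree of a vertex `x` in the digraph with adjacency relation `G`. -/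
noncomputable def inDeg {V : Type*} (G : V → V → Prop) (x : V) : ℕ :=
  Nat.card {y : V // G y x}

namespace KOrdered

open Finset
open scoped Classical

section

/-- Among objects satisfying `P` with bounded size there is one of maximal size. -/
theorem exists_max_of_bounded {α : Type*} (P : α → Prop) (f : α → ℕ) (N : ℕ) (hne : ∃ a, P a)
    (hb : ∀ a, P a → f a ≤ N) : ∃ a, P a ∧ ∀ b, P b → f b ≤ f a := by
  have hP : ∃ i, i ≤ N ∧ ∃ a, P a ∧ f a = i := by
    obtain ⟨a, ha⟩ := hne
    exact ⟨f a, hb a ha, a, ha, rfl⟩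
  obtain ⟨i, hi, hi'⟩ := hP
  obtain ⟨a, ha, hai⟩ := Nat.findGreatest_spec (P := fun i => ∃ a, P a ∧ f a = i) hi hi'
  refine ⟨a, ha, fun b hb' => ?_⟩
  rw [hai]
  exact Nat.le_findGreatest (hb b hb') ⟨b, hb', rfl⟩

/-- Indices of the entries of `l` satisfying `p`. -/
noncomputable def idx {V : Type*} (p : V → Prop) (l : List V) : Finset ℕ :=
  (range l.length).filter fun i => ∃ x, l[i]? = some x ∧ p x

theorem mem_idx {V : Type*} {p : V → Prop} {l : List V} {i : ℕ} :
    i ∈ idx p l ↔ ∃ x, l[i]? = some x ∧ p x := by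
  simp only [idx, mem_filter, mem_range, and_iff_right_iff_imp]
  rintro ⟨x, hx, -⟩
  exact (List.getElem?_eq_some_iff.1 hx).1

theorem idx_subset {V : Type*} (p : V → Prop) (l : List V) : idx p l ⊆ range l.length :=
  filter_subset _ _

theorem card_idx {V : Type*} (p : V → Prop) {l : List V} (hl : l.Nodup) :
    (idx p l).card = (l.toFinset.filter p).card := by
  refine Finset.card_bij (fun i hi => l[i]'(mem_range.1 (idx_subset p l hi))) ?_ ?_ ?_
  · intro i hi
    obtain ⟨x, hx, hpx⟩ := mem_idx.1 hi
    obtain ⟨h, rfl⟩ := List.getElem?_eq_some_iff.1 hx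
    simp [hpx]
  · intro i hi j hj hij
    exact (List.Nodup.getElem_inj_iff hl).1 hij
  · intro x hx
    simp only [mem_filter, List.mem_toFinset] at hx
    obtain ⟨i, hi, rfl⟩ := List.mem_iff_getElem.1 hx.1
    exact ⟨i, mem_idx.2 ⟨_, List.getElem?_eq_getElem hi, hx.2⟩, rfl⟩

/-- Counting bound for two index sets whose admissible crossings are all long. -/
theorem crossing_bound (c q : ℕ) (A B : Finset ℕ) (hA : A ⊆ range c) (hB : B ⊆ range c)
    (P : ℕ → ℕ → Prop)
    (hP : ∀ i j i' j', P i j → i ≤ i' → i' ≤ j' → j' ≤ j → P i' j')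
    (hP0 : ∀ i, i < c → P i i) (hq : 1 ≤ q)
    (h : ∀ i ∈ A, ∀ j ∈ B, i ≤ j → P i j → i + q ≤ j) :
    A.card + B.card ≤ c ∧
      ((∃ i ∈ A, ∃ j ∈ B, i ≤ j ∧ P i j) → A.card + B.card + q ≤ c + 1) := by
  have hd : Disjoint A B := by
    rw [Finset.disjoint_left]
    intro i hi hj
    have := h i hi i hj le_rfl (hP0 i (mem_range.1 (hA hi)))
    omega
  have hu : (A ∪ B).card = A.card + B.card := card_union_of_disjoint hd
  refine ⟨?_, ?_⟩
  · rw [← hu]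
    simpa using card_le_card (union_subset hA hB)
  · rintro ⟨i₀, hi₀, j₀, hj₀, hij₀, hp₀⟩
    obtain ⟨⟨i, j⟩, ⟨hi, hj, hij, hp⟩, hmin⟩ := exists_max_of_bounded
      (fun x : ℕ × ℕ => x.1 ∈ A ∧ x.2 ∈ B ∧ x.1 ≤ x.2 ∧ P x.1 x.2)
      (fun x => c - (x.2 - x.1)) c ⟨(i₀, j₀), hi₀, hj₀, hij₀, hp₀⟩ (fun _ _ => Nat.sub_le _ _)
    simp only at hi hj hij hp hmin
    have hjc := mem_range.1 (hB hj)
    have hq' := h i hi j hj hij hp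
    have hsub : A ∪ B ⊆ range c \ Ioo i j := by
      intro x hx
      rw [mem_sdiff, mem_Ioo]
      refine ⟨union_subset hA hB hx, fun hx' => ?_⟩
      rcases mem_union.1 hx with hx | hx
      · have := hmin (x, j) ⟨hx, hj, hx'.2.le, hP _ _ _ _ hp hx'.1.le hx'.2.le le_rfl⟩
        simp only at this
        omega
      · have := hmin (i, x) ⟨hi, hx, hx'.1.le, hP _ _ _ _ hp le_rfl hx'.1.le hx'.2.le⟩
        simp only at this
        omega
    have h1 := card_le_card hsub
    have h2 : Ioo i j ⊆ range c := fun x hx => by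
      rw [mem_Ioo] at hx
      rw [mem_range]
      omega
    rw [card_sdiff_of_subset h2, hu, card_range, Nat.card_Ioo] at h1
    omega

/-- The closed walk `s₀, m, s₀` is a directed cycle. -/
def IsCyc {V : Type*} (G : V → V → Prop) (s₀ : V) (m : List V) : Prop :=
  (s₀ :: (m ++ [s₀])).IsChain G ∧ (s₀ :: m).Nodup

variable {V : Type*} {G : V → V → Prop}

theorem IsCyc.splice {s₀ : V} {m : List V} (h : IsCyc G s₀ m) {i j : ℕ} (hij : i ≤ j)
    {u w : V} (hu : (s₀ :: m)[i]? = some u) (hw : (m ++ [s₀])[j]? = some w) {R : List V}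
    (hR : (u :: (R ++ [w])).IsChain G) (hRn : R.Nodup) (hRd : ∀ x ∈ R, x ∉ s₀ :: m) :
    IsCyc G s₀ (m.take i ++ R ++ m.drop j) := by
  obtain ⟨hi, hu'⟩ := List.getElem?_eq_some_iff.1 hu
  obtain ⟨hj, hw'⟩ := List.getElem?_eq_some_iff.1 hw
  have hjm : j ≤ m.length := by simp at hj; omega
  have e1 : s₀ :: m.take i = (s₀ :: m).take i ++ [u] := by
    rw [← List.take_succ_cons, List.take_add_one, hu]
    rfl
  have e2 : m.drop j ++ [s₀] = w :: (m ++ [s₀]).drop (j + 1) := by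
    rw [← List.drop_append_of_le_length hjm, List.drop_eq_getElem_cons hj, hw']
  refine ⟨?_, ?_⟩
  · have e3 : s₀ :: (m.take i ++ R ++ m.drop j ++ [s₀])
        = (s₀ :: m).take i ++ u :: (R ++ w :: (m ++ [s₀]).drop (j + 1)) := by
      rw [List.append_assoc, List.append_assoc, e2, ← List.cons_append, e1]
      simp
    rw [e3, List.isChain_split]
    refine ⟨?_, ?_⟩
    · rw [← e1]
      rw [← List.take_succ_cons]
      have := h.1
      rw [← List.cons_append] at this
      exact this.left_of_append.take _
    · rw [← List.cons_append, List.isChain_split]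
      refine ⟨hR, ?_⟩
      rw [← e2]
      refine h.1.suffix ?_
      rw [← List.drop_append_of_le_length hjm]
      exact (List.drop_suffix _ _).trans (List.suffix_cons _ _)
  · have hs : (s₀ :: m.take i ++ m.drop j).Sublist (s₀ :: m) := by
      rw [List.cons_append]
      refine List.Sublist.cons_cons _ ?_
      conv_rhs => rw [← List.take_append_drop i m]
      exact List.Sublist.append (List.Sublist.refl _) (List.drop_sublist_drop_left _ hij)
    have hn := h.2.sublist hs
    have hp : (s₀ :: (m.take i ++ R ++ m.drop j)).Perm (R ++ (s₀ :: m.take i ++ m.drop j)) := by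
      rw [← List.cons_append, ← List.cons_append, ← List.append_assoc]
      exact List.Perm.append_right _ List.perm_append_comm
    rw [hp.nodup_iff, List.nodup_append']
    exact ⟨hRn, hn, fun x hx hx' => hRd x hx (hs.subset hx')⟩

theorem IsCyc.length_splice {s₀ : V} {m : List V} {i j : ℕ} {w : V} (hij : i ≤ j)
    (hw : (m ++ [s₀])[j]? = some w) (R : List V) :
    (m.take i ++ R ++ m.drop j).length + j = m.length + R.length + i := by
  obtain ⟨hj, -⟩ := List.getElem?_eq_some_iff.1 hw
  simp at hj
  simp
  omega

theorem IsCyc.rotate {s₀ u : V} {m : List V} (h : IsCyc G s₀ m) (hu : u ∈ s₀ :: m) :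
    ∃ m', IsCyc G u m' ∧ (u :: m').Perm (s₀ :: m) := by
  rcases List.mem_cons.1 hu with rfl | hu
  · exact ⟨m, h, List.Perm.refl _⟩
  · obtain ⟨m₁, m₂, rfl⟩ := List.append_of_mem hu
    have hp : (u :: (m₂ ++ s₀ :: m₁)).Perm (s₀ :: (m₁ ++ u :: m₂)) := by
      have := List.perm_append_comm (l₁ := u :: m₂) (l₂ := s₀ :: m₁)
      simpa using this
    refine ⟨m₂ ++ s₀ :: m₁, ⟨?_, hp.nodup_iff.2 h.2⟩, hp⟩
    have h1 := h.1
    have e : s₀ :: (m₁ ++ u :: m₂ ++ [s₀]) = (s₀ :: m₁) ++ u :: (m₂ ++ [s₀]) := by simp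
    rw [e, List.isChain_split] at h1
    have e' : u :: (m₂ ++ s₀ :: m₁ ++ [u]) = (u :: m₂) ++ s₀ :: (m₁ ++ [u]) := by simp
    rw [e', List.isChain_split]
    exact ⟨h1.2, h1.1⟩

theorem length_le_card_of_subset {l : List V} (hl : l.Nodup) {U : Finset V} (h : ∀ x ∈ l, x ∈ U) :
    l.length ≤ U.card := by
  rw [← List.toFinset_card_of_nodup hl]
  exact card_le_card fun x hx => h x (List.mem_toFinset.1 hx)

/-- A longest path in `H`: the in-neighbours of its start and the out-neighbours of its end
within `H` lie on the path. -/
theorem exists_longest_path (hG : ∀ x, ¬ G x x) {H : Finset V} (hH : H.Nonempty) :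
    ∃ (Q : List V) (x y : V), Q.IsChain G ∧ Q.Nodup ∧ (∀ v ∈ Q, v ∈ H) ∧ Q.head? = some x ∧
      Q.getLast? = some y ∧ (∀ v ∈ H, G v x → v ∈ Q) ∧ (∀ v ∈ H, G y v → v ∈ Q) ∧
      (H.filter (G · x)).card + 1 ≤ Q.length ∧ (H.filter (G y ·)).card + 1 ≤ Q.length := by
  obtain ⟨v₀, hv₀⟩ := hH
  obtain ⟨Q, ⟨hQ, hQn, hQH⟩, hmax⟩ := exists_max_of_bounded
    (fun Q : List V => Q.IsChain G ∧ Q.Nodup ∧ ∀ v ∈ Q, v ∈ H) List.length H.card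
    ⟨[v₀], by simp [hv₀]⟩ (fun Q hQ => length_le_card_of_subset hQ.2.1 hQ.2.2)
  have hQ0 : Q ≠ [] := by
    rintro rfl
    have := hmax [v₀] (by simp [hv₀])
    simp at this
  obtain ⟨x, hx⟩ : ∃ x, Q.head? = some x := ⟨_, List.head?_eq_some_head hQ0⟩
  obtain ⟨y, hy⟩ : ∃ y, Q.getLast? = some y := ⟨_, List.getLast?_eq_some_getLast hQ0⟩
  have h1 : ∀ v ∈ H, G v x → v ∈ Q := by
    intro v hv hvx
    by_contra hvQ
    have := hmax (v :: Q) ⟨?_, List.nodup_cons.2 ⟨hvQ, hQn⟩, by simpa [hv] using hQH⟩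
    · simp at this
    · rw [List.isChain_cons]
      refine ⟨?_, hQ⟩
      intro z hz
      rw [hx] at hz
      simp at hz
      exact hz ▸ hvx
  have h2 : ∀ v ∈ H, G y v → v ∈ Q := by
    intro v hv hvy
    by_contra hvQ
    have := hmax (Q ++ [v]) ⟨?_, ?_, ?_⟩
    · simp at this
    · rw [List.isChain_append]
      refine ⟨hQ, by simp, ?_⟩
      intro z hz w hw
      rw [hy] at hz
      simp at hz hw
      exact hz ▸ hw ▸ hvy
    · rw [List.nodup_append']
      simpa [hQn] using hvQ
    · intro w hw
      rcases List.mem_append.1 hw with hw | hw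
      · exact hQH w hw
      · simp at hw; exact hw ▸ hv
  have hxQ : x ∈ Q := List.mem_of_mem_head? hx
  have hyQ : y ∈ Q := List.mem_of_mem_getLast? hy
  refine ⟨Q, x, y, hQ, hQn, hQH, hx, hy, h1, h2, ?_, ?_⟩
  · have : (H.filter (G · x)) ⊂ Q.toFinset := by
      rw [Finset.ssubset_iff_of_subset]
      · exact ⟨x, by simpa using hxQ, by simp [hG]⟩
      · intro v hv
        rw [mem_filter] at hv
        simpa using h1 v hv.1 hv.2
    have := card_lt_card this
    rw [List.toFinset_card_of_nodup hQn] at this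
    omega
  · have : (H.filter (G y ·)) ⊂ Q.toFinset := by
      rw [Finset.ssubset_iff_of_subset]
      · exact ⟨y, by simpa using hyQ, by simp [hG]⟩
      · intro v hv
        rw [mem_filter] at hv
        simpa using h2 v hv.1 hv.2
    have := card_lt_card this
    rw [List.toFinset_card_of_nodup hQn] at this
    omega

theorem IsCyc.of_suffix_of_path {Q : List V} (hQ : Q.IsChain G) (hQn : Q.Nodup) {y : V}
    (hy : Q.getLast? = some y) (hne : ∃ v ∈ Q, G y v) :
    ∃ u m, IsCyc G u m ∧ (∀ v ∈ u :: m, v ∈ Q) ∧ y ∈ u :: m ∧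
      ∀ v ∈ Q, G y v → v ∈ u :: m := by
  induction Q with
  | nil => simp at hne
  | cons a l ih =>
    by_cases hya : G y a
    · refine ⟨a, l, ⟨?_, hQn⟩, fun v hv => hv, List.mem_of_mem_getLast? hy, fun v hv _ => hv⟩
      rw [← List.cons_append, List.isChain_append]
      refine ⟨hQ, by simp, ?_⟩
      intro z hz w hw
      rw [hy] at hz
      simp at hz hw
      exact hz ▸ hw ▸ hya
    · obtain ⟨v, hv, hyv⟩ := hne
      have hvl : v ∈ l := by
        rcases List.mem_cons.1 hv with rfl | h
        · exact absurd hyv hya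
        · exact h
      have hl : l ≠ [] := List.ne_nil_of_mem hvl
      have hyl : l.getLast? = some y := by
        rw [← hy]
        cases l with
        | nil => exact absurd rfl hl
        | cons b l => simp [List.getLast?_cons_cons]
      obtain ⟨u, m, h1, h2, hmem, h3⟩ := ih hQ.tail (List.nodup_cons.1 hQn).2 hyl ⟨v, hvl, hyv⟩
      refine ⟨u, m, h1, fun w hw => List.mem_cons_of_mem _ (h2 w hw), hmem, fun w hw hyw => ?_⟩
      rcases List.mem_cons.1 hw with rfl | h
      · exact absurd hyw hya
      · exact h3 w h hyw

theorem IsCyc.of_prefix_of_path {Q : List V} (hQ : Q.IsChain G) (hQn : Q.Nodup) {x : V}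
    (hx : Q.head? = some x) (hne : ∃ v ∈ Q, G v x) :
    ∃ u m, IsCyc G u m ∧ (∀ v ∈ u :: m, v ∈ Q) ∧ x ∈ u :: m ∧
      ∀ v ∈ Q, G v x → v ∈ u :: m := by
  induction Q using List.reverseRecOn with
  | nil => simp at hne
  | append_singleton l a ih =>
    by_cases hya : G a x
    · have hp : (a :: l).Perm (l ++ [a]) := List.perm_append_comm (l₁ := [a])
      refine ⟨a, l, ⟨?_, hp.nodup_iff.2 hQn⟩, fun v hv => hp.mem_iff.1 hv,
        hp.mem_iff.2 (List.mem_of_mem_head? hx), fun v hv _ => hp.mem_iff.2 hv⟩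
      rw [List.isChain_cons]
      refine ⟨?_, hQ⟩
      intro z hz
      rw [hx] at hz
      simp at hz
      exact hz ▸ hya
    · obtain ⟨v, hv, hyv⟩ := hne
      have hvl : v ∈ l := by
        rcases List.mem_append.1 hv with h | h
        · exact h
        · simp at h; subst h; exact absurd hyv hya
      have hl : l ≠ [] := List.ne_nil_of_mem hvl
      have hyl : l.head? = some x := by
        rw [← hx]
        cases l with
        | nil => exact absurd rfl hl
        | cons b l => simp
      obtain ⟨u, m, h1, h2, hmem, h3⟩ := ih hQ.left_of_append (List.nodup_append'.1 hQn).1 hyl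
        ⟨v, hvl, hyv⟩
      refine ⟨u, m, h1, fun w hw => List.mem_append_left _ (h2 w hw), hmem, fun w hw hyw => ?_⟩
      rcases List.mem_append.1 hw with h | h
      · exact h3 w h hyw
      · simp at h; subst h; exact absurd hyw hya

theorem IsCyc.card_le {U : Finset V} {s₀ : V} {m : List V} (h : IsCyc G s₀ m)
    (hm : ∀ v ∈ s₀ :: m, v ∈ U) : m.length + 1 ≤ U.card :=
  length_le_card_of_subset h.2 hm

theorem toFinset_append_singleton (s₀ : V) (m : List V) :
    (m ++ [s₀]).toFinset = (s₀ :: m).toFinset := by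
  ext v
  simp only [List.mem_toFinset, List.mem_append, List.mem_cons, List.not_mem_nil, or_false]
  tauto

theorem IsCyc.nodup' {s₀ : V} {m : List V} (h : IsCyc G s₀ m) : (m ++ [s₀]).Nodup :=
  (List.perm_append_comm (l₁ := [s₀]) (l₂ := m)).nodup_iff.1 h.2

theorem isChain_cons_append_singleton {Q : List V} {x y u w : V} (hQ : Q.IsChain G)
    (hx : Q.head? = some x) (hy : Q.getLast? = some y) (hu : G u x) (hw : G y w) :
    (u :: (Q ++ [w])).IsChain G := by
  rw [List.isChain_cons, List.isChain_append]
  refine ⟨?_, hQ, by simp, ?_⟩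
  · intro z hz
    rw [List.head?_append, hx] at hz
    simp at hz
    exact hz ▸ hu
  · intro z hz v hv
    rw [hy] at hz
    simp at hz hv
    exact hz ▸ hv ▸ hw

/-- Ghouila-Houri's theorem, in the form with separate bounds on out- and indegrees. -/
theorem exists_hamilton_cycle (hG : ∀ x, ¬ G x x) {U : Finset V} {a b : ℕ} (hU : 2 ≤ U.card)
    (hab : U.card ≤ a + b) (ha : ∀ v ∈ U, a ≤ (U.filter (G v ·)).card)
    (hb : ∀ v ∈ U, b ≤ (U.filter (G · v)).card) :
    ∃ s₀ m, IsCyc G s₀ m ∧ ∀ v, v ∈ s₀ :: m ↔ v ∈ U := by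
  have hne : U.Nonempty := card_pos.1 (by omega)
  obtain ⟨Q, x, y, hQ, hQn, hQU, hx, hy, hxQ, hyQ, hxc, hyc⟩ := exists_longest_path hG hne
  have hxQ' : x ∈ Q := List.mem_of_mem_head? hx
  have hyQ' : y ∈ Q := List.mem_of_mem_getLast? hy
  have hQc := length_le_card_of_subset hQn hQU
  have ha1 := ha y (hQU y hyQ')
  have hb1 := hb x (hQU x hxQ')
  have key1 : ∃ u m, IsCyc G u m ∧ (∀ v ∈ u :: m, v ∈ U) ∧ a ≤ m.length := by
    have : (U.filter (G y ·)).Nonempty := card_pos.1 (by omega)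
    obtain ⟨v, hv⟩ := this
    rw [mem_filter] at hv
    obtain ⟨u, m, h1, h2, hyC, h3⟩ :=
      IsCyc.of_suffix_of_path hQ hQn hy ⟨v, hyQ v hv.1 hv.2, hv.2⟩
    refine ⟨u, m, h1, fun v hv => hQU v (h2 v hv), ?_⟩
    have : U.filter (G y ·) ⊂ (u :: m).toFinset := by
      rw [Finset.ssubset_iff_of_subset]
      · exact ⟨y, List.mem_toFinset.2 hyC, by simp [hG]⟩
      · intro v hv
        rw [mem_filter] at hv
        rw [List.mem_toFinset]
        exact h3 v (hyQ v hv.1 hv.2) hv.2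
    have := card_lt_card this
    rw [List.toFinset_card_of_nodup h1.2, List.length_cons] at this
    omega
  have key2 : ∃ u m, IsCyc G u m ∧ (∀ v ∈ u :: m, v ∈ U) ∧ b ≤ m.length := by
    have : (U.filter (G · x)).Nonempty := card_pos.1 (by omega)
    obtain ⟨v, hv⟩ := this
    rw [mem_filter] at hv
    obtain ⟨u, m, h1, h2, hyC, h3⟩ :=
      IsCyc.of_prefix_of_path hQ hQn hx ⟨v, hxQ v hv.1 hv.2, hv.2⟩
    refine ⟨u, m, h1, fun v hv => hQU v (h2 v hv), ?_⟩
    have : U.filter (G · x) ⊂ (u :: m).toFinset := by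
      rw [Finset.ssubset_iff_of_subset]
      · exact ⟨x, List.mem_toFinset.2 hyC, by simp [hG]⟩
      · intro v hv
        rw [mem_filter] at hv
        rw [List.mem_toFinset]
        exact h3 v (hxQ v hv.1 hv.2) hv.2
    have := card_lt_card this
    rw [List.toFinset_card_of_nodup h1.2, List.length_cons] at this
    omega
  obtain ⟨⟨s₀, m⟩, ⟨hC, hCU⟩, hmax⟩ := exists_max_of_bounded
    (fun p : V × List V => IsCyc G p.1 p.2 ∧ ∀ v ∈ p.1 :: p.2, v ∈ U) (fun p => p.2.length) U.card
    (by obtain ⟨u, m, h1, h2, -⟩ := key1; exact ⟨(u, m), h1, h2⟩)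
    (fun p hp => by have := hp.1.card_le hp.2; omega)
  simp only at hC hCU hmax
  have hma : a ≤ m.length := by
    obtain ⟨u, m', h1, h2, h3⟩ := key1
    exact h3.trans (hmax (u, m') ⟨h1, h2⟩)
  have hmb : b ≤ m.length := by
    obtain ⟨u, m', h1, h2, h3⟩ := key2
    exact h3.trans (hmax (u, m') ⟨h1, h2⟩)
  clear hx hy hxQ hyQ hxc hyc hxQ' hyQ' ha1 hb1 key1 key2 hQc hQ hQn hQU x y Q
  refine ⟨s₀, m, hC, fun v => ⟨hCU v, fun hv => ?_⟩⟩
  by_contra hvC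
  set H := U \ (s₀ :: m).toFinset with hH
  obtain ⟨Q, x, y, hQ, hQn, hQH, hx, hy, hxQ, hyQ, hxc, hyc⟩ := exists_longest_path (G := G) hG
    (H := H) ⟨v, by simp only [hH, mem_sdiff, List.mem_toFinset]; exact ⟨hv, hvC⟩⟩
  have hxH := hQH x (List.mem_of_mem_head? hx)
  have hyH := hQH y (List.mem_of_mem_getLast? hy)
  rw [hH, mem_sdiff] at hxH hyH
  have hHc := length_le_card_of_subset hQn hQH
  have hCU' : (s₀ :: m).toFinset ⊆ U := fun v hv => hCU v (List.mem_toFinset.1 hv)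
  have hsplit : ∀ p : V → Prop, (U.filter p).card =
      (H.filter p).card + ((s₀ :: m).toFinset.filter p).card := by
    intro p
    rw [hH, ← card_union_of_disjoint, ← filter_union, sdiff_union_of_subset hCU']
    exact disjoint_filter_filter sdiff_disjoint
  have hUc : U.card = H.card + (m.length + 1) := by
    have := hsplit (fun _ => True)
    rwa [filter_true, filter_true, filter_true, List.toFinset_card_of_nodup hC.2] at this
  have ha1 := ha y hyH.1
  have hb1 := hb x hxH.1
  rw [hsplit] at ha1 hb1
  have hAne : ((s₀ :: m).toFinset.filter (G · x)).Nonempty := card_pos.1 (by omega)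
  have hBne : ((s₀ :: m).toFinset.filter (G y ·)).Nonempty := card_pos.1 (by omega)
  obtain ⟨u, hu⟩ := hAne
  rw [mem_filter, List.mem_toFinset] at hu
  obtain ⟨m', hC', hp⟩ := hC.rotate hu.1
  have hml : m'.length = m.length := by simpa using hp.length_eq
  have htf : (u :: m').toFinset = (s₀ :: m).toFinset := List.toFinset_eq_of_perm _ _ hp
  rw [← htf] at ha1 hb1 hBne
  rw [← toFinset_append_singleton] at ha1 hBne
  rw [← card_idx _ hC'.2] at hb1
  rw [← card_idx _ hC'.nodup'] at ha1
  rw [← card_pos, ← card_idx _ hC'.nodup', card_pos] at hBne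
  have := crossing_bound (m'.length + 1) Q.length (idx (G · x) (u :: m')) (idx (G y ·) (m' ++ [u]))
    (by simpa using idx_subset (G · x) (u :: m')) (by simpa using idx_subset (G y ·) (m' ++ [u]))
    (fun _ _ => True) (by simp) (by simp) (by omega) (by
      intro i hi j hj hij _
      obtain ⟨v, hv, hvx⟩ := mem_idx.1 hi
      obtain ⟨w, hw, hyw⟩ := mem_idx.1 hj
      have hcyc := hC'.splice hij hv hw (isChain_cons_append_singleton hQ hx hy hvx hyw) hQn (by
        intro z hz hzC
        have := hQH z hz
        rw [hH, mem_sdiff, List.mem_toFinset] at this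
        exact this.2 (hp.subset hzC))
      have hlen := IsCyc.length_splice hij hw Q
      have := hmax (u, _) ⟨hcyc, by
        intro z hz
        simp only [List.mem_cons, List.mem_append] at hz
        rcases hz with rfl | (hz | hz) | hz
        · exact hCU _ hu.1
        · exact hCU z (hp.subset (List.mem_cons_of_mem _ (List.mem_of_mem_take hz)))
        · have := hQH z hz
          rw [hH, mem_sdiff] at this
          exact this.1
        · exact hCU z (hp.subset (List.mem_cons_of_mem _ (List.mem_of_mem_drop hz)))⟩
      simp only at this
      omega)
  obtain ⟨j, hj⟩ := hBne
  have := this.2 ⟨0, mem_idx.2 ⟨u, by simp, hu.2⟩, j, hj, Nat.zero_le _, trivial⟩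
  omega
end

section

/-- The number of elements of `(a, b]` satisfying `p`. -/
noncomputable def cnt (p : ℕ → Prop) (a b : ℕ) : ℕ := ((Ioc a b).filter p).card

theorem cnt_le (p : ℕ → Prop) (a b : ℕ) : cnt p a b ≤ b - a := by
  simpa [cnt] using card_filter_le (Ioc a b) p

theorem cnt_mono {p q : ℕ → Prop} {a b : ℕ} (h : ∀ t, a < t → t ≤ b → p t → q t) :
    cnt p a b ≤ cnt q a b :=
  card_le_card fun t ht => by
    simp only [mem_filter, mem_Ioc] at ht ⊢
    exact ⟨ht.1, h t ht.1.1 ht.1.2 ht.2⟩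

theorem cnt_split (p : ℕ → Prop) {a b c : ℕ} (hab : a ≤ b) (hbc : b ≤ c) :
    cnt p a c = cnt p a b + cnt p b c := by
  rw [cnt, ← Ioc_union_Ioc_eq_Ioc hab hbc, filter_union, card_union_of_disjoint]
  · rfl
  · refine disjoint_filter_filter ?_
    rw [Finset.disjoint_left]
    intro x hx hx'
    simp only [mem_Ioc] at hx hx'
    omega

theorem cnt_add_le (p : ℕ → Prop) {a b : ℕ} (hab : a ≤ b) : cnt p a b + a ≤ b := by
  have := cnt_le p a b
  omega

theorem cnt_disjoint {p q : ℕ → Prop} {a b : ℕ} (hab : a ≤ b)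
    (h : ∀ t, a < t → t ≤ b → p t → ¬ q t) :
    cnt p a b + cnt q a b + a ≤ b := by
  suffices cnt p a b + cnt q a b ≤ b - a by omega
  rw [cnt, cnt, ← card_union_of_disjoint]
  · refine (card_le_card (union_subset (filter_subset _ _) (filter_subset _ _))).trans ?_
    simp
  · rw [Finset.disjoint_left]
    intro x hx hx'
    simp only [mem_filter, mem_Ioc] at hx hx'
    exact h x hx.1.1 hx.1.2 hx.2 hx'.2

theorem exists_of_cnt {p q : ℕ → Prop} {a b : ℕ} (hab : a ≤ b)
    (h : b < cnt p a b + cnt q a b + a) :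
    ∃ t, a < t ∧ t ≤ b ∧ p t ∧ q t := by
  by_contra hcon
  push Not at hcon
  exact absurd (cnt_disjoint hab hcon) (by omega)

theorem cnt_and (p q : ℕ → Prop) (a b : ℕ) :
    cnt p a b + cnt q a b ≤ cnt (fun t => p t ∧ q t) a b + (b - a) := by
  have : (Ioc a b).filter (fun t => p t ∧ q t) = (Ioc a b).filter p ∩ (Ioc a b).filter q := by
    ext t
    simp only [mem_filter, mem_inter]
    tauto
  have h : cnt (fun t => p t ∧ q t) a b = ((Ioc a b).filter p ∩ (Ioc a b).filter q).card := by
    rw [← this]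
    exact congrArg card (filter_congr_decidable _ _ _)
  rw [h, cnt, cnt, ← card_union_add_card_inter, add_comm]
  refine Nat.add_le_add_left ?_ _
  refine (card_le_card (union_subset (filter_subset _ _) (filter_subset _ _))).trans ?_
  simp

theorem exists_of_cnt_pos {p : ℕ → Prop} {a b : ℕ} (h : 0 < cnt p a b) :
    ∃ t, a < t ∧ t ≤ b ∧ p t := by
  obtain ⟨t, ht⟩ := card_pos.1 h
  simp only [mem_filter, mem_Ioc] at ht
  exact ⟨t, ht.1.1, ht.1.2, ht.2⟩

theorem card_le_cnt (p : ℕ → Prop) (a b l : ℕ) :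
    ((range l).filter p).card ≤ cnt p a b + (a + 1) + (l - (b + 1)) := by
  have : (range l).filter p ⊆ (Ioc a b).filter p ∪ range (a + 1) ∪ Ico (b + 1) l := by
    intro x hx
    simp only [mem_filter, mem_range, mem_union, mem_Ioc, mem_Ico] at hx ⊢
    by_cases h1 : x < a + 1
    · tauto
    · by_cases h2 : b + 1 ≤ x
      · tauto
      · exact Or.inl (Or.inl ⟨⟨by omega, by omega⟩, hx.2⟩)
  refine (card_le_card this).trans ((card_union_le _ _).trans ?_)
  refine (Nat.add_le_add_right (card_union_le _ _) _).trans ?_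
  simp [cnt]

theorem cnt_pred (q : ℕ → Prop) (a b : ℕ) :
    cnt (fun t => q (t - 1)) a b = ((Ico a b).filter q).card := by
  rw [cnt]
  refine Finset.card_bij' (fun t _ => t - 1) (fun t _ => t + 1) ?_ ?_ ?_ ?_
  · intro t ht
    simp only [mem_filter, mem_Ioc, mem_Ico] at ht ⊢
    exact ⟨by omega, ht.2⟩
  · intro t ht
    simp only [mem_filter, mem_Ioc, mem_Ico] at ht ⊢
    exact ⟨by omega, ht.2⟩
  · intro t ht
    simp only [mem_filter, mem_Ioc] at ht
    omega
  · intro t ht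
    simp

theorem card_le_cnt_pred (q : ℕ → Prop) (a b l : ℕ) :
    ((range l).filter q).card ≤ cnt (fun t => q (t - 1)) a b + a + (l - b) := by
  have : (range l).filter q ⊆ (Ico a b).filter q ∪ range a ∪ Ico b l := by
    intro x hx
    simp only [mem_filter, mem_range, mem_union, mem_Ico] at hx ⊢
    by_cases h1 : x < a
    · tauto
    · by_cases h2 : b ≤ x
      · tauto
      · exact Or.inl (Or.inl ⟨⟨by omega, by omega⟩, hx.2⟩)
  refine (card_le_card this).trans ((card_union_le _ _).trans ?_)
  refine (Nat.add_le_add_right (card_union_le _ _) _).trans ?_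
  simp [cnt_pred]

/-- The combinatorial core: a path with vertices `0, …, l - 1` and adjacency `E`, together with
the entry relation `α` and exit relation `β` of a further path, allowing none of the listed
rotations, contains a large pair without edges. -/
theorem exists_sparse_pair_of_no_rotation {n e l : ℕ} (he : 1 ≤ e) (hn : 1000 * e ≤ n)
    (hln : l ≤ n) (hnl : n ≤ l + e) (E : ℕ → ℕ → Prop) (α β : ℕ → Prop)
    (hα : n ≤ 2 * ((range l).filter α).card + 2 * e)
    (hβ : n ≤ 2 * ((range l).filter β).card + 2 * e)
    (hout : ∀ i < l, n ≤ 2 * ((range l).filter (E i)).card + 2 * e)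
    (hin : ∀ i < l, n ≤ 2 * ((range l).filter (E · i)).card + 2 * e)
    (hnc : ∀ i j, i < j → j < l → α i → β j → False)
    (T : ∀ w u t, 1 ≤ w → β w → α u → u + 1 < l → w < t → t ≤ u → E (w - 1) t →
      E (t - 1) (u + 1) → False)
    (T2 : ∀ w u f t, 1 ≤ w → β w → α u → u + 1 < l → w < f → f + 1 ≤ t → t ≤ u → β f →
      E (w - 1) t → E (f - 1) (u + 1) → E (t - 1) w → False)
    (T4 : ∀ w u f b t, 1 ≤ w → β w → α u → u + 1 < l → w < f → f < b → b + 1 ≤ t → t ≤ u → β b →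
      E (w - 1) t → E (t - 1) f → E (b - 1) w → E (f - 1) (u + 1) → False)
    (T3 : ∀ w₀ u t a w, 1 ≤ w₀ → β w₀ → α u → u + 1 < l → w₀ < t → t < a → a < w → w ≤ u →
      E (w₀ - 1) a → E (w - 1) t → E (a - 1) w → E (t - 1) (u + 1) → False) :
    ∃ X Y : Finset ℕ, X ⊆ range l ∧ Y ⊆ range l ∧ Disjoint X Y ∧ n ≤ 2 * X.card + 400 * e ∧
      n ≤ 2 * Y.card + 400 * e ∧ ∀ i ∈ X, ∀ j ∈ Y, ¬ E i j := by
  -- the last index `r` of `β`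
  obtain ⟨r, ⟨hrl, hrβ⟩, hrmax⟩ := exists_max_of_bounded (fun j => j < l ∧ β j) id l
    (by
      have : ((range l).filter β).Nonempty := card_pos.1 (by omega)
      obtain ⟨j, hj⟩ := this
      exact ⟨j, by simpa using hj⟩) (fun j hj => hj.1.le)
  simp only [id] at hrmax
  have hβr : ∀ j < l, β j → j ≤ r := fun j h1 h2 => hrmax j ⟨h1, h2⟩
  have hαr : ∀ i < l, α i → r ≤ i := by
    intro i _ h2
    by_contra h
    exact hnc i r (by omega) hrl h2 hrβ
  have hr1 : ((range l).filter α).card ≤ l - r := by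
    have : (range l).filter α ⊆ Ico r l := fun i hi => by
      simp only [mem_filter, mem_range, mem_Ico] at hi ⊢
      exact ⟨hαr i hi.1 hi.2, hi.1⟩
    simpa using card_le_card this
  have hr2 : ((range l).filter β).card ≤ r + 1 := by
    have : (range l).filter β ⊆ range (r + 1) := fun i hi => by
      simp only [mem_filter, mem_range] at hi ⊢
      have := hβr i hi.1 hi.2
      omega
    simpa using card_le_card this
  -- the first positive index `w` of `β` and the last non-final index `u` of `α`
  obtain ⟨w, ⟨hw1, hwr, hwβ⟩, hwmin⟩ := exists_max_of_bounded (fun j => 1 ≤ j ∧ j ≤ r ∧ β j)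
    (fun j => r - j) r ⟨r, by omega, le_rfl, hrβ⟩ (fun j hj => Nat.sub_le _ _)
  have hβw : ∀ j < l, 1 ≤ j → β j → w ≤ j := by
    intro j h1 h2 h3
    have h4 := hβr j h1 h3
    have := hwmin j ⟨h2, h4, h3⟩
    omega
  have hw2 : ((range l).filter β).card ≤ 1 + (r + 1 - w) := by
    have : (range l).filter β ⊆ {0} ∪ Icc w r := fun i hi => by
      simp only [mem_filter, mem_range, mem_union, mem_singleton, mem_Icc] at hi ⊢
      have h1 := hβr i hi.1 hi.2
      by_cases h : i = 0
      · exact Or.inl h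
      · exact Or.inr ⟨hβw i hi.1 (by omega) hi.2, h1⟩
    refine (card_le_card this).trans ((card_union_le _ _).trans ?_)
    simp
  obtain ⟨u, ⟨hu1, huα⟩, humax⟩ := exists_max_of_bounded (fun j => j + 1 < l ∧ α j) id l
    (by
      by_contra hcon
      push Not at hcon
      have : (range l).filter α ⊆ {l - 1} := fun i hi => by
        simp only [mem_filter, mem_range, mem_singleton] at hi ⊢
        by_contra h
        exact hcon i (by omega) hi.2
      have := card_le_card this
      simp at this
      omega) (fun j hj => by simp only [id]; omega)
  simp only [id] at humax
  have hru : r ≤ u := hαr u (by omega) huα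
  have hu2 : ((range l).filter α).card ≤ 1 + (u + 1 - r) := by
    have : (range l).filter α ⊆ {l - 1} ∪ Icc r u := fun i hi => by
      simp only [mem_filter, mem_range, mem_union, mem_singleton, mem_Icc] at hi ⊢
      have h1 := hαr i hi.1 hi.2
      by_cases h : i = l - 1
      · exact Or.inl h
      · exact Or.inr ⟨h1, humax i ⟨by omega, hi.2⟩⟩
    refine (card_le_card this).trans ((card_union_le _ _).trans ?_)
    simp
  set F : ℕ → Prop := fun t => E (t - 1) (u + 1) with hF
  have hwl : w - 1 < l := by omega
  have hβ1 : ((range l).filter β).card ≤ cnt β 0 r + 1 := by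
    have : (range l).filter β ⊆ {0} ∪ (Ioc 0 r).filter β := fun i hi => by
      simp only [mem_filter, mem_range, mem_union, mem_singleton, mem_Ioc] at hi ⊢
      have h1 := hβr i hi.1 hi.2
      by_cases h : i = 0
      · exact Or.inl h
      · exact Or.inr ⟨⟨by omega, h1⟩, hi.2⟩
    refine (card_le_card this).trans ((card_union_le _ _).trans ?_)
    simp [cnt, add_comm]
  have hα1 : ((range l).filter α).card ≤ cnt (fun t => α (t - 1)) r (l - 1) + 1 := by
    rw [cnt_pred]
    have : (range l).filter α ⊆ {l - 1} ∪ (Ico r (l - 1)).filter α := fun i hi => by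
      simp only [mem_filter, mem_range, mem_union, mem_singleton, mem_Ico] at hi ⊢
      have h1 := hαr i hi.1 hi.2
      by_cases h : i = l - 1
      · exact Or.inl h
      · exact Or.inr ⟨⟨h1, by omega⟩, hi.2⟩
    refine (card_le_card this).trans ((card_union_le _ _).trans ?_)
    simp [add_comm]
  -- coarse bounds
  have br1 : n ≤ 2 * r + 4 * e := by omega
  have br2 : 2 * r ≤ n + 2 * e := by omega
  have bw : w ≤ 4 * e := by omega
  have bu : n ≤ u + 5 * e := by omega
  have bβ : r ≤ cnt β 0 r + 3 * e := by omega
  have bα : l ≤ cnt (fun t => α (t - 1)) r (l - 1) + r + 4 * e := by omega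
  clear hα hβ hr1 hr2 hw2 hu2 hβ1 hα1 hαr hβr hrmax hwmin humax hβw hnc hrβ
  have hDF : ∀ t, w < t → t ≤ u → E (w - 1) t → ¬ F t := fun t h1 h2 h3 h4 =>
    T w u t hw1 hwβ huα hu1 h1 h2 h3 h4
  have bβ' : r ≤ cnt β w r + w + 3 * e := by
    have hβ2 := cnt_split β (Nat.zero_le w) hwr
    have hβ3 := cnt_add_le β (Nat.zero_le w)
    omega
  have bD : n ≤ 2 * (cnt (E (w - 1)) w r + cnt (E (w - 1)) r u) + 22 * e := by
    have hD := hout (w - 1) hwl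
    have hD1 := card_le_cnt (E (w - 1)) w u l
    have hDs := cnt_split (E (w - 1)) hwr hru
    omega
  have bF : n ≤ 2 * (cnt F w r + cnt F r u) + 22 * e := by
    have hE := hin (u + 1) hu1
    have hF1 := card_le_cnt_pred (E · (u + 1)) w u l
    have hFs : cnt F w u = cnt F w r + cnt F r u := cnt_split F hwr hru
    change ((range l).filter (E · (u + 1))).card ≤ cnt F w u + w + (l - u) at hF1
    omega
  have bDF1 : cnt (E (w - 1)) w r + cnt F w r + w ≤ r :=
    cnt_disjoint hwr fun t h1 h2 h3 => hDF t h1 (by omega) h3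
  have bDF2 : cnt (E (w - 1)) r u + cnt F r u + r ≤ u :=
    cnt_disjoint hru fun t h1 h2 h3 => hDF t (by omega) h2 h3
  by_cases c1 : cnt (E (w - 1)) r u ≤ 45 * e
  · refine ⟨(Ico 0 r).filter (fun i => β (i + 1)), (Ioc r u).filter F, ?_, ?_, ?_, ?_, ?_, ?_⟩
    · intro i hi
      simp only [mem_filter, mem_Ico, mem_range] at hi ⊢
      omega
    · intro i hi
      simp only [mem_filter, mem_Ioc, mem_range] at hi ⊢
      omega
    · rw [Finset.disjoint_left]
      intro i hi hi'
      simp only [mem_filter, mem_Ico, mem_Ioc] at hi hi'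
      omega
    · rw [← cnt_pred]
      have : cnt β 0 r ≤ cnt (fun t => β (t - 1 + 1)) 0 r := cnt_mono fun t h1 _ h2 => by
        rwa [Nat.sub_add_cancel h1]
      omega
    · change n ≤ 2 * cnt F r u + 400 * e
      omega
    · intro i hi j hj hij
      simp only [mem_filter, mem_Ico, mem_Ioc] at hi hj
      exact T (i + 1) u j (by omega) hi.2 huα hu1 (by omega) hj.1.2 (by simpa using hij) hj.2
  by_cases c2 : cnt (E (w - 1)) w r ≤ 45 * e
  · have bF' : r ≤ cnt F w r + 75 * e := by omega
    have bD' : n ≤ 2 * cnt (E (w - 1)) r u + 112 * e := by omega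
    clear c1 c2 bD bF bDF1 bDF2 bα
    obtain ⟨f, hf1, hf2, hf3, hf4⟩ :=
      exists_of_cnt (p := β) (q := F) (a := w) (b := r) hwr (by omega)
    set I : ℕ → Prop := fun t => E (t - 1) w with hI
    have hr1u : r + 1 ≤ u := by omega
    have bD'' : n ≤ 2 * cnt (E (w - 1)) (r + 1) u + 114 * e := by
      have hDs' := cnt_split (E (w - 1)) (Nat.le_succ r) hr1u
      have hD2 := cnt_add_le (E (w - 1)) (Nat.le_succ r)
      simp only [Nat.succ_eq_add_one] at *
      omega
    have hDI : cnt (E (w - 1)) (r + 1) u + cnt I (r + 1) u + (r + 1) ≤ u :=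
      cnt_disjoint hr1u fun t h1 h2 h3 h4 =>
        T2 w u f t hw1 hwβ huα hu1 hf1 (by omega) h2 hf3 h3 hf4 h4
    have bI : r ≤ cnt I 0 r + 70 * e := by
      have hI1 := card_le_cnt_pred (E · w) 0 u l
      change ((range l).filter (E · w)).card ≤ cnt I 0 u + 0 + (l - u) at hI1
      have hIn := hin w (by omega)
      have hIs := cnt_split I (Nat.zero_le r) hru
      have hIs' := cnt_split I (Nat.le_succ r) hr1u
      have hI2 := cnt_add_le I (Nat.le_succ r)
      simp only [Nat.succ_eq_add_one] at *
      omega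
    have bIβ : r ≤ cnt (fun t => I t ∧ β t) 0 r + 73 * e := by
      have hIβ := cnt_and I β 0 r
      omega
    clear bI hDI bD'
    obtain ⟨b, ⟨hb1, hb2, hb3, hb4⟩, hbmax⟩ := exists_max_of_bounded
      (fun j => 0 < j ∧ j ≤ r ∧ I j ∧ β j) id l (by
        have : 0 < cnt (fun t => I t ∧ β t) 0 r := by omega
        exact exists_of_cnt_pos this) (fun j hj => by simp only [id]; omega)
    simp only [id] at hbmax
    have bb : r ≤ b + 73 * e := by
      have hbc := cnt_split (fun t => I t ∧ β t) (Nat.zero_le b) hb2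
      have hbc1 := cnt_le (fun t => I t ∧ β t) 0 b
      have hbc2 : cnt (fun t => I t ∧ β t) b r = 0 := by
        by_contra h
        obtain ⟨t, ht1, ht2, ht⟩ := exists_of_cnt_pos (Nat.pos_of_ne_zero h)
        have := hbmax t ⟨by omega, ht2, ht⟩
        omega
      omega
    have bF'' : r ≤ cnt F w (b - 1) + 149 * e := by
      have hwb : w ≤ b - 1 := by omega
      have hFb := cnt_split F hwb (show b - 1 ≤ r by omega)
      have hFb' := cnt_le F (b - 1) r
      omega
    clear hbmax
    refine ⟨(Ico (r + 1) u).filter (fun i => E (w - 1) (i + 1)), (Ioc w (b - 1)).filter F,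
      ?_, ?_, ?_, ?_, ?_, ?_⟩
    · intro i hi
      simp only [mem_filter, mem_Ico, mem_range] at hi ⊢
      omega
    · intro i hi
      simp only [mem_filter, mem_Ioc, mem_range] at hi ⊢
      omega
    · rw [Finset.disjoint_left]
      intro i hi hi'
      simp only [mem_filter, mem_Ico, mem_Ioc] at hi hi'
      omega
    · rw [← cnt_pred]
      have : cnt (E (w - 1)) (r + 1) u ≤ cnt (fun t => E (w - 1) (t - 1 + 1)) (r + 1) u :=
        cnt_mono fun t h1 _ h2 => by rwa [Nat.sub_add_cancel (by omega)]
      omega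
    · change n ≤ 2 * cnt F w (b - 1) + 400 * e
      omega
    · intro i hi j hj hij
      simp only [mem_filter, mem_Ico, mem_Ioc] at hi hj
      exact T4 w u j b (i + 1) hw1 hwβ huα hu1 hj.1.1 (by omega) (by omega) (by omega) hb4 hi.2
        (by simpa using hij) hb3 hj.2
  · exfalso
    have bF' : 25 * e ≤ cnt F w r := by omega
    clear bD bF bDF1 bDF2 hDF
    have hmiss : ∀ i, w < i → i ≤ r → E (w - 1) i → r ≤ cnt (E (i - 1)) 0 r + 9 * e := by
      intro i h1 h2 h3
      have h4 := hout (i - 1) (by omega)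
      have h5 := card_le_cnt (E (i - 1)) 0 (l - 1) l
      have h6 := cnt_split (E (i - 1)) (Nat.zero_le r) (show r ≤ l - 1 by omega)
      have h7 : cnt (E (i - 1)) r (l - 1) + cnt (fun t => α (t - 1)) r (l - 1) + r ≤ l - 1 :=
        cnt_disjoint (by omega) fun t g1 g2 g3 g4 =>
          T w (t - 1) i hw1 hwβ g4 (by omega) h1 (by omega) h3
            (by rwa [Nat.sub_add_cancel (by omega)])
      omega
    clear bα bβ
    obtain ⟨a, ⟨ha1, ha2, ha3, ha4⟩, hamin⟩ := exists_max_of_bounded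
      (fun j => w < j ∧ j ≤ r ∧ E (w - 1) j ∧ β j) (fun j => r - j) r (by
        obtain ⟨t, h⟩ := exists_of_cnt (p := E (w - 1)) (q := β) (a := w) (b := r) hwr (by omega)
        exact ⟨t, h⟩) (fun j hj => Nat.sub_le _ _)
    have hma := hmiss a ha1 ha2 ha3
    have bDa : 40 * e ≤ cnt (E (w - 1)) a r := by
      have hDa := cnt_split (E (w - 1)) ha1.le ha2
      have hDa' := cnt_split (E (w - 1)) (show w ≤ a - 1 by omega) (show a - 1 ≤ a by omega)
      have hDa1 := cnt_le (E (w - 1)) (a - 1) a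
      have hβa' := cnt_split β (show w ≤ a - 1 by omega) (show a - 1 ≤ r by omega)
      have hβa1 := cnt_add_le β (show a - 1 ≤ r by omega)
      have hDβ : cnt (E (w - 1)) w (a - 1) + cnt β w (a - 1) + w ≤ a - 1 :=
        cnt_disjoint (by omega) fun t g1 g2 g3 g4 => by
          have := hamin t ⟨g1, by omega, g3, g4⟩
          omega
      omega
    have bEa : r ≤ cnt (E (a - 1)) a r + a + 9 * e := by
      have hEa := cnt_split (E (a - 1)) (Nat.zero_le a) ha2
      have hEa1 := cnt_add_le (E (a - 1)) (Nat.zero_le a)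
      omega
    clear hma hamin
    obtain ⟨w', hw'1, hw'2, hw'3, hw'4⟩ := exists_of_cnt (p := E (w - 1)) (q := E (a - 1))
      (a := a) (b := r) ha2 (by omega)
    have bFa : 14 * e ≤ cnt F w (a - 1) := by
      have hFE : cnt (E (a - 1)) a r + cnt F a r + a ≤ r :=
        cnt_disjoint ha2 fun t g1 g2 g3 g4 =>
          T a u t (by omega) ha4 huα hu1 g1 (by omega) g3 g4
      have hFa := cnt_split F (show w ≤ a - 1 by omega) (show a - 1 ≤ r by omega)
      have hFa' := cnt_split F (show a - 1 ≤ a by omega) ha2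
      have hFa1 := cnt_le F (a - 1) a
      omega
    have bEw : a - 1 ≤ cnt (E (w' - 1)) w (a - 1) + w + 9 * e := by
      have hmw := hmiss w' (by omega) hw'2 hw'3
      have hEw := cnt_split (E (w' - 1)) (Nat.zero_le (a - 1)) (show a - 1 ≤ r by omega)
      have hEw1 := cnt_add_le (E (w' - 1)) (show a - 1 ≤ r by omega)
      have hEw2 := cnt_split (E (w' - 1)) (Nat.zero_le w) (show w ≤ a - 1 by omega)
      have hEw3 := cnt_add_le (E (w' - 1)) (Nat.zero_le w)
      omega
    obtain ⟨t, ht1, ht2, ht3, ht4⟩ := exists_of_cnt (p := F) (q := E (w' - 1))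
      (a := w) (b := a - 1) (by omega) (by omega)
    exact T3 w u t a w' hw1 hwβ huα hu1 ht1 (by omega) hw'1 (by omega) ha3 ht4 hw'4 ht3
end

section

variable {V : Type*} {G : V → V → Prop}

/-- `l` is a directed walk from `a` to `b`. -/
def IsWalk (G : V → V → Prop) (l : List V) (a b : V) : Prop :=
  l.IsChain G ∧ l.head? = some a ∧ l.getLast? = some b

theorem IsWalk.append {l l' : List V} {a b c d : V} (h : IsWalk G l a b) (h' : IsWalk G l' c d)
    (hbc : G b c) : IsWalk G (l ++ l') a d := by
  refine ⟨List.isChain_append.2 ⟨h.1, h'.1, ?_⟩, ?_, ?_⟩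
  · intro z hz w hw
    rw [h.2.2] at hz
    rw [h'.2.1] at hw
    simp at hz hw
    exact hz ▸ hw ▸ hbc
  · rw [List.head?_append, h.2.1]
    rfl
  · rw [List.getLast?_append, h'.2.2]
    rfl

/-- The entries of `p` with indices in `[a, b)`. -/
def slice (p : List V) (a b : ℕ) : List V := (p.drop a).take (b - a)

theorem slice_append (p : List V) {a b c : ℕ} (hab : a ≤ b) (hbc : b ≤ c) :
    slice p a b ++ slice p b c = slice p a c := by
  rw [slice, slice, slice, show c - a = (b - a) + (c - b) by omega, List.take_add, List.drop_drop,
    show a + (b - a) = b by omega]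

theorem slice_full (p : List V) : slice p 0 p.length = p := by
  simp [slice]

theorem isWalk_slice {p : List V} (hp : p.IsChain G) {a b : ℕ} (hab : a < b)
    {x y : V} (hx : p[a]? = some x) (hy : p[b - 1]? = some y) : IsWalk G (slice p a b) x y := by
  refine ⟨(hp.drop a).take _, ?_, ?_⟩
  · rw [slice, List.head?_take, if_neg (by omega), List.head?_drop, hx]
  · rw [slice, List.getLast?_take, if_neg (by omega), List.getElem?_drop,
      show a + (b - a - 1) = b - 1 by omega, hy]
    rfl

variable [Fintype V]

theorem card_filter_le_idx (f : V → Prop) {p : List V} (hp : p.Nodup) :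
    (univ.filter f).card + p.length ≤ (idx f p).card + Fintype.card V := by
  rw [card_idx f hp, ← List.toFinset_card_of_nodup hp, ← card_univ]
  have h1 : univ.filter f ⊆ p.toFinset.filter f ∪ (univ \ p.toFinset) := by
    intro v hv
    simp only [mem_filter, mem_union, mem_sdiff, mem_univ, true_and] at hv ⊢
    tauto
  have h2 := (card_le_card h1).trans (card_union_le _ _)
  have h3 := card_sdiff_add_card_eq_card (subset_univ p.toFinset)
  omega

theorem exists_sparse_pair_of_path {e : ℕ} (he : 1 ≤ e) (hn : 1000 * e ≤ Fintype.card V)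
    (hout : ∀ v, Fintype.card V ≤ 2 * (univ.filter (G v ·)).card)
    (hin : ∀ v, Fintype.card V ≤ 2 * (univ.filter (G · v)).card)
    {p Q : List V} (hp : p.IsChain G) (hpn : p.Nodup) (hpe : Fintype.card V ≤ p.length + e)
    {x y : V} (hQ : IsWalk G Q x y)
    (hnc : ∀ (i j : ℕ) (a b : V), i < j → p[i]? = some a → p[j]? = some b → G a x → G y b → False)
    (hno : ∀ p' : List V, p'.IsChain G → p'.Perm (p ++ Q) → p'.head? = p.head? →
      p'.getLast? = p.getLast? → False) :
    ∃ X Y : Finset V, Disjoint X Y ∧ Fintype.card V ≤ 2 * X.card + 400 * e ∧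
      Fintype.card V ≤ 2 * Y.card + 400 * e ∧ ∀ a ∈ X, ∀ b ∈ Y, ¬ G a b := by
  set l := p.length with hl
  have hln : l ≤ Fintype.card V := hpn.length_le_card
  set v : ℕ → V := fun i => p[i]?.getD x with hv
  have hpv : ∀ i < l, p[i]? = some (v i) := by
    intro i hi
    simp only [hv]
    rw [List.getElem?_eq_getElem hi]
    rfl
  have hidx : ∀ f : V → Prop, idx f p = (range l).filter (fun i => f (v i)) := by
    intro f
    ext i
    simp only [mem_idx, mem_filter, mem_range]
    constructor
    · rintro ⟨z, hz, hfz⟩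
      have hi : i < l := (List.getElem?_eq_some_iff.1 hz).1
      rw [hpv i hi] at hz
      cases hz
      exact ⟨hi, hfz⟩
    · rintro ⟨hi, hf⟩
      exact ⟨v i, hpv i hi, hf⟩
  have hcard : ∀ f : V → Prop, Fintype.card V ≤ 2 * (univ.filter f).card →
      Fintype.card V ≤ 2 * ((range l).filter (fun i => f (v i))).card + 2 * e := by
    intro f hf
    have := card_filter_le_idx f hpn
    rw [hidx] at this
    omega
  have hsl : ∀ a b, a < b → b ≤ l → IsWalk G (slice p a b) (v a) (v (b - 1)) :=
    fun a b hab hb => isWalk_slice hp hab (hpv a (by omega)) (hpv (b - 1) (by omega))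
  have hct : ∀ z a b c, a ≤ b → b ≤ c →
      List.count z (slice p a c) = List.count z (slice p a b) + List.count z (slice p b c) := by
    intro z a b c hab hbc
    rw [← slice_append p hab hbc, List.count_append]
  have hcp : ∀ z, List.count z p = List.count z (slice p 0 l) := fun z => by rw [slice_full]
  have hfin : ∀ p' : List V, 0 < l → IsWalk G p' (v 0) (v (l - 1)) →
      (∀ z, List.count z p' = List.count z p + List.count z Q) → False := by
    intro p' h0 h1 h2
    refine hno p' h1.1 (List.perm_iff_count.2 fun z => by rw [List.count_append, h2]) ?_ ?_
    · rw [h1.2.1, List.head?_eq_getElem?, hpv 0 h0]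
    · rw [h1.2.2, List.getLast?_eq_getElem?, hpv (l - 1) (by omega)]
  obtain ⟨X, Y, hX, hY, hXY, hXc, hYc, hno'⟩ := exists_sparse_pair_of_no_rotation he hn hln hpe
    (fun i j => G (v i) (v j)) (fun i => G (v i) x) (fun j => G y (v j))
    (hcard (G · x) (hin x)) (hcard (G y ·) (hout y))
    (fun i _ => hcard (G (v i) ·) (hout (v i))) (fun i _ => hcard (G · (v i)) (hin (v i)))
    (fun i j hij hj h1 h2 => hnc i j _ _ hij (hpv i (by omega)) (hpv j hj) h1 h2)
    (by
      intro w u t h1 hβ hα hu h2 h3 e1 e2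
      refine hfin (slice p 0 w ++ (slice p t (u + 1) ++ (Q ++ (slice p w t ++ slice p (u + 1) l))))
        (by omega) ?_ ?_
      · exact (hsl 0 w h1 (by omega)).append ((hsl t (u + 1) (by omega) (by omega)).append
          (hQ.append ((hsl w t h2 (by omega)).append (hsl (u + 1) l hu le_rfl) e2) hβ) hα) e1
      · intro z
        rw [hcp z, hct z 0 w l (by omega) (by omega), hct z w t l (by omega) (by omega),
          hct z t (u + 1) l (by omega) (by omega)]
        simp only [List.count_append]
        ring)
    (by
      intro w u f t h1 hβ hα hu h2 h3 h4 hβ' e1 e2 e3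
      refine hfin (slice p 0 w ++ (slice p t (u + 1) ++ (Q ++ (slice p f t ++ (slice p w f ++
        slice p (u + 1) l))))) (by omega) ?_ ?_
      · exact (hsl 0 w h1 (by omega)).append ((hsl t (u + 1) (by omega) (by omega)).append
          (hQ.append ((hsl f t (by omega) (by omega)).append ((hsl w f h2 (by omega)).append
            (hsl (u + 1) l hu le_rfl) e2) e3) hβ') hα) e1
      · intro z
        rw [hcp z, hct z 0 w l (by omega) (by omega), hct z w f l (by omega) (by omega),
          hct z f t l (by omega) (by omega), hct z t (u + 1) l (by omega) (by omega)]
        simp only [List.count_append]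
        ring)
    (by
      intro w u f b t h1 hβ hα hu h2 h3 h4 h5 hβ' e1 e2 e3 e4
      refine hfin (slice p 0 w ++ (slice p t (u + 1) ++ (Q ++ (slice p b t ++ (slice p f b ++
        (slice p w f ++ slice p (u + 1) l)))))) (by omega) ?_ ?_
      · exact (hsl 0 w h1 (by omega)).append ((hsl t (u + 1) (by omega) (by omega)).append
          (hQ.append ((hsl b t (by omega) (by omega)).append ((hsl f b h3 (by omega)).append
            ((hsl w f h2 (by omega)).append
            (hsl (u + 1) l hu le_rfl) e4) e3) e2) hβ') hα) e1
      · intro z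
        rw [hcp z, hct z 0 w l (by omega) (by omega), hct z w f l (by omega) (by omega),
          hct z f b l (by omega) (by omega),
          hct z b t l (by omega) (by omega), hct z t (u + 1) l (by omega) (by omega)]
        simp only [List.count_append]
        ring)
    (by
      intro w₀ u t a w h1 hβ hα hu h2 h3 h4 h5 e1 e2 e3 e4
      refine hfin (slice p 0 w₀ ++ (slice p a w ++ (slice p t a ++ (slice p w (u + 1) ++ (Q ++
        (slice p w₀ t ++ slice p (u + 1) l)))))) (by omega) ?_ ?_
      · exact (hsl 0 w₀ h1 (by omega)).append ((hsl a w (by omega) (by omega)).append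
          ((hsl t a h3 (by omega)).append ((hsl w (u + 1) (by omega) (by omega)).append
          (hQ.append ((hsl w₀ t h2 (by omega)).append
            (hsl (u + 1) l hu le_rfl) e4) hβ) hα) e3) e2) e1
      · intro z
        rw [hcp z, hct z 0 w₀ l (by omega) (by omega), hct z w₀ t l (by omega) (by omega),
          hct z t a l (by omega) (by omega),
          hct z a w l (by omega) (by omega), hct z w (u + 1) l (by omega) (by omega)]
        simp only [List.count_append]
        ring)
  have hinj : Set.InjOn v (range l : Set ℕ) := by
    intro i hi j hj hij
    have hi' := hpv i (by simpa using hi)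
    have hj' := hpv j (by simpa using hj)
    rw [hij, ← hj'] at hi'
    exact (List.getElem?_inj (by simpa using hi) hpn).1 hi'
  have hXi := hinj.mono (show (X : Set ℕ) ⊆ _ by exact_mod_cast hX)
  have hYi := hinj.mono (show (Y : Set ℕ) ⊆ _ by exact_mod_cast hY)
  refine ⟨X.image v, Y.image v, ?_, ?_, ?_, ?_⟩
  · rw [Finset.disjoint_left]
    intro z hz hz'
    obtain ⟨i, hi, rfl⟩ := mem_image.1 hz
    obtain ⟨j, hj, hij⟩ := mem_image.1 hz'
    have := hinj (hY hj) (hX hi) hij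
    subst this
    exact Finset.disjoint_left.1 hXY hi hj
  · rwa [card_image_of_injOn hXi]
  · rwa [card_image_of_injOn hYi]
  · intro a ha b hb
    obtain ⟨i, hi, rfl⟩ := mem_image.1 ha
    obtain ⟨j, hj, rfl⟩ := mem_image.1 hb
    exact hno' i hi j hj

/-- A cycle whose segment from `s₀` to `s₁` is almost spanning can be turned into a Hamilton cycle
respecting the prescribed order, unless there is a large pair without edges. -/
theorem exists_hamilton_of_long_segment (hG : ∀ x, ¬ G x x) {e : ℕ} (he : 1 ≤ e)
    (hn : 1000 * e ≤ Fintype.card V)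
    (hout : ∀ v, Fintype.card V + 1 ≤ 2 * (univ.filter (G v ·)).card)
    (hin : ∀ v, Fintype.card V + 1 ≤ 2 * (univ.filter (G · v)).card)
    (hext : ¬ ∃ X Y : Finset V, Disjoint X Y ∧ Fintype.card V ≤ 2 * X.card + 400 * e ∧
      Fintype.card V ≤ 2 * Y.card + 400 * e ∧ ∀ a ∈ X, ∀ b ∈ Y, ¬ G a b)
    {s₀ s₁ : V} {t p r : List V} (hC : IsCyc G s₀ (p ++ s₁ :: r)) (ht : t.Sublist r)
    (hp : Fintype.card V ≤ p.length + e) :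
    ∃ m, IsCyc G s₀ m ∧ (∀ v, v ∈ s₀ :: m) ∧ (s₁ :: t).Sublist m := by
  obtain ⟨⟨p', r'⟩, ⟨hC', ht', hp'⟩, hmax⟩ := exists_max_of_bounded
    (fun x : List V × List V => IsCyc G s₀ (x.1 ++ s₁ :: x.2) ∧ t.Sublist x.2 ∧
      Fintype.card V ≤ x.1.length + e) (fun x => x.1.length + x.2.length) (Fintype.card V)
    ⟨(p, r), hC, ht, hp⟩ (fun x hx => by
      have := hx.1.2.length_le_card
      simp at this
      omega)
  clear hC ht hp p r
  simp only at hC' ht' hp' hmax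
  rename' p' => p, r' => r, hC' => hC, ht' => ht, hp' => hp
  refine ⟨p ++ s₁ :: r, hC, ?_, ?_⟩
  swap
  · exact (List.Sublist.cons_cons _ ht).trans (List.sublist_append_right _ _)
  by_contra hcon
  push Not at hcon
  obtain ⟨v, hv⟩ := hcon
  set m := p ++ s₁ :: r with hm
  set H := univ \ (s₀ :: m).toFinset with hH
  obtain ⟨Q, x, y, hQ, hQn, hQH, hx, hy, -, -, hxc, hyc⟩ := exists_longest_path (G := G) hG
    (H := H) ⟨v, by simp only [hH, mem_sdiff, List.mem_toFinset]; exact ⟨mem_univ _, hv⟩⟩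
  have hQd : ∀ z ∈ Q, z ∉ s₀ :: m := fun z hz hz' => by
    have := hQH z hz
    rw [hH, mem_sdiff, List.mem_toFinset] at this
    exact this.2 hz'
  have hHc := length_le_card_of_subset hQn hQH
  have hsplit : ∀ f : V → Prop, (univ.filter f).card =
      (H.filter f).card + ((s₀ :: m).toFinset.filter f).card := by
    intro f
    rw [hH, ← card_union_of_disjoint, ← filter_union, sdiff_union_of_subset (subset_univ _)]
    exact disjoint_filter_filter sdiff_disjoint
  have hUc : Fintype.card V = H.card + (m.length + 1) := by
    have := hsplit (fun _ => True)
    rwa [filter_true, filter_true, filter_true, List.toFinset_card_of_nodup hC.2, card_univ] at this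
  have hml : m.length = p.length + (r.length + 1) := by simp [hm]
  have h1 := hout y
  have h2 := hin x
  rw [hsplit] at h1 h2
  rw [← toFinset_append_singleton, ← card_idx _ hC.nodup'] at h1
  rw [← card_idx _ hC.2] at h2
  have hcr := crossing_bound (m.length + 1) Q.length (idx (G · x) (s₀ :: m))
    (idx (G y ·) (m ++ [s₀]))
    (by simpa using idx_subset (G · x) (s₀ :: m)) (by simpa using idx_subset (G y ·) (m ++ [s₀]))
    (fun i j => i = j ∨ j ≤ p.length) (by intros; omega) (by simp) (by omega) (by
      intro i hi j hj hij hP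
      obtain ⟨a, ha, hax⟩ := mem_idx.1 hi
      obtain ⟨b, hb, hyb⟩ := mem_idx.1 hj
      have hcyc := hC.splice hij ha hb (isChain_cons_append_singleton hQ hx hy hax hyb) hQn hQd
      by_contra hlt
      by_cases hjp : j ≤ p.length
      · rw [hm, List.take_append_of_le_length (by omega), List.drop_append_of_le_length hjp,
          ← List.append_assoc] at hcyc
        have := hmax (_, _) ⟨hcyc, ht, by simp; omega⟩
        simp at this
        omega
      · obtain rfl : i = j := by omega
        obtain ⟨d, rfl⟩ : ∃ d, i = p.length + (d + 1) := ⟨i - p.length - 1, by omega⟩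
        rw [hm, List.take_length_add_append, List.drop_length_add_append, List.take_succ_cons,
          List.drop_succ_cons, List.append_assoc, List.append_assoc, List.cons_append] at hcyc
        have := hmax (_, _) ⟨hcyc, ?_, hp⟩
        · simp at this
          omega
        · refine ht.trans ?_
          conv_lhs => rw [← List.take_append_drop d r]
          exact List.Sublist.append (List.Sublist.refl _) (List.sublist_append_right _ _))
  have hnocross : ∀ i j a b, i ≤ j → j ≤ p.length → (s₀ :: m)[i]? = some a →
      (m ++ [s₀])[j]? = some b → G a x → G y b → False := by
    intro i j a b hij hj ha hb hax hyb
    have := hcr.2 ⟨i, mem_idx.2 ⟨a, ha, hax⟩, j, mem_idx.2 ⟨b, hb, hyb⟩, hij, Or.inr hj⟩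
    omega
  have hpC : p.IsChain G := by
    have := hC.1.tail
    rw [hm] at this
    simp only [List.tail_cons, List.append_assoc] at this
    exact this.left_of_append
  have hpn : p.Nodup := by
    have := (List.nodup_cons.1 hC.2).2
    rw [hm] at this
    exact (List.nodup_append'.1 this).1
  refine hext (exists_sparse_pair_of_path he hn (fun v => by have := hout v; omega)
    (fun v => by have := hin v; omega) hpC hpn hp ⟨hQ, hx, hy⟩ ?_ ?_)
  · intro i j a b hij ha hb hax hyb
    have hj := (List.getElem?_eq_some_iff.1 hb).1
    refine hnocross (i + 1) j a b hij hj.le ?_ ?_ hax hyb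
    · rw [List.getElem?_cons_succ, hm, List.getElem?_append_left (by omega), ha]
    · rw [hm, List.append_assoc, List.getElem?_append_left (by omega), hb]
  · intro p' h1 h2 h3 h4
    have hp0 : p ≠ [] := by
      rintro rfl
      simp at hp
      omega
    have hcyc : IsCyc G s₀ (p' ++ s₁ :: r) := by
      refine ⟨?_, ?_⟩
      · have hc := hC.1
        rw [hm, List.append_assoc, List.cons_append, List.isChain_cons, List.isChain_append] at hc
        rw [List.append_assoc, List.cons_append, List.isChain_cons, List.isChain_append]
        refine ⟨?_, h1, hc.2.2.1, ?_⟩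
        · intro z hz
          refine hc.1 z ?_
          rw [List.head?_append] at hz ⊢
          rwa [h3] at hz
        · rw [h4]
          exact hc.2.2.2
      · have hperm : (s₀ :: (p' ++ s₁ :: r)).Perm (Q ++ s₀ :: m) := by
          rw [List.perm_iff_count] at h2 ⊢
          intro z
          have := h2 z
          rw [hm]
          simp only [List.count_append, List.count_cons] at this ⊢
          omega
        rw [hperm.nodup_iff, List.nodup_append']
        exact ⟨hQn, hC.2, fun z hz hz' => hQd z hz hz'⟩
    have hlen := h2.length_eq
    rw [List.length_append] at hlen
    have := hmax (p', r) ⟨hcyc, ht, by simp only; omega⟩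
    simp only at this
    omega
end

section

/-- Exponential concentration for sums of independent uniform samples, as a counting bound. -/
theorem card_filter_sum_nonneg_le {α : Type*} [Fintype α] (f : α → ℝ) {η : ℝ} (hη : 0 ≤ η)
    (hη1 : η ≤ 1) (hf : ∀ a, |f a| ≤ 1) (hs : ∑ a, f a ≤ -η * Fintype.card α) (m : ℕ) :
    ((univ.filter fun ω : Fin m → α => 0 ≤ ∑ i, f (ω i)).card : ℝ) ≤
      ((Fintype.card α : ℝ) * (1 - η ^ 2 / 4)) ^ m := by
  have h1 : ((univ.filter fun ω : Fin m → α => 0 ≤ ∑ i, f (ω i)).card : ℝ) ≤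
      ∑ ω : Fin m → α, ∏ i, Real.exp (η / 2 * f (ω i)) := by
    rw [card_filter]
    push_cast
    refine sum_le_sum fun ω _ => ?_
    rw [← Real.exp_sum, ← mul_sum]
    split_ifs with h
    · exact Real.one_le_exp (by positivity)
    · exact (Real.exp_pos _).le
  refine h1.trans ?_
  have h2 : ∑ ω : Fin m → α, ∏ i, Real.exp (η / 2 * f (ω i)) =
      (∑ a, Real.exp (η / 2 * f a)) ^ m := by
    rw [Finset.sum_pow']
    simp
  rw [h2]
  refine pow_le_pow_left₀ (sum_nonneg fun _ _ => (Real.exp_pos _).le) ?_ m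
  have h3 : ∀ a, Real.exp (η / 2 * f a) ≤ 1 + η / 2 * f a + η ^ 2 / 4 := by
    intro a
    have hb := abs_le.1 (hf a)
    have h4 : |η / 2 * f a| ≤ 1 := by
      rw [abs_mul, abs_of_nonneg (by positivity)]
      nlinarith [hf a, abs_nonneg (f a)]
    have h5 := (abs_le.1 (Real.abs_exp_sub_one_sub_id_le h4)).2
    have h6 : (f a) ^ 2 ≤ 1 := (sq_le_one_iff_abs_le_one _).2 (hf a)
    nlinarith [sq_nonneg η]
  refine (sum_le_sum fun a _ => h3 a).trans ?_
  rw [sum_add_distrib, sum_add_distrib, ← mul_sum]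
  simp only [sum_const, card_univ, nsmul_eq_mul]
  nlinarith

variable {V : Type*} [Fintype V]

theorem card_filter_sum_pair_nonneg_le (f : V → V → ℝ) {η : ℝ} (hη : 0 ≤ η)
    (hη1 : η ≤ 1) (hf : ∀ a b, |f a b| ≤ 1)
    (hs : ∑ a, ∑ b, f a b ≤ -η * (Fintype.card V : ℝ) ^ 2) (m : ℕ) :
    ((univ.filter fun ω : Fin m × Bool → V => 0 ≤ ∑ i, f (ω (i, false)) (ω (i, true))).card : ℝ) ≤
      (Fintype.card (Fin m × Bool → V) : ℝ) * (1 - η ^ 2 / 4) ^ m := by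
  have h := card_filter_sum_nonneg_le (fun x : V × V => f x.1 x.2) hη hη1 (fun x => hf x.1 x.2)
    (by rw [Fintype.sum_prod_type]; simpa [sq] using hs) m
  let e : (Fin m × Bool → V) ≃ (Fin m → V × V) :=
    (Equiv.curry _ _ _).trans (Equiv.piCongrRight fun _ => Equiv.boolArrowEquivProd V)
  have he : (univ.filter fun ω : Fin m × Bool → V =>
      0 ≤ ∑ i, f (ω (i, false)) (ω (i, true))).card =
      (univ.filter fun ω : Fin m → V × V => 0 ≤ ∑ i, f (ω i).1 (ω i).2).card := by
    refine Finset.card_equiv e fun ω => ?_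
    simp [e, Equiv.curry, Function.curry]
  rw [he]
  refine h.trans_eq ?_
  rw [mul_pow]
  simp [pow_mul]
  left
  ring

theorem card_filter_apply_eq {ι : Type*} [Fintype ι] [DecidableEq ι] {x y : ι} (hxy : x ≠ y) :
    (univ.filter fun ω : ι → V => ω x = ω y).card * Fintype.card V ≤ Fintype.card (ι → V) := by
  rw [← card_univ, ← card_univ, ← card_product]
  refine card_le_card_of_injOn (fun p => Function.update p.1 x p.2) (by simp) ?_
  rintro ⟨ω, v⟩ h ⟨ω', v'⟩ h' heq
  simp only [coe_product, Set.mem_prod, coe_filter, mem_univ, true_and, Set.mem_ofPred_eq]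
    at h h' heq
  have h1 : v = v' := by simpa using congrFun heq x
  have h2 : ∀ z, z ≠ x → ω z = ω' z := fun z hz => by simpa [hz] using congrFun heq z
  refine Prod.ext (funext fun z => ?_) h1
  by_cases hz : z = x
  · subst hz
    simp only
    rw [h.1, h'.1, h2 y hxy.symm]
  · exact h2 z hz

theorem card_filter_apply_mem {ι : Type*} [Fintype ι] [DecidableEq ι] (x : ι) (S : Finset V) :
    (univ.filter fun ω : ι → V => ω x ∈ S).card * Fintype.card V ≤
      S.card * Fintype.card (ι → V) := by
  rw [← card_univ, ← card_univ, ← card_product, ← card_product]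
  refine card_le_card_of_injOn (fun p => (p.1 x, Function.update p.1 x p.2)) ?_ ?_
  · rintro ⟨ω, v⟩ h
    simpa using h
  rintro ⟨ω, v⟩ h ⟨ω', v'⟩ h' heq
  simp only [Prod.mk.injEq] at heq
  have h1 : v = v' := by simpa using congrFun heq.2 x
  have h2 : ∀ z, z ≠ x → ω z = ω' z := fun z hz => by simpa [hz] using congrFun heq.2 z
  refine Prod.ext (funext fun z => ?_) h1
  by_cases hz : z = x
  · subst hz
    exact heq.1
  · exact h2 z hz

theorem exists_of_card_bad_lt {Ω : Type*} [Fintype Ω] {ι : Type*} (s : Finset ι)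
    (bad : ι → Ω → Prop) (c : ι → ℝ) (hb : ∀ i ∈ s, ((univ.filter (bad i)).card : ℝ) ≤ c i)
    (hc : ∑ i ∈ s, c i < Fintype.card Ω) : ∃ ω, ∀ i ∈ s, ¬ bad i ω := by
  by_contra hcon
  push Not at hcon
  have : (univ : Finset Ω) ⊆ s.biUnion fun i => univ.filter (bad i) := by
    intro ω _
    obtain ⟨i, hi, hω⟩ := hcon ω
    simp only [mem_biUnion, mem_filter, mem_univ, true_and]
    exact ⟨i, hi, hω⟩
  have h1 := (card_le_card this).trans card_biUnion_le
  rw [card_univ] at h1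
  have h2 : (Fintype.card Ω : ℝ) ≤ ∑ i ∈ s, ((univ.filter (bad i)).card : ℝ) := by
    exact_mod_cast h1
  linarith [sum_le_sum hb]

theorem eventually_union_bound {ρ : ℝ} (hρ0 : 0 < ρ) (hρ1 : ρ < 1) (k : ℕ) :
    ∃ m₀ : ℕ, ∀ m ≥ m₀, ∀ n : ℕ, m ^ 4 ≤ n → n < (m + 1) ^ 4 →
      (n : ℝ) ^ 2 * ρ ^ m + 2 * n * ρ ^ m + (4 * m ^ 2 + 2 * m * k) / n < 1 := by
  have h1 : Filter.Tendsto (fun m : ℕ => ((m + 1 : ℕ) : ℝ) ^ 8 * ρ ^ (m + 1)) Filter.atTop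
      (nhds 0) :=
    (tendsto_pow_const_mul_const_pow_of_abs_lt_one 8 (by rw [abs_of_pos hρ0]; exact hρ1)).comp
      (Filter.tendsto_add_atTop_nat 1)
  obtain ⟨m₁, hm₁⟩ := Filter.eventually_atTop.1
    (h1.eventually (gt_mem_nhds (show (0 : ℝ) < ρ / 8 by positivity)))
  refine ⟨max m₁ (8 + 4 * k + 1), fun m hm n hn1 hn2 => ?_⟩
  have hm1 := hm₁ m (le_trans (le_max_left _ _) hm)
  have hm2 : 8 + 4 * k + 1 ≤ m := le_trans (le_max_right _ _) hm
  rw [pow_succ ρ m, ← mul_assoc] at hm1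
  have hm3 : ((m + 1 : ℕ) : ℝ) ^ 8 * ρ ^ m < 1 / 8 := by
    by_contra h
    push Not at h
    nlinarith
  have hn3 : (n : ℝ) ≤ ((m + 1 : ℕ) : ℝ) ^ 4 := by exact_mod_cast hn2.le
  have hn4 : (m : ℝ) ^ 4 ≤ n := by exact_mod_cast hn1
  have hm4 : (8 + 4 * k + 1 : ℝ) ≤ m := by exact_mod_cast hm2
  have hk0 : (0 : ℝ) ≤ k := Nat.cast_nonneg k
  have hmpos : (1 : ℝ) ≤ m := by linarith
  have hnpos : (1 : ℝ) ≤ n := le_trans (one_le_pow₀ hmpos) hn4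
  have hr : 0 < ρ ^ m := by positivity
  have a1 : (n : ℝ) ^ 2 * ρ ^ m ≤ ((m + 1 : ℕ) : ℝ) ^ 8 * ρ ^ m := by
    refine mul_le_mul_of_nonneg_right ?_ hr.le
    calc (n : ℝ) ^ 2 ≤ (((m + 1 : ℕ) : ℝ) ^ 4) ^ 2 := pow_le_pow_left₀ (by positivity) hn3 2
      _ = _ := by ring
  have a2 : 2 * (n : ℝ) * ρ ^ m ≤ 2 * ((n : ℝ) ^ 2 * ρ ^ m) := by
    rw [← mul_assoc]
    refine mul_le_mul_of_nonneg_right ?_ hr.le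
    nlinarith
  have a3 : (4 * (m : ℝ) ^ 2 + 2 * m * k) / n ≤ 1 / 2 := by
    rw [div_le_iff₀ (by linarith)]
    have : (m : ℝ) * m ^ 3 = m ^ 4 := by ring
    have h5 : (m : ℝ) * m ≤ m * m ^ 3 := by
      refine mul_le_mul_of_nonneg_left ?_ (by linarith)
      nlinarith [one_le_pow₀ hmpos (n := 2)]
    have h6 : (m : ℝ) ^ 2 * (8 + 4 * k + 1) ≤ m ^ 2 * m ^ 2 := by
      refine mul_le_mul_of_nonneg_left ?_ (by positivity)
      nlinarith
    have h7 : (m : ℝ) * k ≤ m ^ 2 * k := by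
      refine mul_le_mul_of_nonneg_right ?_ hk0
      nlinarith
    nlinarith
  linarith

/-- Existence of a random-like family of disjoint pairs of vertices. -/
theorem exists_random_pairs (N k M : ℕ) (hN : 1 ≤ N) : ∃ n₀ : ℕ, ∀ (V : Type*) [Fintype V]
    (S : Finset V) (W : V × V → V → V → Prop) (P : V ⊕ V → V → Prop), n₀ ≤ Fintype.card V →
    S.card ≤ k →
    (∀ z, Fintype.card V ^ 2 ≤ N * (univ.filter fun x : V × V => W z x.1 x.2).card) →
    ∃ m, M ≤ m ∧ m ^ 4 ≤ Fintype.card V ∧ ∃ ω : Fin m × Bool → V, Function.Injective ω ∧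
      (∀ x, ω x ∉ S) ∧
      (∀ z, m ≤ 2 * N * (univ.filter fun i => W z (ω (i, false)) (ω (i, true))).card) ∧
      ∀ j, 24 * N * Fintype.card V * (univ.filter fun x => P j (ω x)).card ≤
        m * (48 * N * (univ.filter (P j)).card + Fintype.card V) := by
  have hN' : (1 : ℝ) ≤ N := by exact_mod_cast hN
  set η : ℝ := 1 / (96 * N) with hη
  have hη0 : 0 < η := by positivity
  have hη1 : η ≤ 1 := by
    rw [hη, div_le_one (by positivity)]
    linarith
  have hηN : 1 / (2 * N) = 48 * η := by
    rw [hη]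
    field_simp
    norm_num
  have hηN' : 1 / (24 * N) = 4 * η := by
    rw [hη]
    field_simp
    norm_num
  have hη2 : 96 * N * η = 1 := by
    rw [hη]
    field_simp
  obtain ⟨m₀, hm₀⟩ := eventually_union_bound (ρ := 1 - η ^ 2 / 4) (by nlinarith) (by nlinarith) k
  refine ⟨(max m₀ (max M 1) + 1) ^ 4, fun V _ S W P hn hS hW => ?_⟩
  obtain ⟨m, hm1, hm2, hmM⟩ : ∃ m, m ^ 4 ≤ Fintype.card V ∧ Fintype.card V < (m + 1) ^ 4 ∧
      max m₀ (max M 1) ≤ m := by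
    refine ⟨Nat.sqrt (Nat.sqrt (Fintype.card V)), ?_, ?_, ?_⟩
    · have h1 := Nat.sqrt_le' (Nat.sqrt (Fintype.card V))
      have h2 := Nat.sqrt_le' (Fintype.card V)
      calc _ = (Nat.sqrt (Nat.sqrt (Fintype.card V)) ^ 2) ^ 2 := by ring
        _ ≤ (Nat.sqrt (Fintype.card V)) ^ 2 := Nat.pow_le_pow_left h1 2
        _ ≤ _ := h2
    · have h1 := Nat.succ_le_of_lt (Nat.lt_succ_sqrt' (Nat.sqrt (Fintype.card V)))
      have h2 := Nat.lt_succ_sqrt' (Fintype.card V)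
      calc _ < (Nat.sqrt (Fintype.card V) + 1) ^ 2 := h2
        _ ≤ ((Nat.sqrt (Nat.sqrt (Fintype.card V)) + 1) ^ 2) ^ 2 := Nat.pow_le_pow_left h1 2
        _ = _ := by ring
    · rw [Nat.le_sqrt', Nat.le_sqrt', ← pow_mul]
      refine le_trans (Nat.pow_le_pow_left ?_ _) hn
      omega
  have hbound := hm₀ m (le_trans (le_max_left _ _) hmM) _ hm1 hm2
  have hm_pos : 1 ≤ m := le_trans (le_trans (le_max_right _ _) (le_max_right _ _)) hmM
  refine ⟨m, le_trans (le_trans (le_max_left _ _) (le_max_right _ _)) hmM, hm1, ?_⟩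
  set n := Fintype.card V with hn_def
  have hn_pos : 0 < n := lt_of_lt_of_le (by positivity) hm1
  have hnR : (0 : ℝ) < n := by exact_mod_cast hn_pos
  set T : ℝ := (Fintype.card (Fin m × Bool → V) : ℝ) with hT
  have hTpos : 0 < T := by
    rw [hT, Fintype.card_fun]
    have : 0 < Fintype.card V := hn_pos
    positivity
  set f₁ : V × V → V → V → ℝ := fun z a b => 1 / (2 * N) - if W z a b then 1 else 0 with hf₁
  set f₂ : V ⊕ V → V → V → ℝ := fun j a b =>
    ((if P j a then 1 else 0) + (if P j b then 1 else 0) -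
      2 * ((univ.filter (P j)).card : ℝ) / n - 1 / (24 * N)) / 4 with hf₂
  have hb₁ : ∀ z, ((univ.filter fun ω : Fin m × Bool → V =>
      0 ≤ ∑ i, f₁ z (ω (i, false)) (ω (i, true))).card : ℝ) ≤ T * (1 - η ^ 2 / 4) ^ m := by
    intro z
    refine card_filter_sum_pair_nonneg_le _ hη0.le hη1 ?_ ?_ m
    · intro a b
      have : (1 : ℝ) / (2 * N) ≤ 1 := by
        rw [div_le_one (by positivity)]
        linarith
      have h0 : (0 : ℝ) ≤ 1 / (2 * N) := by positivity
      simp only [hf₁]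
      rw [abs_le]
      split_ifs <;> constructor <;> linarith
    · have h1 : ∑ a, ∑ b, (if W z a b then (1 : ℝ) else 0) =
          ((univ.filter fun x : V × V => W z x.1 x.2).card : ℝ) := by
        rw [← Fintype.sum_prod_type' (f := fun a b => if W z a b then (1 : ℝ) else 0)]
        simp
      have h2 : ((n : ℝ)) ^ 2 ≤ N * ((univ.filter fun x : V × V => W z x.1 x.2).card : ℝ) := by
        exact_mod_cast hW z
      simp only [hf₁, sum_sub_distrib, h1, sum_const, card_univ, nsmul_eq_mul, ← hn_def]
      rw [hηN]
      have h3 : 96 * η * (n : ℝ) ^ 2 ≤ 96 * η *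
          (N * ((univ.filter fun x : V × V => W z x.1 x.2).card : ℝ)) :=
        mul_le_mul_of_nonneg_left h2 (by positivity)
      have h4 : 96 * η * (N * ((univ.filter fun x : V × V => W z x.1 x.2).card : ℝ)) =
          ((univ.filter fun x : V × V => W z x.1 x.2).card : ℝ) := by
        rw [← mul_assoc, show 96 * η * N = 96 * N * η by ring, hη2, one_mul]
      have h5 : 0 ≤ η * (n : ℝ) ^ 2 := by positivity
      nlinarith
  have hb₂ : ∀ j, ((univ.filter fun ω : Fin m × Bool → V =>
      0 ≤ ∑ i, f₂ j (ω (i, false)) (ω (i, true))).card : ℝ) ≤ T * (1 - η ^ 2 / 4) ^ m := by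
    intro j
    have hd : ((univ.filter (P j)).card : ℝ) / n ≤ 1 := by
      rw [div_le_one hnR]
      exact_mod_cast card_le_univ _
    have hd0 : 0 ≤ ((univ.filter (P j)).card : ℝ) / n := by positivity
    refine card_filter_sum_pair_nonneg_le _ hη0.le hη1 ?_ ?_ m
    · intro a b
      have : (1 : ℝ) / (24 * N) ≤ 1 := by
        rw [div_le_one (by positivity)]
        linarith
      have h0 : (0 : ℝ) ≤ 1 / (24 * N) := by positivity
      simp only [hf₂, mul_div_assoc]
      rw [abs_le]
      split_ifs <;> constructor <;> linarith
    · have h1 : ∑ a, (if P j a then (1 : ℝ) else 0) = ((univ.filter (P j)).card : ℝ) := by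
        simp
      simp only [hf₂, ← sum_div, sum_sub_distrib, sum_add_distrib, sum_const, card_univ,
        nsmul_eq_mul, ← hn_def, ← mul_sum, h1]
      apply le_of_eq
      rw [hη]
      field_simp
      ring
  have hb₃ : ∀ x y : Fin m × Bool, ((univ.filter fun ω : Fin m × Bool → V =>
      x ≠ y ∧ ω x = ω y).card : ℝ) ≤ T / n := by
    intro x y
    rw [le_div_iff₀ hnR]
    by_cases hxy : x = y
    · simp [hxy, hTpos.le]
    · have := card_filter_apply_eq (V := V) hxy
      simp only [ne_eq, hxy, not_false_eq_true, true_and]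
      rw [hT, hn_def]
      exact_mod_cast this
  have hb₄ : ∀ x : Fin m × Bool, ((univ.filter fun ω : Fin m × Bool → V =>
      ω x ∈ S).card : ℝ) ≤ k * T / n := by
    intro x
    rw [le_div_iff₀ hnR]
    have h1 := card_filter_apply_mem x S
    have h2 : ((univ.filter fun ω : Fin m × Bool → V => ω x ∈ S).card : ℝ) * n ≤ S.card * T := by
      rw [hT, hn_def]
      exact_mod_cast h1
    have h3 : (S.card : ℝ) ≤ k := by exact_mod_cast hS
    nlinarith
  obtain ⟨ω, hω⟩ := exists_of_card_bad_lt
    (univ : Finset ((V × V) ⊕ (V ⊕ V) ⊕ ((Fin m × Bool) × (Fin m × Bool)) ⊕ (Fin m × Bool)))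
    (Sum.elim (fun z (ω : Fin m × Bool → V) => 0 ≤ ∑ i, f₁ z (ω (i, false)) (ω (i, true)))
      (Sum.elim (fun j ω => 0 ≤ ∑ i, f₂ j (ω (i, false)) (ω (i, true)))
      (Sum.elim (fun xy ω => xy.1 ≠ xy.2 ∧ ω xy.1 = ω xy.2) (fun x ω => ω x ∈ S))))
    (Sum.elim (fun _ => T * (1 - η ^ 2 / 4) ^ m) (Sum.elim (fun _ => T * (1 - η ^ 2 / 4) ^ m)
      (Sum.elim (fun _ => T / n) (fun _ => k * T / n))))
    (by
      rintro (z | j | ⟨x, y⟩ | x) -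
      · exact hb₁ z
      · exact hb₂ j
      · refine le_trans (Nat.cast_le.2 (card_le_card fun ω h => ?_)) (hb₃ x y)
        exact mem_filter.2 ⟨mem_univ _, (mem_filter.1 h).2⟩
      · refine le_trans (Nat.cast_le.2 (card_le_card fun ω h => ?_)) (hb₄ x)
        exact mem_filter.2 ⟨mem_univ _, (mem_filter.1 h).2⟩)
    (by
      simp only [Fintype.sum_sum_type, Sum.elim_inl, Sum.elim_inr, sum_const, card_univ,
        Fintype.card_prod, Fintype.card_sum, Fintype.card_fin, Fintype.card_bool, nsmul_eq_mul,
        ← hn_def, ← hT]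
      push_cast
      have := mul_lt_mul_of_pos_left hbound hTpos
      rw [mul_one] at this
      refine lt_of_eq_of_lt ?_ this
      field_simp
      ring)
  refine ⟨ω, ?_, ?_, ?_, ?_⟩
  · intro x y hxy
    by_contra hne
    exact hω (Sum.inr (Sum.inr (Sum.inl (x, y)))) (mem_univ _) ⟨hne, hxy⟩
  · intro x
    exact hω (Sum.inr (Sum.inr (Sum.inr x))) (mem_univ _)
  · intro z
    have := hω (Sum.inl z) (mem_univ _)
    simp only [Sum.elim_inl, hf₁, sum_sub_distrib, sum_const, card_univ, Fintype.card_fin,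
      nsmul_eq_mul, not_le, sum_boole] at this
    have h2 : (m : ℝ) ≤
        2 * N * ((univ.filter fun i => W z (ω (i, false)) (ω (i, true))).card : ℝ) := by
      have h3 : (m : ℝ) * (1 / (2 * N)) <
          ((univ.filter fun i => W z (ω (i, false)) (ω (i, true))).card : ℝ) := by linarith
      rw [mul_one_div, div_lt_iff₀ (by positivity)] at h3
      linarith
    exact_mod_cast h2
  · intro j
    have := hω (Sum.inr (Sum.inl j)) (mem_univ _)
    simp only [Sum.elim_inl, Sum.elim_inr, hf₂, ← sum_div, mul_div_assoc, sum_sub_distrib,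
      sum_add_distrib,
      sum_const, card_univ, Fintype.card_fin, nsmul_eq_mul, not_le, sum_boole] at this
    have hx : (univ.filter fun x => P j (ω x)).card =
        (univ.filter fun i => P j (ω (i, false))).card +
        (univ.filter fun i => P j (ω (i, true))).card := by
      rw [card_filter, card_filter, card_filter, Fintype.sum_prod_type, ← sum_add_distrib]
      refine sum_congr rfl fun i _ => ?_
      rw [Fintype.sum_bool]
      ring
    rw [hx]
    set c₁ := (univ.filter fun i => P j (ω (i, false))).card
    set c₂ := (univ.filter fun i => P j (ω (i, true))).card
    set d := (univ.filter (P j)).card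
    have h3 : (c₁ : ℝ) + c₂ < m * (2 * d / n) + m * (1 / (24 * N)) := by
      rw [mul_div_assoc]
      linarith
    have h4 : (24 * N * n) * ((c₁ : ℝ) + c₂) ≤
        (24 * N * n) * (m * (2 * d / n) + m * (1 / (24 * N))) :=
      mul_le_mul_of_nonneg_left h3.le (by positivity)
    have h5 : (24 * N * n) * (m * (2 * d / n) + m * (1 / (24 * N))) =
        (m : ℝ) * (48 * N * d + n) := by
      field_simp
      ring
    rw [h5] at h4
    exact_mod_cast h4
end

section

variable {V : Type*} {G : V → V → Prop}

theorem IsWalk.append_connect {l l' κ : List V} {a b c d : V} (h : IsWalk G l a b)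
    (hκ : (b :: (κ ++ [c])).IsChain G) (h' : IsWalk G l' c d) :
    IsWalk G (l ++ (κ ++ l')) a d := by
  rcases κ.eq_nil_or_concat with rfl | ⟨κ', z, rfl⟩
  · exact h.append h' (by simpa using hκ)
  · rw [List.concat_eq_append] at hκ ⊢
    rw [List.isChain_cons, List.isChain_append] at hκ
    obtain ⟨h1, h2, -, h3⟩ := hκ
    obtain ⟨w, hw⟩ : ∃ w, (κ' ++ [z]).head? = some w := by
      cases κ' <;> simp
    refine h.append (IsWalk.append (b := z) (c := c) ⟨h2, hw, by simp⟩ h' ?_) (h1 w ?_)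
    · exact h3 z (by simp) c (by simp)
    · rw [List.head?_append, hw]
      simp

/-- `u` can be joined to `w` by a path with at most three inner vertices from `Res`, avoiding any
given set of at most `N` vertices. -/
def Conn (G : V → V → Prop) (Res : Finset V) (N : ℕ) (u w : V) : Prop :=
  ∀ F : Finset V, F.card ≤ N → ∃ κ : List V, (∀ x ∈ κ, x ∈ Res ∧ x ∉ F) ∧ κ.Nodup ∧
    κ.length ≤ 3 ∧ (u :: (κ ++ [w])).IsChain G

/-- The walks of `L` can be joined up consecutively, starting in `a` and ending in `y`. -/
def Linked (G : V → V → Prop) (Res : Finset V) (N : ℕ) : List (List V) → V → V → Prop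
  | [], a, y => a = y
  | b :: L, a, y => ∃ c a', IsWalk G b a c ∧ Conn G Res N c a' ∧ Linked G Res N L a' y

theorem Linked.exists_walk {Res : Finset V} {N : ℕ} {L : List (List V)} {a y : V}
    (h : Linked G Res N L a y) {F : Finset V} (hn : L.flatten.Nodup)
    (hd : ∀ x ∈ L.flatten, x ∉ Res) (hF : F.card + 3 * L.length ≤ N) :
    ∃ κ : List V, IsWalk G (κ ++ [y]) a y ∧ L.flatten.Sublist κ ∧ (∀ b ∈ L, b <:+: κ) ∧
      κ.Nodup ∧ (∀ x ∈ κ, x ∈ L.flatten ∨ (x ∈ Res ∧ x ∉ F)) ∧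
      κ.length ≤ L.flatten.length + 3 * L.length := by
  induction L generalizing a F with
  | nil =>
    obtain rfl : a = y := h
    exact ⟨[], ⟨by simp, by simp, by simp⟩, by simp, by simp, by simp, by simp, by simp⟩
  | cons b L ih =>
    obtain ⟨c, a', hb, hc, hL⟩ := h
    rw [List.flatten_cons, List.nodup_append'] at hn
    obtain ⟨hbn, hLn, hdis⟩ := hn
    rw [List.length_cons] at hF
    obtain ⟨κ₁, hκ₁, hκ₁n, hκ₁l, hch⟩ := hc F (by omega)
    have hFc : (F ∪ κ₁.toFinset).card + 3 * L.length ≤ N := by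
      have := card_union_le F κ₁.toFinset
      have := List.toFinset_card_le κ₁
      omega
    obtain ⟨κ₂, hw, hsub, hinf, hn₂, hm₂, hl₂⟩ := ih hL (F := F ∪ κ₁.toFinset) hLn
      (fun x hx => hd x (by simp [List.flatten_cons, List.mem_append]; right; simpa using hx)) hFc
    have hbR : ∀ x ∈ b, x ∉ Res := fun x hx => hd x (by
      rw [List.flatten_cons]
      exact List.mem_append_left _ hx)
    refine ⟨b ++ (κ₁ ++ κ₂), ?_, ?_, ?_, ?_, ?_, ?_⟩
    · have := hb.append_connect hch hw
      simpa using this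
    · rw [List.flatten_cons]
      exact (List.Sublist.refl b).append (hsub.trans (List.sublist_append_right _ _))
    · intro b' hb'
      rcases List.mem_cons.1 hb' with rfl | hb'
      · exact (List.prefix_append _ _).isInfix
      · refine (hinf b' hb').trans ?_
        rw [← List.append_assoc]
        exact (List.suffix_append _ _).isInfix
    · rw [List.nodup_append', List.nodup_append']
      refine ⟨hbn, ⟨hκ₁n, hn₂, ?_⟩, ?_⟩
      · intro x hx hx'
        rcases hm₂ x hx' with h | h
        · exact hd x (by rw [List.flatten_cons]; exact List.mem_append_right _ h) (hκ₁ x hx).1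
        · exact h.2 (mem_union_right _ (List.mem_toFinset.2 hx))
      · intro x hx hx'
        rcases List.mem_append.1 hx' with h | h
        · exact hbR x hx (hκ₁ x h).1
        · rcases hm₂ x h with h | h
          · exact hdis hx h
          · exact hbR x hx h.1
    · intro x hx
      rw [List.flatten_cons, List.mem_append]
      rcases List.mem_append.1 hx with h | h
      · exact Or.inl (Or.inl h)
      rcases List.mem_append.1 h with h | h
      · exact Or.inr (hκ₁ x h)
      · rcases hm₂ x h with h | h
        · exact Or.inl (Or.inr h)
        · exact Or.inr ⟨h.1, fun h' => h.2 (mem_union_left _ h')⟩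
    · simp only [List.length_append, List.flatten_cons, List.length_cons] at hl₂ ⊢
      omega

/-- Closing up linked walks into a cycle. -/
theorem Linked.exists_isCyc {Res : Finset V} {N : ℕ} {L : List (List V)} {s₀ a : V}
    (hc : Conn G Res N s₀ a) (h : Linked G Res N L a s₀) (hn : (s₀ :: L.flatten).Nodup)
    (hd : ∀ x ∈ s₀ :: L.flatten, x ∉ Res) (hN : 3 * L.length + 3 ≤ N) :
    ∃ m, IsCyc G s₀ m ∧ L.flatten.Sublist m ∧ (∀ b ∈ L, b <:+: m) ∧
      (∀ x ∈ m, x ∈ L.flatten ∨ x ∈ Res) ∧ m.length ≤ L.flatten.length + 3 * L.length + 3 := by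
  obtain ⟨κ₁, hκ₁, hκ₁n, hκ₁l, hch⟩ := hc ∅ (by simp)
  have := List.toFinset_card_le κ₁
  rw [List.nodup_cons] at hn
  obtain ⟨κ₂, hw, hsub, hinf, hκ₂n, hm, hl⟩ := h.exists_walk (F := κ₁.toFinset) hn.2
    (fun x hx => hd x (List.mem_cons_of_mem _ hx)) (by omega)
  have hsw : IsWalk G [s₀] s₀ s₀ := ⟨by simp, by simp, by simp⟩
  have hcyc := (hsw.append_connect hch hw).1
  refine ⟨κ₁ ++ κ₂, ⟨by simpa using hcyc, ?_⟩, hsub.trans (List.sublist_append_right _ _),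
    fun b hb => (hinf b hb).trans (List.suffix_append _ _).isInfix, ?_, ?_⟩
  · rw [List.nodup_cons, List.nodup_append', List.mem_append]
    refine ⟨?_, hκ₁n, hκ₂n, ?_⟩
    · rintro (h | h)
      · exact hd s₀ List.mem_cons_self (hκ₁ _ h).1
      · rcases hm _ h with h | h
        · exact hn.1 h
        · exact hd s₀ List.mem_cons_self h.1
    · intro x hx hx'
      rcases hm _ hx' with h | h
      · exact hd x (List.mem_cons_of_mem _ h) (hκ₁ _ hx).1
      · exact h.2 (List.mem_toFinset.2 hx)
  · intro x hx
    rcases List.mem_append.1 hx with h | h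
    · exact Or.inr (hκ₁ _ h).1
    · exact (hm _ h).imp_right And.left
  · rw [List.length_append]
    omega
end

section

variable {V : Type*} {G : V → V → Prop}

theorem exists_paths_of_chain_sum {ι : Type*} {H : V ⊕ ι → V ⊕ ι → Prop}
    (hH : ∀ v w, H (Sum.inl v) (Sum.inl w) → G v w) (l : List (V ⊕ ι)) (hl : l.IsChain H) :
    ∃ L : List (List V), (∀ b ∈ L, b ≠ [] ∧ b.IsChain G) ∧ L.flatten = l.filterMap Sum.getLeft? ∧
      L.length ≤ l.countP Sum.isRight + (if ∃ v, l.head? = some (Sum.inl v) then 1 else 0) := by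
  induction l with
  | nil => exact ⟨[], by simp⟩
  | cons x l ih =>
    obtain ⟨L, hL, hf, hlen⟩ := ih hl.tail
    rcases x with v | i
    · by_cases hw : ∃ w, l.head? = some (Sum.inl w)
      · rw [if_pos hw] at hlen
        obtain ⟨w, hw⟩ := hw
        obtain ⟨l', rfl⟩ : ∃ l', l = Sum.inl w :: l' := by
          cases l with
          | nil => simp at hw
          | cons y l' =>
            simp at hw
            exact ⟨l', by rw [hw]⟩
        have hvw : G v w := hH v w (List.isChain_cons_cons.1 hl).1
        rcases L with _ | ⟨b, L⟩
        · simp at hf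
        obtain ⟨hb, hbc⟩ := hL b List.mem_cons_self
        rcases b with _ | ⟨w', b⟩
        · exact absurd rfl hb
        obtain rfl : w' = w := by
          simp at hf
          exact hf.1
        refine ⟨(v :: w' :: b) :: L, ?_, ?_, ?_⟩
        · intro b' hb'
          rcases List.mem_cons.1 hb' with rfl | hb'
          · exact ⟨by simp, List.isChain_cons_cons.2 ⟨hvw, hbc⟩⟩
          · exact hL b' (List.mem_cons_of_mem _ hb')
        · simp at hf ⊢
          exact hf
        · simp at hlen ⊢
          exact hlen
      · rw [if_neg hw] at hlen
        refine ⟨[v] :: L, ?_, ?_, ?_⟩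
        · intro b' hb'
          rcases List.mem_cons.1 hb' with rfl | hb'
          · exact ⟨by simp, by simp⟩
          · exact hL b' hb'
        · simp [hf]
        · simp at hlen ⊢
          exact hlen
    · refine ⟨L, hL, by rw [hf, List.filterMap_cons_none rfl], ?_⟩
      simp only [List.countP_cons, Sum.isRight_inr, if_true]
      refine hlen.trans ?_
      split_ifs <;> omega

/-- A digraph on `U` whose degrees are at most `D / 2` short of the Dirac bound has a path cover
with at most `D` paths. -/
theorem exists_path_cover (hG : ∀ x, ¬ G x x) {U : Finset V} {D : ℕ} (hD : 1 ≤ D)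
    (hDU : D ≤ U.card) (ha : ∀ v ∈ U, U.card ≤ 2 * (U.filter (G v ·)).card + D)
    (hb : ∀ v ∈ U, U.card ≤ 2 * (U.filter (G · v)).card + D) :
    ∃ L : List (List V), (∀ b ∈ L, b ≠ [] ∧ b.IsChain G) ∧ L.flatten.Nodup ∧
      (∀ v, v ∈ L.flatten ↔ v ∈ U) ∧ L.length ≤ D := by
  let H : V ⊕ Fin D → V ⊕ Fin D → Prop := fun x y =>
    Sum.elim (fun v => Sum.elim (fun w => G v w) (fun _ => True) y)
      (fun _ => Sum.elim (fun _ => True) (fun _ => False) y) x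
  have hH : ∀ x, ¬ H x x := by
    rintro (v | i)
    · exact hG v
    · exact fun h => h
  have hcard : (U.disjSum (univ : Finset (Fin D))).card = U.card + D := by simp
  have hset : ∀ (P : V ⊕ Fin D → Prop), ((U.disjSum (univ : Finset (Fin D))).filter P).card =
      (U.filter fun v => P (Sum.inl v)).card +
        ((univ : Finset (Fin D)).filter fun i => P (Sum.inr i)).card := by
    intro P
    rw [card_filter, sum_disjSum, card_filter, card_filter]
  have hfd : ∀ (v : V), (univ.filter fun i : Fin D => H (Sum.inl v) (Sum.inr i)).card = D :=
    fun v => (congrArg card (filter_true_of_mem (p := fun i => H (Sum.inl v) (Sum.inr i))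
      fun _ _ => trivial)).trans
      (card_fin D)
  have hfd' : ∀ (v : V), (univ.filter fun i : Fin D => H (Sum.inr i) (Sum.inl v)).card = D :=
    fun v => (congrArg card (filter_true_of_mem (p := fun i => H (Sum.inr i) (Sum.inl v))
      fun _ _ => trivial)).trans
      (card_fin D)
  have hfu : ∀ i, (U.filter fun v => H (Sum.inl v) (Sum.inr i)).card = U.card :=
    fun i => congrArg card (filter_true_of_mem fun _ _ => trivial)
  have hfu' : ∀ i, (U.filter fun v => H (Sum.inr i) (Sum.inl v)).card = U.card :=
    fun i => congrArg card (filter_true_of_mem fun _ _ => trivial)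
  have hout : ∀ x ∈ U.disjSum (univ : Finset (Fin D)), (U.card + D + 1) / 2 ≤
      ((U.disjSum (univ : Finset (Fin D))).filter (H x ·)).card := by
    rintro (v | i) hx
    · have := ha v (by simpa using hx)
      have h1 : (U.filter fun w => H (Sum.inl v) (Sum.inl w)).card = (U.filter (G v ·)).card := rfl
      rw [hset, hfd, h1]
      omega
    · rw [hset, hfu']
      omega
  have hin : ∀ x ∈ U.disjSum (univ : Finset (Fin D)), (U.card + D + 1) / 2 ≤
      ((U.disjSum (univ : Finset (Fin D))).filter (H · x)).card := by
    rintro (v | i) hx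
    · have := hb v (by simpa using hx)
      have h1 : (U.filter fun w => H (Sum.inl w) (Sum.inl v)).card = (U.filter (G · v)).card := rfl
      rw [hset, hfd', h1]
      omega
    · rw [hset, hfu]
      omega
  obtain ⟨s₀, m, hC, hm⟩ := exists_hamilton_cycle hH (by omega) (by omega) hout hin
  let d : V ⊕ Fin D := Sum.inr ⟨0, by omega⟩
  have hd : d ∈ s₀ :: m := (hm d).2 (by simp [d])
  obtain ⟨m', hC', hp⟩ := hC.rotate hd
  have hm' : ∀ x, x ∈ d :: m' ↔ x ∈ U.disjSum (univ : Finset (Fin D)) := fun x => by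
    rw [hp.mem_iff, hm]
  obtain ⟨L, hL, hf, hlen⟩ := exists_paths_of_chain_sum (G := G) (H := H) (fun v w h => h) m' (by
    have := hC'.1.tail
    simp only [List.tail_cons] at this
    exact this.left_of_append)
  refine ⟨L, hL, ?_, ?_, ?_⟩
  · rw [hf]
    refine (List.nodup_cons.1 hC'.2).2.filterMap ?_
    rintro (a | a) (b | b) c <;> simp
    rintro rfl rfl
    rfl
  · intro v
    rw [hf, List.mem_filterMap]
    have := hm' (Sum.inl v)
    simp only [d, List.mem_cons, reduceCtorEq, false_or, inl_mem_disjSum] at this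
    rw [← this]
    constructor
    · rintro ⟨(w | w), hw, h⟩ <;> simp at h
      exact h ▸ hw
    · exact fun h => ⟨_, h, rfl⟩
  · have hc : (d :: m').countP Sum.isRight ≤ D := by
      rw [List.countP_eq_length_filter]
      have hn : ((d :: m').filter Sum.isRight).Nodup := hC'.2.filter _
      have := length_le_card_of_subset hn
        (U := (univ : Finset (Fin D)).map ⟨Sum.inr, Sum.inr_injective⟩) (by
        rintro (v | i) hx
        · simp at hx
        · simp)
      simpa using this
    rw [List.countP_cons] at hc
    simp only [d, Sum.isRight_inr, if_true] at hc
    refine hlen.trans ?_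
    split_ifs <;> omega
end

section

/-- `G` is close to a blow-up with two large vertex sets that almost do not intersect and
almost no edges from the first to the second. -/
def Ext {V : Type*} [Fintype V] (G : V → V → Prop) (N : ℕ) : Prop :=
  ∃ X Y : Finset V, N * Fintype.card V ≤ 2 * N * X.card + 2 * Fintype.card V ∧
    N * Fintype.card V ≤ 2 * N * Y.card + 2 * Fintype.card V ∧
    N * (X ∩ Y).card ≤ Fintype.card V ∧
    N * ((X ×ˢ Y).filter fun p => G p.1 p.2).card ≤ Fintype.card V ^ 2

/-- The pair `a, b` provides a short connection between the two vertices of `z`. -/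
def Links {V : Type*} (G : V → V → Prop) (z : V × V) (a b : V) : Prop :=
  G z.1 a ∧ ((G a b ∧ G b z.2) ∨ G a z.2)

theorem many_links_of_not_ext {V : Type*} [Fintype V] {G : V → V → Prop} {N : ℕ}
    (hout : ∀ v, Fintype.card V + 1 ≤ 2 * (univ.filter (G v ·)).card)
    (hin : ∀ v, Fintype.card V + 1 ≤ 2 * (univ.filter (G · v)).card) (hext : ¬ Ext G N)
    (z : V × V) :
    Fintype.card V ^ 2 ≤ N * (univ.filter fun x : V × V => Links G z x.1 x.2).card := by
  by_contra! hlt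
  refine hext ⟨univ.filter (G z.1 ·), univ.filter (G · z.2), ?_, ?_, ?_, ?_⟩
  · have := hout z.1
    nlinarith
  · have := hin z.2
    nlinarith
  · have h1 : (univ.filter (G z.1 ·) ∩ univ.filter (G · z.2)).card * Fintype.card V ≤
        (univ.filter fun x : V × V => Links G z x.1 x.2).card := by
      rw [← card_univ, ← card_product]
      refine card_le_card fun x hx => ?_
      simp only [mem_product, mem_inter, mem_filter, mem_univ, true_and, and_true] at hx ⊢
      exact ⟨hx.1, Or.inr hx.2⟩
    have h2 := Nat.mul_le_mul_left N h1
    rw [← mul_assoc] at h2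
    have h3 := h2.trans_lt hlt
    rw [sq] at h3
    exact (Nat.lt_of_mul_lt_mul_right h3).le
  · refine (Nat.mul_le_mul_left N (card_le_card fun x hx => ?_)).trans hlt.le
    simp only [mem_product, mem_filter, mem_univ, true_and] at hx ⊢
    exact ⟨hx.1.1, Or.inl ⟨hx.2, hx.1.2⟩⟩

theorem linked_of_conn {V : Type*} {G : V → V → Prop} {Res : Finset V} {N : ℕ}
    (h : ∀ u w, Conn G Res N u w) {L : List (List V)} (hL : ∀ b ∈ L, b ≠ [] ∧ b.IsChain G)
    (y : V) : ∃ a, Linked G Res N L a y := by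
  induction L with
  | nil => exact ⟨y, rfl⟩
  | cons b L ih =>
    obtain ⟨a', ha'⟩ := ih fun b' hb' => hL b' (List.mem_cons_of_mem _ hb')
    obtain ⟨hb, hbc⟩ := hL b List.mem_cons_self
    exact ⟨b.head hb, b.getLast hb, a', ⟨hbc, List.head?_eq_some_head hb,
      List.getLast?_eq_some_getLast hb⟩, h _ _, ha'⟩

theorem conn_of_pairs {V : Type*} {G : V → V → Prop} {m K N : ℕ} {ω : Fin m × Bool → V}
    (hω : Function.Injective ω) {Res : Finset V} (hR : ∀ x, ω x ∈ Res) {u w : V}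
    (hW : m ≤ K * (univ.filter fun i => Links G (u, w) (ω (i, false)) (ω (i, true))).card)
    (hm : K * N < m) : Conn G Res N u w := by
  intro F hF
  set T := univ.filter fun i => Links G (u, w) (ω (i, false)) (ω (i, true)) with hT
  have hlt : F.card < T.card := by
    have := Nat.mul_le_mul_left K hF
    exact Nat.lt_of_mul_lt_mul_left (a := K) (by omega)
  obtain ⟨i, hi, hiF⟩ : ∃ i ∈ T, ω (i, false) ∉ F ∧ ω (i, true) ∉ F := by
    by_contra! hcon
    refine absurd (card_le_card_of_injOn (s := T) (t := F)
      (fun i => if ω (i, false) ∈ F then ω (i, false) else ω (i, true)) ?_ ?_) (by omega)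
    · intro i hi
      dsimp only
      split_ifs with h
      · exact h
      · exact hcon i hi h
    · intro i _ j _ hij
      dsimp only at hij
      split_ifs at hij <;> exact congrArg Prod.fst (hω hij)
  have hl := (mem_filter.1 hi).2
  rcases hl with ⟨h1, ⟨h2, h3⟩ | h2⟩
  · refine ⟨[ω (i, false), ω (i, true)], ?_, ?_, by simp, ?_⟩
    · simpa [hR] using hiF
    · have : ω (i, false) ≠ ω (i, true) := fun h => by simpa using hω h
      simp [this]
    · simp_all
  · refine ⟨[ω (i, false)], ?_, by simp, by simp, ?_⟩
    · simpa [hR] using hiF.1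
    · simp_all

theorem two_mul_le_of_random_bound {N n m d c q : ℕ} (hN : 1 ≤ N) (hn : 2 * m ≤ n) (hn0 : 0 < n)
    (hd : n ≤ 2 * d) (hc : 24 * N * n * c ≤ m * (48 * N * d + n)) (hq : m ≤ 12 * N * q) :
    n + 2 * c ≤ 2 * m + 2 * d + q := by
  obtain ⟨r, hr⟩ := Nat.exists_eq_add_of_le hd
  have h1 : m * (48 * N * d + n) = 24 * N * m * n + 24 * N * m * r + m * n := by
    have : 48 * N * d = 24 * N * (2 * d) := by ring
    rw [this, hr]
    ring
  have h2 : m * n ≤ 12 * N * q * n := Nat.mul_le_mul_right n hq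
  have h3 : 12 * N * r * (2 * m) ≤ 12 * N * r * n := Nat.mul_le_mul_left _ hn
  have h4 : (12 * N * n) * (2 * c) ≤ (12 * N * n) * (2 * m + r + q) := by nlinarith
  have h5 := Nat.le_of_mul_le_mul_left h4 (by positivity)
  omega

theorem exists_hamilton_of_not_ext (N k : ℕ) (hN : 1 ≤ N) : ∃ n₀ : ℕ, ∀ (V : Type)
    [Fintype V] (G : V → V → Prop), (∀ x, ¬ G x x) → n₀ ≤ Fintype.card V →
    (∀ v, Fintype.card V + 1 ≤ 2 * (univ.filter (G v ·)).card) →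
    (∀ v, Fintype.card V + 1 ≤ 2 * (univ.filter (G · v)).card) → ¬ Ext G N →
    ∀ s₀ s₁ t, (s₀ :: s₁ :: t).Nodup → t.length + 2 ≤ k →
      ∃ m, IsCyc G s₀ m ∧ (∀ v, v ∈ s₀ :: m) ∧ (s₁ :: t).Sublist m := by
  obtain ⟨n₀, hn₀⟩ := exists_random_pairs N k (1000 * N * (k + 1)) hN
  refine ⟨n₀, fun V _ G hG hn hout hin hext s₀ s₁ t hs hk => ?_⟩
  set n := Fintype.card V with hn_def
  set S : Finset V := (s₀ :: s₁ :: t).toFinset with hS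
  have hSc : S.card ≤ k := (List.toFinset_card_le _).trans hk
  obtain ⟨m, hmM, hmn, ω, hω, hωS, hωW, hωP⟩ := hn₀ V S (Links G)
    (Sum.elim (fun v x => G v x) (fun v x => G x v)) hn hSc (many_links_of_not_ext hout hin hext)
  rw [← hn_def] at hmn hωP
  have hmk : 1000 * (k + 1) ≤ m := by nlinarith
  have hmN : 1000 * N ≤ m := by nlinarith
  have hm4 : 1000 * N * m ≤ n ∧ 1000000 * m ≤ n := by
    have : m ^ 4 = m * m * m * m := by ring
    have h1 : 1000 ≤ m := by omega
    have h2 : 1000000 * m ≤ m * m * m := by nlinarith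
    have h3 : m * m * m * 1 ≤ m * m * m * m := Nat.mul_le_mul_left _ (by omega)
    constructor
    · nlinarith
    · omega
  set Res : Finset V := univ.image ω with hRes
  have hResc : Res.card = 2 * m := by
    rw [hRes, card_image_of_injective _ hω]
    simp [mul_comm]
  set D := m / (12 * N) + 1 + 2 * k with hD
  set U : Finset V := univ \ (Res ∪ S) with hU
  have hdis : Disjoint Res S := by
    rw [disjoint_left, hRes]
    intro x hx hxS
    obtain ⟨i, -, rfl⟩ := mem_image.1 hx
    exact hωS i hxS
  have hUc : U.card + 2 * m + S.card = n := by
    have := card_sdiff_add_card_eq_card (subset_univ (Res ∪ S))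
    rw [card_union_of_disjoint hdis, hResc, card_univ, ← hU] at this
    omega
  have hdeg : ∀ P : V → Prop, n + 1 ≤ 2 * (univ.filter P).card →
      24 * N * n * (univ.filter fun x => P (ω x)).card ≤ m * (48 * N * (univ.filter P).card + n) →
      U.card ≤ 2 * (U.filter P).card + D := by
    intro P h1 h2
    have h3 := two_mul_le_of_random_bound (q := m / (12 * N) + 1) hN (by omega) (by omega)
      (by omega) h2 (by
        have := Nat.lt_mul_div_succ m (show 0 < 12 * N by omega)
        exact this.le)
    have h4 : (univ.filter P).card ≤ (U.filter P).card +
        (univ.filter fun x => P (ω x)).card + S.card := by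
      rw [← card_image_of_injective (univ.filter fun x => P (ω x)) hω]
      refine (card_le_card fun x hx => ?_).trans
        ((card_union_le _ _).trans (Nat.add_le_add_right (card_union_le _ _) _))
      have hxP := (mem_filter.1 hx).2
      by_cases hxS : x ∈ S
      · exact mem_union_right _ hxS
      refine mem_union_left _ ?_
      by_cases hxR : x ∈ Res
      · obtain ⟨i, -, rfl⟩ := mem_image.1 hxR
        exact mem_union_right _ (mem_image_of_mem _ (mem_filter.2 ⟨mem_univ _, hxP⟩))
      · refine mem_union_left _ (mem_filter.2 ⟨?_, hxP⟩)
        simp [hU, hxR, hxS]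
    omega
  have hDm : 12 * (m / (12 * N)) ≤ m := by
    have h1 := Nat.div_mul_le_self m (12 * N)
    have h2 : 12 * (m / (12 * N)) ≤ 12 * N * (m / (12 * N)) :=
      Nat.mul_le_mul_right _ (by omega)
    linarith [mul_comm (m / (12 * N)) (12 * N)]
  obtain ⟨L, hL, hLn, hLU, hLD⟩ := exists_path_cover hG (U := U) (D := D) (by omega) (by omega)
    (fun v _ => hdeg _ (hout v) (hωP (Sum.inl v))) (fun v _ => hdeg _ (hin v) (hωP (Sum.inr v)))
  have hconn : ∀ u w, Conn G Res (3 * (D + k) + 3) u w := by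
    intro u w
    refine conn_of_pairs (K := 2 * N) hω (fun x => mem_image_of_mem _ (mem_univ _))
      (hωW (u, w)) ?_
    have h1 := Nat.div_mul_le_self m (12 * N)
    have h2 : 2 * N * (3 * (D + k) + 3) = (m / (12 * N) * (12 * N)) / 2 + N * (18 * k + 12) := by
      rw [hD, show m / (12 * N) * (12 * N) = 2 * (m / (12 * N) * (6 * N)) by ring,
        Nat.mul_div_cancel_left _ (by norm_num)]
      ring
    have h3 : N * (18 * k + 12) * 4 ≤ m := by nlinarith
    have h4 : 0 < m := by omega
    rw [h2]
    omega
  set L' : List (List V) := L ++ (s₁ :: t).map fun x => [x] with hL'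
  have hflat : L'.flatten = L.flatten ++ s₁ :: t := by
    have : ((s₁ :: t).map fun x => [x]).flatten = s₁ :: t := by
      rw [← List.flatMap_def, List.flatMap_singleton']
    rw [hL', List.flatten_append, this]
  have hL'l : L'.length ≤ D + k - 1 := by
    simp [hL']
    omega
  obtain ⟨a, hlink⟩ := linked_of_conn hconn (L := L') (by
    intro b hb
    rcases List.mem_append.1 hb with hb | hb
    · exact hL b hb
    · obtain ⟨x, -, rfl⟩ := List.mem_map.1 hb
      simp) s₀
  have hUS : ∀ x ∈ L.flatten, x ∉ Res ∧ x ∉ S := by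
    intro x hx
    have := (hLU x).1 hx
    simpa [hU] using this
  have hSR : ∀ x ∈ s₀ :: s₁ :: t, x ∉ Res := fun x hx hR =>
    disjoint_left.1 hdis hR (List.mem_toFinset.2 hx)
  obtain ⟨r, hC, hsub, -, -, hlen⟩ := hlink.exists_isCyc (hconn s₀ a) (by
      rw [hflat, List.nodup_cons, List.nodup_append', List.mem_append]
      rw [List.nodup_cons] at hs
      refine ⟨?_, hLn, hs.2, ?_⟩
      · rintro (h | h)
        · exact (hUS _ h).2 (by simp [hS])
        · exact hs.1 h
      · intro x hx hx'
        exact (hUS x hx).2 (by rw [hS, List.mem_toFinset]; exact List.mem_cons_of_mem _ hx'))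
    (by
      intro x hx
      rw [hflat] at hx
      rcases List.mem_cons.1 hx with rfl | hx
      · exact hSR _ List.mem_cons_self
      rcases List.mem_append.1 hx with hx | hx
      · exact (hUS x hx).1
      · exact hSR x (List.mem_cons_of_mem _ hx)) (by omega)
  rw [hflat] at hsub
  obtain ⟨r₁, r₂, rfl, hr₁, hr₂⟩ := List.append_sublist_iff.1 hsub
  obtain ⟨r₃, r₄, rfl, hr₃, hr₄⟩ := List.cons_sublist_iff.1 hr₂
  obtain ⟨r₅, r₆, rfl⟩ := List.append_of_mem hr₃
  have hLl : L.flatten.length = U.card := by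
    rw [← List.toFinset_card_of_nodup hLn]
    congr 1
    ext x
    rw [List.mem_toFinset, hLU]
  refine exists_hamilton_of_long_segment hG (e := 2 * m + k) (by omega) (by omega) hout hin ?_
    (p := r₁ ++ r₅) (r := r₆ ++ r₄) (by simpa using hC)
    (hr₄.trans (List.sublist_append_right _ _)) ?_
  · rintro ⟨X, Y, hXY, hX, hY, hno⟩
    have h1 : N * (400 * (2 * m + k)) ≤ 2 * n := by nlinarith
    refine hext ⟨X, Y, ?_, ?_, ?_, ?_⟩
    · nlinarith
    · nlinarith
    · rw [disjoint_iff_inter_eq_empty.1 hXY]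
      simp
    · rw [filter_false_of_mem]
      · simp
      · rintro ⟨a, b⟩ hab
        exact hno a (mem_product.1 hab).1 b (mem_product.1 hab).2
  · have := hr₁.length_le
    rw [List.length_append]
    omega
end

section

variable {V : Type*} {G : V → V → Prop}

theorem pair_infix_cases {x y u w : V} {P Q : List V} (h : [x, y] <:+: P ++ u :: w :: Q) :
    [x, y] <:+: P ++ [u] ∨ [x, y] <:+: w :: Q ∨ (x = u ∧ y = w) := by
  obtain ⟨A, B, hAB⟩ := h
  have hAB' : A ++ (x :: y :: B) = P ++ u :: w :: Q := by simpa using hAB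
  rcases List.append_eq_append_iff.1 hAB' with ⟨E, rfl, hE2⟩ | ⟨E, rfl, hE2⟩
  · match E, hE2 with
    | [], hE2 =>
      simp only [List.nil_append, List.cons.injEq] at hE2
      exact Or.inr (Or.inr ⟨hE2.1, hE2.2.1⟩)
    | [e], hE2 =>
      simp only [List.cons_append, List.nil_append, List.cons.injEq] at hE2
      obtain ⟨rfl, rfl, -⟩ := hE2
      exact Or.inl ⟨A, [], by simp⟩
    | e :: e' :: E, hE2 =>
      simp only [List.cons_append, List.cons.injEq] at hE2
      obtain ⟨rfl, rfl, -⟩ := hE2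
      exact Or.inl ⟨A, E ++ [u], by simp⟩
  · match E, hE2 with
    | [], hE2 =>
      simp only [List.nil_append, List.cons.injEq] at hE2
      exact Or.inr (Or.inr ⟨hE2.1.symm, hE2.2.1.symm⟩)
    | e :: E, hE2 =>
      simp only [List.cons_append, List.cons.injEq] at hE2
      rw [hE2.2]
      exact Or.inr (Or.inl ⟨E, B, by simp⟩)

/-- The consecutive pairs of the closed walk `s₀, m, s₀`. -/
def CycEdge (s₀ : V) (m : List V) (x y : V) : Prop := [x, y] <:+: s₀ :: (m ++ [s₀])

theorem IsCyc.insert {s₀ u w : V} {m R : List V} (h : IsCyc G s₀ m) (huw : CycEdge s₀ m u w)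
    (hR : (u :: (R ++ [w])).IsChain G) (hRn : R.Nodup) (hRd : ∀ x ∈ R, x ∉ s₀ :: m) :
    ∃ m', IsCyc G s₀ m' ∧ m.Sublist m' ∧ m'.Perm (R ++ m) ∧
      u :: (R ++ [w]) <:+: s₀ :: (m' ++ [s₀]) ∧
      ∀ x y, CycEdge s₀ m x y → ¬ (x = u ∧ y = w) → CycEdge s₀ m' x y := by
  obtain ⟨P, Q, hPQ⟩ := huw
  have hc : s₀ :: (m ++ [s₀]) = P ++ u :: w :: Q := by rw [← hPQ]; simp
  have hlen := congrArg List.length hc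
  simp only [List.length_cons, List.length_append, List.length_nil] at hlen
  set i := P.length with hi
  have him : i ≤ m.length := by omega
  have h1 : s₀ :: m.take i = P ++ [u] := by
    have := congrArg (List.take (i + 1)) hc
    rw [List.take_succ_cons, List.take_append_of_le_length him, hi, List.take_length_add_append]
      at this
    simpa using this
  have h2 : m.drop i ++ [s₀] = w :: Q := by
    have := congrArg (List.drop (i + 1)) hc
    rw [List.drop_succ_cons, List.drop_append_of_le_length him, hi, List.drop_length_add_append]
      at this
    simpa using this
  have hc' : s₀ :: (m.take i ++ R ++ m.drop i ++ [s₀]) = P ++ u :: (R ++ w :: Q) := by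
    rw [List.append_assoc, h2, ← List.cons_append, ← List.cons_append, h1]
    simp
  have hp : (m.take i ++ R ++ m.drop i).Perm (R ++ m) := by
    conv_rhs => rw [← List.take_append_drop i m, ← List.append_assoc]
    exact List.Perm.append_right _ List.perm_append_comm
  have hchain := h.1
  rw [hc, List.isChain_split] at hchain
  refine ⟨m.take i ++ R ++ m.drop i, ⟨?_, ?_⟩, ?_, hp, ?_, ?_⟩
  · rw [hc', List.isChain_split]
    refine ⟨hchain.1, ?_⟩
    rw [← List.cons_append, List.isChain_split]
    exact ⟨hR, hchain.2.tail⟩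
  · have := h.2
    rw [List.nodup_cons] at this ⊢
    rw [hp.mem_iff, hp.nodup_iff, List.nodup_append', List.mem_append]
    refine ⟨?_, hRn, this.2, fun x hx hx' => hRd x hx (List.mem_cons_of_mem _ hx')⟩
    rintro (h' | h')
    · exact hRd _ h' List.mem_cons_self
    · exact this.1 h'
  · conv_lhs => rw [← List.take_append_drop i m]
    exact (List.sublist_append_left _ _).append (List.Sublist.refl _)
  · rw [hc']
    exact ⟨P, Q, by simp⟩
  · intro x y hxy hne
    unfold CycEdge at hxy ⊢
    rw [hc] at hxy
    rw [hc']
    rcases pair_infix_cases hxy with h' | h' | h'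
    · exact h'.trans ⟨[], R ++ w :: Q, by simp⟩
    · exact h'.trans ⟨P ++ u :: R, [], by simp⟩
    · exact absurd h' hne

theorem CycEdge.mem {s₀ x y : V} {m : List V} (h : CycEdge s₀ m x y) :
    x ∈ s₀ :: m ∧ y ∈ s₀ :: m := by
  have h1 := h.subset (List.mem_cons_self)
  have h2 := h.subset (List.mem_cons_of_mem _ List.mem_cons_self : y ∈ [x, y])
  simp only [List.mem_cons, List.mem_append] at h1 h2 ⊢
  simp only [List.not_mem_nil, or_false] at h1 h2
  tauto

theorem IsCyc.exists_edge_of_mem_inter [Fintype V] {s₀ : V} {m : List V} (h : IsCyc G s₀ m)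
    {p q : V → Prop}
    (hpq : (s₀ :: m).length < (univ.filter fun v => v ∈ s₀ :: m ∧ p v).card
      + (univ.filter fun v => v ∈ s₀ :: m ∧ q v).card) :
    ∃ x y, CycEdge s₀ m x y ∧ p x ∧ q y := by
  have e1 : (idx p (s₀ :: m)).card = (univ.filter fun v => v ∈ s₀ :: m ∧ p v).card := by
    rw [card_idx p h.2]
    congr 1
    ext v
    simp
  have e2 : (idx q (m ++ [s₀])).card = (univ.filter fun v => v ∈ s₀ :: m ∧ q v).card := by
    rw [card_idx q h.nodup']
    congr 1
    ext v
    simp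
  have h3 : ¬ Disjoint (idx p (s₀ :: m)) (idx q (m ++ [s₀])) := by
    intro hd
    have h4 := card_union_of_disjoint hd
    have h5 : idx p (s₀ :: m) ∪ idx q (m ++ [s₀]) ⊆ range (s₀ :: m).length := by
      refine union_subset (idx_subset _ _) ((idx_subset _ _).trans ?_)
      simp
    have h6 := card_le_card h5
    rw [card_range] at h6
    omega
  rw [not_disjoint_iff] at h3
  obtain ⟨i, hi1, hi2⟩ := h3
  obtain ⟨x, hx, hpx⟩ := mem_idx.1 hi1
  obtain ⟨y, hy, hqy⟩ := mem_idx.1 hi2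
  refine ⟨x, y, ?_, hpx, hqy⟩
  have hx' : (s₀ :: (m ++ [s₀]))[i]? = some x := by
    rw [← List.cons_append, List.getElem?_append_left, hx]
    exact (List.getElem?_eq_some_iff.1 hx).1
  have hy' : (s₀ :: (m ++ [s₀]))[i + 1]? = some y := by
    simpa using hy
  obtain ⟨h1, rfl⟩ := List.getElem?_eq_some_iff.1 hx'
  obtain ⟨h2, rfl⟩ := List.getElem?_eq_some_iff.1 hy'
  refine ⟨(s₀ :: (m ++ [s₀])).take i, (s₀ :: (m ++ [s₀])).drop (i + 2), ?_⟩
  conv_rhs => rw [← List.take_append_drop i (s₀ :: (m ++ [s₀])), List.drop_eq_getElem_cons h1,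
    List.drop_eq_getElem_cons h2]
  simp

end

section

/-- `G` is close to the disjoint union of two complete digraphs on `A` and `B`, where `A` and `B`
avoid a given set `S` of `k` vertices. -/
structure Split {V : Type*} [Fintype V] (G : V → V → Prop) (S A B : Finset V) (k M : ℕ) :
    Prop where
  irrefl : ∀ x, ¬ G x x
  disj : Disjoint A B
  disjA : Disjoint A S
  disjB : Disjoint B S
  cardS : S.card = k
  three_le : 3 ≤ k
  cardA : Fintype.card V ≤ 2 * A.card + 2 * M
  cardB : Fintype.card V ≤ 2 * B.card + 2 * M
  outA : ∀ a ∈ A, (A.filter fun x => ¬ G a x).card ≤ M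
  inA : ∀ a ∈ A, (A.filter fun x => ¬ G x a).card ≤ M
  outB : ∀ b ∈ B, (B.filter fun x => ¬ G b x).card ≤ M
  inB : ∀ b ∈ B, (B.filter fun x => ¬ G x b).card ≤ M
  outDeg : ∀ v, Fintype.card V + k ≤ 2 * (univ.filter fun x => G v x).card + 2
  inDeg : ∀ v, Fintype.card V + k ≤ 2 * (univ.filter fun x => G x v).card + 2
  le_M : 100000 * k ^ 2 ≤ M
  M_le : 1000 * M ≤ Fintype.card V

variable {V : Type*} [Fintype V] {G : V → V → Prop} {S A B : Finset V} {k M : ℕ}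

namespace Split

theorem symm (h : Split G S A B k M) : Split G S B A k M :=
  ⟨h.irrefl, h.disj.symm, h.disjB, h.disjA, h.cardS, h.three_le, h.cardB, h.cardA, h.outB, h.inB,
    h.outA, h.inA, h.outDeg, h.inDeg, h.le_M, h.M_le⟩

theorem reverse (h : Split G S A B k M) : Split (fun x y => G y x) S A B k M :=
  ⟨h.irrefl, h.disj, h.disjA, h.disjB, h.cardS, h.three_le, h.cardA, h.cardB, h.inA, h.outA,
    h.inB, h.outB, h.inDeg, h.outDeg, h.le_M, h.M_le⟩

theorem large_M (h : Split G S A B k M) : 300000 * k ≤ M ∧ 900000 ≤ M := by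
  have h1 := h.le_M
  have h2 := h.three_le
  constructor <;> nlinarith

theorem pick (h : Split G S A B k M) {x y : V} (hx : x ∈ A) (hy : y ∈ A) {T : Finset V}
    (hT : T ⊆ A) (hTc : 4 * M ≤ T.card) (l : List V) (hl : l.length ≤ M) :
    ∃ a ∈ T, a ∉ l ∧ G x a ∧ G a y := by
  by_contra! hno
  have hM := h.large_M.2
  have hsub : T ⊆ l.toFinset ∪ (A.filter (fun a => ¬ G x a) ∪ A.filter (fun a => ¬ G a y)) := by
    intro a ha
    simp only [mem_union, mem_filter, List.mem_toFinset, hT ha, true_and]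
    by_contra! hc
    exact hno a ha hc.1 hc.2.1 hc.2.2
  have h1 := card_le_card hsub
  have h2 := card_union_le l.toFinset
    (A.filter (fun a => ¬ G x a) ∪ A.filter (fun a => ¬ G a y))
  have h3 := card_union_le (A.filter (fun a => ¬ G x a)) (A.filter (fun a => ¬ G a y))
  have h4 := h.outA x hx
  have h5 := h.inA y hy
  have h6 := List.toFinset_card_le l
  omega

theorem card_filter_out (h : Split G S A B k M) {x : V} (hx : x ∈ A) {T : Finset V} (hT : T ⊆ A) :
    T.card ≤ (T.filter (G x ·)).card + M := by
  have h1 := h.outA x hx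
  have h2 := card_filter_add_card_filter_not (s := T) (fun y => G x y)
  have h3 : (T.filter fun y => ¬ G x y).card ≤ (A.filter fun y => ¬ G x y).card :=
    card_le_card (filter_subset_filter _ hT)
  omega

theorem card_filter_in (h : Split G S A B k M) {x : V} (hx : x ∈ A) {T : Finset V} (hT : T ⊆ A) :
    T.card ≤ (T.filter (G · x)).card + M :=
  h.reverse.card_filter_out hx hT

/-- All of `T ⊆ A` can be inserted into a single edge inside `A`. -/
theorem exists_path_covering (h : Split G S A B k M) {u w : V} (hu : u ∈ A) (hw : w ∈ A)
    {T : Finset V} (hT : T ⊆ A) (huT : u ∉ T) (hTc : 4 * M ≤ T.card) :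
    ∃ R : List V, (u :: (R ++ [w])).IsChain G ∧ R.Nodup ∧ ∀ x, x ∈ R ↔ x ∈ T := by
  obtain ⟨H, hH⟩ : ∃ H : V → V → Prop,
      H = fun x y => if x = u then G u y else if y = u then G x w else G x y := ⟨_, rfl⟩
  have hM := h.large_M.2
  have hc : (insert u T).card = T.card + 1 := card_insert_of_notMem huT
  have hne : ∀ x ∈ T, x ≠ u := fun x hx hxu => huT (hxu ▸ hx)
  have hout : ∀ v ∈ insert u T, T.card - M ≤ ((insert u T).filter (H v ·)).card := by
    intro v hv
    have hvA : v ∈ A := by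
      rcases mem_insert.1 hv with rfl | hv
      exacts [hu, hT hv]
    have h1 := h.card_filter_out hvA hT
    have h2 : T.filter (G v ·) ⊆ (insert u T).filter (H v ·) := by
      intro y hy
      rw [mem_filter] at hy ⊢
      refine ⟨mem_insert_of_mem hy.1, ?_⟩
      rw [hH]
      by_cases hvu : v = u
      · subst hvu
        simpa using hy.2
      · simpa [hvu, hne y hy.1] using hy.2
    have h3 := card_le_card h2
    omega
  have hin : ∀ v ∈ insert u T, T.card - M ≤ ((insert u T).filter (H · v)).card := by
    intro v hv
    by_cases hvu : v = u
    · have h1 := h.card_filter_in hw hT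
      have h2 : T.filter (G · w) ⊆ (insert u T).filter (H · v) := by
        intro y hy
        rw [mem_filter] at hy ⊢
        refine ⟨mem_insert_of_mem hy.1, ?_⟩
        rw [hH]
        simpa [hvu, hne y hy.1] using hy.2
      have h3 := card_le_card h2
      omega
    · have h1 := h.card_filter_in (hT (mem_of_mem_insert_of_ne hv hvu)) hT
      have h2 : T.filter (G · v) ⊆ (insert u T).filter (H · v) := by
        intro y hy
        rw [mem_filter] at hy ⊢
        refine ⟨mem_insert_of_mem hy.1, ?_⟩
        rw [hH]
        simpa [hvu, hne y hy.1] using hy.2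
      have h3 := card_le_card h2
      omega
  have hirr : ∀ x, ¬ H x x := by
    intro x
    rw [hH]
    by_cases hxu : x = u
    · simpa [hxu] using h.irrefl u
    · simpa [hxu] using h.irrefl x
  obtain ⟨s, m, hm, hmem⟩ := exists_hamilton_cycle hirr (U := insert u T)
    (a := T.card - M) (b := T.card - M) (by omega) (by omega) hout hin
  obtain ⟨R, hR, hperm⟩ := hm.rotate (u := u) ((hmem u).2 (mem_insert_self _ _))
  have huR := List.nodup_cons.1 hR.2
  have hRT : ∀ x, x ∈ R ↔ x ∈ T := by
    intro x
    have h1 : x ∈ u :: R ↔ x ∈ insert u T := by rw [hperm.mem_iff, hmem]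
    rw [List.mem_cons, mem_insert] at h1
    constructor
    · intro hx
      rcases h1.1 (Or.inr hx) with rfl | h'
      exacts [absurd hx huR.1, h']
    · intro hx
      rcases h1.2 (Or.inr hx) with rfl | h'
      exacts [absurd hx huT, h']
  refine ⟨R, ?_, huR.2, hRT⟩
  have hRne : R ≠ [] := by
    rintro rfl
    have : T = ∅ := by
      ext x
      simpa using (hRT x).symm
    rw [this] at hTc
    simp at hTc
    omega
  have hch := hR.1
  rw [List.isChain_cons, List.isChain_append] at hch
  obtain ⟨h1, h2, -, h3⟩ := hch
  have hRu : ∀ x ∈ R, x ≠ u := fun x hx hxu => huR.1 (hxu ▸ hx)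
  refine isChain_cons_append_singleton (x := R.head hRne) (y := R.getLast hRne) ?_
    (List.head?_eq_some_head hRne) (List.getLast?_eq_some_getLast hRne) ?_ ?_
  · refine List.IsChain.imp_of_mem_imp ?_ h2
    intro x y hx hy hxy
    simpa [hH, hRu x hx, hRu y hy] using hxy
  · have := h1 (R.head hRne) (by rw [List.head?_append, List.head?_eq_some_head hRne]; rfl)
    simpa [hH] using this
  · have := h3 (R.getLast hRne) (List.getLast?_eq_some_getLast hRne) u (by simp)
    simpa [hH, hRu _ (List.getLast_mem hRne)] using this

end Split

end

section

variable {V : Type*} [Fintype V] {G : V → V → Prop} {S A B : Finset V} {k M : ℕ}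

/-- The number of vertices outside `A ∪ B` on the cycle `s₀, m`. -/
noncomputable def excCount (A B : Finset V) (s₀ : V) (m : List V) : ℕ :=
  (univ.filter fun v => v ∈ s₀ :: m ∧ v ∉ A ∧ v ∉ B).card

/-- A short cycle through `t` with an edge inside `A` and an edge inside `B`. -/
structure Good (G : V → V → Prop) (A B : Finset V) (K : ℕ) (s₀ : V) (t m : List V) : Prop where
  cyc : IsCyc G s₀ m
  sub : t.Sublist m
  edgeA : ∃ x ∈ A, ∃ y ∈ A, CycEdge s₀ m x y
  edgeB : ∃ x ∈ B, ∃ y ∈ B, CycEdge s₀ m x y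
  len : m.length ≤ K + 7 * excCount A B s₀ m

namespace Good

variable {K : ℕ} {s₀ : V} {t m : List V}

theorem excCount_comm : excCount A B s₀ m = excCount B A s₀ m := by
  unfold excCount
  congr 1
  ext v
  simp only [mem_filter]
  tauto

theorem symm (h : Good G A B K s₀ t m) : Good G B A K s₀ t m :=
  ⟨h.cyc, h.sub, h.edgeB, h.edgeA, by rw [excCount_comm]; exact h.len⟩

theorem insert (h : Good G A B K s₀ t m) {u w z : V} {R : List V} (huw : CycEdge s₀ m u w)
    (hR : (u :: (R ++ [w])).IsChain G) (hRn : R.Nodup) (hRd : ∀ x ∈ R, x ∉ s₀ :: m)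
    (hRl : R.length ≤ 7) (hz : z ∈ R) (hzA : z ∉ A) (hzB : z ∉ B)
    (hA : (∃ x ∈ A, ∃ y ∈ A, [x, y] <:+: u :: (R ++ [w])) ∨ ¬ (u ∈ A ∧ w ∈ A))
    (hB : (∃ x ∈ B, ∃ y ∈ B, [x, y] <:+: u :: (R ++ [w])) ∨ ¬ (u ∈ B ∧ w ∈ B)) :
    ∃ m', Good G A B K s₀ t m' ∧ excCount A B s₀ m < excCount A B s₀ m' := by
  obtain ⟨m', hm', hsub, hperm, hinf, hedge⟩ := h.cyc.insert huw hR hRn hRd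
  have hlt : excCount A B s₀ m < excCount A B s₀ m' := by
    refine card_lt_card ?_
    rw [ssubset_iff_of_subset]
    · refine ⟨z, ?_, ?_⟩
      · rw [mem_filter]
        refine ⟨mem_univ _, List.mem_cons_of_mem _ ?_, hzA, hzB⟩
        rw [hperm.mem_iff]
        exact List.mem_append_left _ hz
      · rw [mem_filter]
        exact fun h' => hRd z hz h'.2.1
    · intro v hv
      rw [mem_filter] at hv ⊢
      exact ⟨mem_univ _, (hsub.cons_cons s₀).subset hv.2.1, hv.2.2⟩
  have key : ∀ D : Finset V, (∃ x ∈ D, ∃ y ∈ D, CycEdge s₀ m x y) →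
      ((∃ x ∈ D, ∃ y ∈ D, [x, y] <:+: u :: (R ++ [w])) ∨ ¬ (u ∈ D ∧ w ∈ D)) →
      ∃ x ∈ D, ∃ y ∈ D, CycEdge s₀ m' x y := by
    rintro D ⟨x, hx, y, hy, hxy⟩ (⟨x', hx', y', hy', hxy'⟩ | hne)
    · exact ⟨x', hx', y', hy', hxy'.trans hinf⟩
    · refine ⟨x, hx, y, hy, hedge x y hxy ?_⟩
      rintro ⟨rfl, rfl⟩
      exact hne ⟨hx, hy⟩
  refine ⟨m', ⟨hm', h.sub.trans hsub, key A h.edgeA hA, key B h.edgeB hB, ?_⟩, hlt⟩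
  have h1 := hperm.length_eq
  rw [List.length_append] at h1
  have h2 := h.len
  omega

theorem exists_insert_same (h : Good G A B K s₀ t m) (hs : Split G S A B k M) {z : V}
    (hz : z ∉ s₀ :: m) (hzA : z ∉ A) (hzB : z ∉ B)
    (hin : 4 * M ≤ ((A.filter (· ∉ s₀ :: m)).filter (G · z)).card)
    (hout : 4 * M ≤ ((A.filter (· ∉ s₀ :: m)).filter (G z ·)).card) :
    ∃ m', Good G A B K s₀ t m' ∧ excCount A B s₀ m < excCount A B s₀ m' := by
  have hM := hs.large_M.2
  obtain ⟨x, hx, y, hy, hxy⟩ := h.edgeA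
  obtain ⟨a, ha, -, hxa, -⟩ := hs.pick hx hx ((filter_subset _ _).trans (filter_subset _ _)) hin
    [] (by simp)
  obtain ⟨c, hc, hca, -, hcy⟩ := hs.pick hy hy ((filter_subset _ _).trans (filter_subset _ _)) hout
    [a] (by simp; omega)
  simp only [mem_filter] at ha hc
  have hd := disjoint_left.1 hs.disj
  refine h.insert (u := x) (w := y) (z := z) (R := [a, z, c]) hxy ?_ ?_ ?_ (by simp) (by simp)
    hzA hzB (Or.inl ⟨x, hx, a, ha.1.1, [], [z, c, y], by simp⟩)
    (Or.inr fun h' => hd hx h'.1)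
  · simp [hxa, ha.2, hc.2, hcy]
  · grind
  · simp only [List.mem_cons, List.not_mem_nil, or_false]
    rintro v (rfl | rfl | rfl)
    exacts [by simpa using ha.1.2, by simpa using hz, by simpa using hc.1.2]

theorem exists_insert_cross (h : Good G A B K s₀ t m) (hs : Split G S A B k M) {z : V}
    (hz : z ∉ s₀ :: m) (hzA : z ∉ A) (hzB : z ∉ B)
    (hin : 4 * M ≤ ((A.filter (· ∉ s₀ :: m)).filter (G · z)).card)
    (hout : 4 * M ≤ ((B.filter (· ∉ s₀ :: m)).filter (G z ·)).card) :
    ∃ m', Good G A B K s₀ t m' ∧ excCount A B s₀ m < excCount A B s₀ m' := by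
  have hM := hs.large_M.2
  have hd := disjoint_left.1 hs.disj
  obtain ⟨x, hx, y, hy, hxy⟩ := h.edgeA
  obtain ⟨x', hx', y', hy', hxy'⟩ := h.edgeB
  have hinA := (filter_subset (G · z) _).trans (filter_subset (· ∉ s₀ :: m) A)
  have houtB := (filter_subset (G z ·) _).trans (filter_subset (· ∉ s₀ :: m) B)
  have hA' : 4 * M ≤ (A.filter (· ∉ s₀ :: m)).card := hin.trans (card_le_card (filter_subset _ _))
  have hB' : 4 * M ≤ (B.filter (· ∉ s₀ :: m)).card := hout.trans (card_le_card (filter_subset _ _))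
  by_cases h1 : ∃ b₀ ∈ B, b₀ ∉ s₀ :: m ∧ G b₀ z
  · obtain ⟨b₀, hb₀, hb₀m, hb₀z⟩ := h1
    obtain ⟨c, hc, hcn, hxc, hcb⟩ := hs.symm.pick hx' hb₀ (filter_subset _ _) hB' [b₀]
      (by simp; omega)
    obtain ⟨b, hb, hbn, -, hby⟩ := hs.symm.pick hy' hy' houtB hout [b₀, c] (by simp; omega)
    simp only [mem_filter] at hb hc
    refine h.insert (u := x') (w := y') (z := z) (R := [c, b₀, z, b]) hxy' ?_ ?_ ?_ (by simp)
      (by simp) hzA hzB (Or.inr fun h' => hd h'.1 hx')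
      (Or.inl ⟨x', hx', c, hc.1, [], [b₀, z, b, y'], by simp⟩)
    · simp [hxc, hcb, hb₀z, hb.2, hby]
    · clear hin hout hinA houtB hA' hB' h hs
      simp only [List.nodup_cons, List.mem_cons, List.not_mem_nil, or_false, not_or] at *
      and_intros <;> grind
    · simp only [List.mem_cons, List.not_mem_nil, or_false]
      rintro v (rfl | rfl | rfl | rfl)
      exacts [by simpa using hc.2, by simpa using hb₀m, by simpa using hz, by simpa using hb.1.2]
  by_cases h2 : ∃ a₀ ∈ A, a₀ ∉ s₀ :: m ∧ G z a₀
  · obtain ⟨a₀, ha₀, ha₀m, hza₀⟩ := h2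
    obtain ⟨c, hc, hcn, hac, hcy⟩ := hs.pick ha₀ hy (filter_subset _ _) hA' [a₀]
      (by simp; omega)
    obtain ⟨a, ha, han, hxa, -⟩ := hs.pick hx hx hinA hin [a₀, c] (by simp; omega)
    simp only [mem_filter] at ha hc
    refine h.insert (u := x) (w := y) (z := z) (R := [a, z, a₀, c]) hxy ?_ ?_ ?_ (by simp)
      (by simp) hzA hzB (Or.inl ⟨x, hx, a, ha.1.1, [], [z, a₀, c, y], by simp⟩)
      (Or.inr fun h' => hd hx h'.1)
    · simp [hxa, ha.2, hza₀, hac, hcy]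
    · clear hin hout hinA houtB hA' hB' h hs
      simp only [List.nodup_cons, List.mem_cons, List.not_mem_nil, or_false, not_or] at *
      and_intros <;> grind
    · simp only [List.mem_cons, List.not_mem_nil, or_false]
      rintro v (rfl | rfl | rfl | rfl)
      exacts [by simpa using ha.1.2, by simpa using hz, by simpa using ha₀m, by simpa using hc.2]
  by_cases h3 : ∃ p ∈ B, p ∉ s₀ :: m ∧ ∃ q ∈ A, q ∉ s₀ :: m ∧ G p q
  · obtain ⟨p, hp, hpm, q, hq, hqm, hpq⟩ := h3
    obtain ⟨c, hc, hcn, hqc, hcy⟩ := hs.pick hq hy (filter_subset _ _) hA' [q] (by simp; omega)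
    obtain ⟨a, ha, han, hxa, -⟩ := hs.pick hx hx hinA hin [q, c] (by simp; omega)
    obtain ⟨b, hb, hbn, -, hbp⟩ := hs.symm.pick hp hp houtB hout [p] (by simp; omega)
    simp only [mem_filter] at ha hc hb
    refine h.insert (u := x) (w := y) (z := z) (R := [a, z, b, p, q, c]) hxy ?_ ?_ ?_ (by simp)
      (by simp) hzA hzB (Or.inl ⟨x, hx, a, ha.1.1, [], [z, b, p, q, c, y], by simp⟩)
      (Or.inr fun h' => hd hx h'.1)
    · simp [hxa, ha.2, hb.2, hbp, hpq, hqc, hcy]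
    · clear hin hout hinA houtB hA' hB' h hs
      simp only [List.nodup_cons, List.mem_cons, List.not_mem_nil, or_false, not_or] at *
      and_intros <;> grind
    · simp only [List.mem_cons, List.not_mem_nil, or_false]
      rintro v (rfl | rfl | rfl | rfl | rfl | rfl)
      exacts [by simpa using ha.1.2, by simpa using hz, by simpa using hb.1.2, by simpa using hpm,
        by simpa using hqm, by simpa using hc.2]
  push Not at h1 h2 h3
  obtain ⟨p, hp, -⟩ := hs.symm.pick hx' hx' (filter_subset _ _) hB' [] (by simp)
  obtain ⟨q, hq, -⟩ := hs.pick hx hx (filter_subset _ _) hA' [] (by simp)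
  obtain ⟨hpB, hpm⟩ := mem_filter.1 hp
  obtain ⟨hqA, hqm⟩ := mem_filter.1 hq
  obtain ⟨b, hb, hbn, -, hbp⟩ := hs.symm.pick hpB hpB houtB hout [p] (by simp; omega)
  by_cases h4 : ∃ v, v ∉ s₀ :: m ∧ G p v ∧ G v q
  · obtain ⟨v, hvm, hpv, hvq⟩ := h4
    have hvA : v ∉ A := fun hv => h3 p hpB hpm v hv hvm hpv
    have hvB : v ∉ B := fun hv => h3 v hv hvm q hqA hqm hvq
    have hvz : v ≠ z := by
      rintro rfl
      exact h1 p hpB hpm hpv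
    obtain ⟨c, hc, hcn, hqc, hcy⟩ := hs.pick hqA hy (filter_subset _ _) hA' [q] (by simp; omega)
    obtain ⟨a, ha, han, hxa, -⟩ := hs.pick hx hx hinA hin [q, c] (by simp; omega)
    simp only [mem_filter] at ha hc hb
    refine h.insert (u := x) (w := y) (z := z) (R := [a, z, b, p, v, q, c]) hxy ?_ ?_ ?_ (by simp)
      (by simp) hzA hzB (Or.inl ⟨x, hx, a, ha.1.1, [], [z, b, p, v, q, c, y], by simp⟩)
      (Or.inr fun h' => hd hx h'.1)
    · simp [hxa, ha.2, hb.2, hbp, hpv, hvq, hqc, hcy]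
    · clear hin hout hinA houtB hA' hB' h hs
      simp only [List.nodup_cons, List.mem_cons, List.not_mem_nil, or_false, not_or] at *
      and_intros <;> grind
    · simp only [List.mem_cons, List.not_mem_nil, or_false]
      rintro v' (rfl | rfl | rfl | rfl | rfl | rfl | rfl)
      exacts [by simpa using ha.1.2, by simpa using hz, by simpa using hb.1.2, by simpa using hpm,
        by simpa using hvm, by simpa using hqm, by simpa using hc.2]
  push Not at h4
  obtain ⟨u, w, huw, huq, hpw⟩ := h.cyc.exists_edge_of_mem_inter (p := (G · q)) (q := (G p ·)) (by
    have hk := hs.three_le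
    have hlen : ((s₀ :: m).toFinset).card = (s₀ :: m).length := List.toFinset_card_of_nodup h.cyc.2
    have e1 : (univ.filter fun v => v ∈ s₀ :: m ∧ G v q).card
        + (univ.filter fun v => v ∉ s₀ :: m ∧ G v q).card = (univ.filter (G · q)).card := by
      rw [← card_filter_add_card_filter_not (s := univ.filter (G · q)) (· ∈ s₀ :: m),
        filter_filter, filter_filter]
      simp only [and_comm]
    have e2 : (univ.filter fun v => v ∈ s₀ :: m ∧ G p v).card
        + (univ.filter fun v => v ∉ s₀ :: m ∧ G p v).card = (univ.filter (G p ·)).card := by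
      rw [← card_filter_add_card_filter_not (s := univ.filter (G p ·)) (· ∈ s₀ :: m),
        filter_filter, filter_filter]
      simp only [and_comm]
    have hpq : p ≠ q := fun h' => hd hqA (h' ▸ hpB)
    have hnpq := h3 p hpB hpm q hqA hqm
    have e3 : (univ.filter fun v => v ∉ s₀ :: m ∧ G v q).card
        + (univ.filter fun v => v ∉ s₀ :: m ∧ G p v).card + 2 + (s₀ :: m).length
        ≤ Fintype.card V := by
      rw [← card_union_of_disjoint, ← hlen, ← card_pair hpq, ← card_union_of_disjoint,
        ← card_union_of_disjoint]
      · exact card_le_univ _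
      · rw [disjoint_left]
        simp only [mem_union, mem_filter, mem_univ, true_and, mem_insert, mem_singleton,
          List.mem_toFinset]
        rintro v ((h' | h') | (rfl | rfl))
        exacts [h'.1, h'.1, hpm, hqm]
      · rw [disjoint_left]
        simp only [mem_union, mem_filter, mem_univ, true_and, mem_insert, mem_singleton]
        rintro v (h' | h') (rfl | rfl)
        exacts [hnpq h'.2, hs.irrefl _ h'.2, hs.irrefl _ h'.2, hnpq h'.2]
      · rw [disjoint_left]
        simp only [mem_filter, mem_univ, true_and]
        exact fun v h' h'' => h4 v h'.1 h''.2 h'.2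
    have d1 := hs.inDeg q
    have d2 := hs.outDeg p
    have e2' : (s₀ :: m).length < (univ.filter fun v => v ∈ s₀ :: m ∧ G v q).card
        + (univ.filter fun v => v ∈ s₀ :: m ∧ G p v).card := by
      omega
    exact e2')
  obtain ⟨a, ha, han, hqa, -⟩ := hs.pick hqA hqA hinA hin [q] (by simp; omega)
  simp only [mem_filter] at ha hb
  refine h.insert (u := u) (w := w) (z := z) (R := [q, a, z, b, p]) huw ?_ ?_ ?_ (by simp)
      (by simp) hzA hzB (Or.inl ⟨q, hqA, a, ha.1.1, [u], [z, b, p, w], by simp⟩)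
      (Or.inl ⟨b, hb.1.1, p, hpB, [u, q, a, z], [w], by simp⟩)
  · simp [huq, hqa, ha.2, hb.2, hbp, hpw]
  · clear hin hout hinA houtB hA' hB' h hs
    simp only [List.nodup_cons, List.mem_cons, List.not_mem_nil, or_false, not_or] at *
    and_intros <;> grind
  · simp only [List.mem_cons, List.not_mem_nil, or_false]
    rintro v' (rfl | rfl | rfl | rfl | rfl)
    exacts [by simpa using hqm, by simpa using ha.1.2, by simpa using hz, by simpa using hb.1.2,
      by simpa using hpm]

end Good

end

section

variable {V : Type*} [Fintype V] {G : V → V → Prop} {S A B : Finset V} {k M : ℕ}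

namespace Split

theorem card_compl (h : Split G S A B k M) : (univ \ (A ∪ B)).card ≤ 2 * M := by
  have h1 := card_sdiff_add_card_eq_card (subset_univ (A ∪ B))
  rw [card_union_of_disjoint h.disj, card_univ] at h1
  have h2 := h.cardA
  have h3 := h.cardB
  omega

/-- Every vertex keeps many inneighbours in one of the classes after removing few vertices. -/
theorem many_in (h : Split G S A B k M) (l : List V) (hl : l.length ≤ 16 * M) (z : V) :
    4 * M ≤ ((A.filter (· ∉ l)).filter (G · z)).card ∨
      4 * M ≤ ((B.filter (· ∉ l)).filter (G · z)).card := by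
  have hsub : univ.filter (G · z) ⊆ ((A.filter (· ∉ l)).filter (G · z) ∪
      (B.filter (· ∉ l)).filter (G · z)) ∪ (univ \ (A ∪ B) ∪ l.toFinset) := by
    intro v hv
    simp only [mem_union, mem_filter, mem_sdiff, mem_univ, true_and, List.mem_toFinset] at hv ⊢
    tauto
  have h1 := card_le_card hsub
  have h2 := card_union_le ((A.filter (· ∉ l)).filter (G · z) ∪
      (B.filter (· ∉ l)).filter (G · z)) (univ \ (A ∪ B) ∪ l.toFinset)
  have h3 := card_union_le ((A.filter (· ∉ l)).filter (G · z)) ((B.filter (· ∉ l)).filter (G · z))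
  have h4 := card_union_le (univ \ (A ∪ B)) l.toFinset
  have h5 := List.toFinset_card_le l
  have h6 := h.card_compl
  have h7 := h.inDeg z
  have h8 := h.M_le
  have h9 := h.large_M.2
  by_contra! hc
  omega

theorem many_out (h : Split G S A B k M) (l : List V) (hl : l.length ≤ 16 * M) (z : V) :
    4 * M ≤ ((A.filter (· ∉ l)).filter (G z ·)).card ∨
      4 * M ≤ ((B.filter (· ∉ l)).filter (G z ·)).card :=
  h.reverse.many_in l hl z

theorem many_left (h : Split G S A B k M) (l : List V) (hl : l.length ≤ 16 * M) :
    4 * M ≤ (A.filter (· ∉ l)).card := by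
  have h1 : A ⊆ A.filter (· ∉ l) ∪ l.toFinset := by
    intro v hv
    simp only [mem_union, mem_filter, List.mem_toFinset]
    tauto
  have h2 := card_le_card h1
  have h3 := card_union_le (A.filter (· ∉ l)) l.toFinset
  have h4 := List.toFinset_card_le l
  have h5 := h.cardA
  have h6 := h.M_le
  have h7 := h.large_M.2
  omega

/-- Absorption: a short suitable cycle extends to a Hamilton cycle. -/
theorem exists_hamilton_of_good (h : Split G S A B k M) {s₀ : V} {t m : List V} {K : ℕ}
    (hK : K ≤ M) (hm : Good G A B K s₀ t m) :
    ∃ m', IsCyc G s₀ m' ∧ (∀ v, v ∈ s₀ :: m') ∧ t.Sublist m' := by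
  obtain ⟨m, hm, hmax⟩ := exists_max_of_bounded (Good G A B K s₀ t) (excCount A B s₀)
    (Fintype.card V) ⟨m, hm⟩ (fun m _ => card_le_univ _)
  have hl : (s₀ :: m).length ≤ 16 * M := by
    have h1 : excCount A B s₀ m ≤ (univ \ (A ∪ B)).card := by
      refine card_le_card fun v hv => ?_
      simp only [mem_filter, mem_sdiff, mem_union, mem_univ, true_and] at hv ⊢
      tauto
    have h2 := h.card_compl
    have h3 := hm.len
    have h4 := h.large_M.2
    rw [List.length_cons]
    omega
  have hZ : ∀ z, z ∉ A → z ∉ B → z ∈ s₀ :: m := by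
    intro z hzA hzB
    by_contra hz
    have key : ∃ m', Good G A B K s₀ t m' ∧ excCount A B s₀ m < excCount A B s₀ m' := by
      rcases h.many_in _ hl z with hi | hi <;> rcases h.many_out _ hl z with ho | ho
      · exact hm.exists_insert_same h hz hzA hzB hi ho
      · exact hm.exists_insert_cross h hz hzA hzB hi ho
      · obtain ⟨m', h1, h2⟩ := hm.symm.exists_insert_cross h.symm hz hzB hzA hi ho
        exact ⟨m', h1.symm, by rwa [Good.excCount_comm, Good.excCount_comm (m := m')]⟩
      · obtain ⟨m', h1, h2⟩ := hm.symm.exists_insert_same h.symm hz hzB hzA hi ho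
        exact ⟨m', h1.symm, by rwa [Good.excCount_comm, Good.excCount_comm (m := m')]⟩
    obtain ⟨m', h1, h2⟩ := key
    exact absurd (hmax m' h1) (by omega)
  have hd := disjoint_left.1 h.disj
  obtain ⟨x, hx, y, hy, hxy⟩ := hm.edgeA
  obtain ⟨x', hx', y', hy', hxy'⟩ := hm.edgeB
  obtain ⟨R, hR, hRn, hRm⟩ := h.exists_path_covering hx hy (filter_subset (· ∉ s₀ :: m) A)
    (fun h' => (mem_filter.1 h').2 hxy.mem.1) (h.many_left _ hl)
  obtain ⟨R', hR', hRn', hRm'⟩ := h.symm.exists_path_covering hx' hy'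
    (filter_subset (· ∉ s₀ :: m) B)
    (fun h' => (mem_filter.1 h').2 hxy'.mem.1) (h.symm.many_left _ hl)
  simp only [mem_filter] at hRm hRm'
  obtain ⟨m₁, hm₁, hs₁, hp₁, -, he₁⟩ := hm.cyc.insert hxy hR hRn fun v hv => ((hRm v).1 hv).2
  obtain ⟨m₂, hm₂, hs₂, hp₂, -, -⟩ := hm₁.insert
    (he₁ x' y' hxy' fun h' => hd hx (h'.1 ▸ hx')) hR' hRn' (by
      intro v hv hv'
      rw [List.mem_cons, hp₁.mem_iff, List.mem_append] at hv'
      have := (hRm' v).1 hv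
      rcases hv' with h' | h' | h'
      · exact this.2 (h' ▸ List.mem_cons_self)
      · exact hd ((hRm v).1 h').1 this.1
      · exact this.2 (List.mem_cons_of_mem _ h'))
  refine ⟨m₂, hm₂, fun v => ?_, (hm.sub.trans hs₁).trans hs₂⟩
  rw [List.mem_cons, hp₂.mem_iff, List.mem_append, hp₁.mem_iff, List.mem_append, hRm, hRm']
  have := hZ v
  rw [List.mem_cons] at this ⊢
  tauto

end Split

end

section

/-- `v` has many outneighbours in `X`. -/
def Out {V : Type*} (G : V → V → Prop) (k : ℕ) (X : Finset V) (v : V) : Prop :=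
  200 * k ≤ (X.filter (G v ·)).card

/-- `v` has many inneighbours in `X`. -/
def In {V : Type*} (G : V → V → Prop) (k : ℕ) (X : Finset V) (v : V) : Prop :=
  200 * k ≤ (X.filter (G · v)).card

/-- `u` can be robustly joined to `w` inside `A` or inside `B`. -/
def Joins {V : Type*} (G : V → V → Prop) (k : ℕ) (A B : Finset V) (u w : V) : Prop :=
  (Out G k A u ∧ In G k A w) ∨ (Out G k B u ∧ In G k B w)

theorem exists_mem_avoiding {V : Type*} {T : Finset V} (l : List V) (F : Finset V)
    (h : l.length + F.card < T.card) : ∃ a ∈ T, a ∉ l ∧ a ∉ F := by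
  by_contra! hno
  have hsub : T ⊆ l.toFinset ∪ F := by
    intro a ha
    rw [mem_union, List.mem_toFinset]
    by_cases hal : a ∈ l
    exacts [Or.inl hal, Or.inr (hno a ha hal)]
  have h1 := card_le_card hsub
  have h2 := card_union_le l.toFinset F
  have h3 := List.toFinset_card_le l
  omega

variable {V : Type*} {G : V → V → Prop}

/-- The walks of `L` can be joined up consecutively, starting in `u` and ending in `y`, where
`u` does not belong to the first walk. -/
def LinkedFrom {V : Type*} (P : V → V → Prop) (G : V → V → Prop) : List (List V) → V → V → Prop
  | [], u, y => P u y
  | b :: L, u, y => ∃ a c, P u a ∧ IsWalk G b a c ∧ LinkedFrom P G L c y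

theorem LinkedFrom.linked {P : V → V → Prop} {Res : Finset V} {N : ℕ} {L : List (List V)}
    {u y : V} (h : LinkedFrom P G L u y) (hP : ∀ u w, P u w → Conn G Res N u w) :
    ∃ a, Conn G Res N u a ∧ Linked G Res N L a y := by
  induction L generalizing u with
  | nil => exact ⟨y, hP _ _ h, rfl⟩
  | cons b L ih =>
    obtain ⟨a, c, h1, h2, h3⟩ := h
    obtain ⟨a', h4, h5⟩ := ih h3
    exact ⟨a, hP _ _ h1, c, a', h2, h4, h5⟩

theorem LinkedFrom.append {P : V → V → Prop} {L L' : List (List V)} {u v y : V}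
    (h : LinkedFrom P G L u v) (h' : LinkedFrom P G L' v y) :
    LinkedFrom P G (L ++ [v] :: L') u y := by
  induction L generalizing u with
  | nil => exact ⟨v, v, h, ⟨by simp, by simp, by simp⟩, h'⟩
  | cons b L ih =>
    obtain ⟨a, c, h1, h2, h3⟩ := h
    exact ⟨a, c, h1, h2, ih h3⟩

/-- The lists `D j, [σ (j + 1)], D (j + 1), …, [σ (j + d)], D (j + d)`. -/
def weave {V : Type*} (D : ℕ → List (List V)) (σ : ℕ → V) : ℕ → ℕ → List (List V)
  | 0, j => D j
  | d + 1, j => D j ++ [σ (j + 1)] :: weave D σ d (j + 1)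

theorem linkedFrom_weave {P : V → V → Prop} {D : ℕ → List (List V)} {σ : ℕ → V} {d j : ℕ}
    (h : ∀ i, j ≤ i → i ≤ j + d → LinkedFrom P G (D i) (σ i) (σ (i + 1))) :
    LinkedFrom P G (weave D σ d j) (σ j) (σ (j + d + 1)) := by
  induction d generalizing j with
  | zero => exact h j le_rfl le_rfl
  | succ d ih =>
    have := ih (j := j + 1) fun i h1 h2 => h i (by omega) (by omega)
    rw [show j + 1 + d + 1 = j + (d + 1) + 1 by omega] at this
    exact (h j le_rfl (by omega)).append this

theorem flatten_weave_perm (D : ℕ → List (List V)) (σ : ℕ → V) (d j : ℕ) :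
    (weave D σ d j).flatten.Perm ((List.range' (j + 1) d).map σ ++
      (List.range' j (d + 1)).flatMap fun i => (D i).flatten) := by
  induction d generalizing j with
  | zero => simp [weave]
  | succ d ih =>
    rw [weave, List.flatten_append, List.flatten_cons, List.range'_succ (s := j + 1),
      List.range'_succ (s := j) (n := d + 1), List.flatMap_cons, List.map_cons]
    have h1 := (ih (j + 1)).append_left ((D j).flatten ++ [σ (j + 1)])
    refine (List.Perm.of_eq (by simp)).trans (h1.trans ?_)
    rw [← List.append_assoc, ← List.append_assoc]
    refine List.Perm.append_right _ ?_
    rw [List.append_assoc]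
    exact List.perm_append_comm

theorem sublist_flatten_weave (D : ℕ → List (List V)) (σ : ℕ → V) (d j : ℕ) :
    ((List.range' (j + 1) d).map σ).Sublist (weave D σ d j).flatten := by
  induction d generalizing j with
  | zero => simp
  | succ d ih =>
    rw [weave, List.flatten_append, List.flatten_cons, List.range'_succ, List.map_cons]
    exact ((ih (j + 1)).cons_cons _).trans (List.sublist_append_right _ _)

theorem length_weave_le {D : ℕ → List (List V)} (σ : ℕ → V) (hD : ∀ i, (D i).length ≤ 1)
    (d j : ℕ) : (weave D σ d j).length ≤ 2 * d + 1 := by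
  induction d generalizing j with
  | zero => exact hD j
  | succ d ih =>
    rw [weave, List.length_append, List.length_cons]
    have h1 := hD j
    have h2 := ih (j + 1)
    omega

theorem mem_weave {D : ℕ → List (List V)} (σ : ℕ → V) {b : List V} {d j i : ℕ} (hb : b ∈ D i)
    (h1 : j ≤ i) (h2 : i ≤ j + d) : b ∈ weave D σ d j := by
  induction d generalizing j with
  | zero =>
    obtain rfl : i = j := by omega
    exact hb
  | succ d ih =>
    rw [weave, List.mem_append, List.mem_cons]
    by_cases hij : i = j
    · exact Or.inl (hij ▸ hb)
    · exact Or.inr (Or.inr (ih (by omega) (by omega)))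

/-- A list satisfying `Q` exists outside any small set disjoint from `R`. -/
def Avail {V : Type*} (N : ℕ) (R : Finset V) (Q : List V → Prop) : Prop :=
  ∀ F : Finset V, F.card ≤ N → Disjoint F R → ∃ b, Q b ∧ ∀ x ∈ b, x ∉ F

/-- Greedy choice of disjoint lists. -/
theorem exists_disjoint_of_avail {ι : Type*} [DecidableEq ι] {N c : ℕ} (T : Finset ι)
    (R : ι → Finset V)
    (Q : ι → List V → Prop) (hQ : ∀ i ∈ T, ∀ b, Q i b → b.length ≤ c)
    (hR : ∀ i ∈ T, (R i).card ≤ 2) (hRd : ∀ i ∈ T, ∀ j ∈ T, i ≠ j → Disjoint (R i) (R j))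
    (hav : ∀ i ∈ T, Avail N (R i) (Q i)) (F : Finset V) (hF : ∀ i ∈ T, Disjoint F (R i))
    (hN : F.card + (c + 2) * T.card ≤ N) :
    ∃ b : ι → List V, (∀ i ∈ T, Q i (b i) ∧ ∀ x ∈ b i, x ∉ F) ∧
      ∀ i ∈ T, ∀ j ∈ T, i ≠ j → (b i).Disjoint (b j) := by
  induction T using Finset.induction_on generalizing F with
  | empty => exact ⟨fun _ => [], by simp, by simp⟩
  | insert i T hi ih =>
    have hiT := mem_insert_self i T
    have hT : ∀ j ∈ T, j ∈ insert i T := fun j hj => mem_insert_of_mem hj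
    rw [card_insert_of_notMem hi] at hN
    have hc : (F ∪ T.biUnion R).card ≤ N := by
      have h1 := card_union_le F (T.biUnion R)
      have h2 := card_biUnion_le_card_mul T R 2 fun j hj => hR j (hT j hj)
      nlinarith
    obtain ⟨b₀, hb₀, hb₀F⟩ := hav i hiT (F ∪ T.biUnion R) hc (by
      rw [disjoint_union_left, disjoint_biUnion_left]
      exact ⟨hF i hiT, fun j hj => hRd j (hT j hj) i hiT fun h => hi (h ▸ hj)⟩)
    simp only [mem_union, mem_biUnion, not_or, not_exists, not_and] at hb₀F
    obtain ⟨b, hb, hbd⟩ := ih (fun j hj => hQ j (hT j hj)) (fun j hj => hR j (hT j hj))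
      (fun j hj j' hj' => hRd j (hT j hj) j' (hT j' hj')) (fun j hj => hav j (hT j hj))
      (F ∪ b₀.toFinset) (fun j hj => by
        rw [disjoint_union_left]
        refine ⟨hF j (hT j hj), disjoint_left.2 fun x hx hx' => ?_⟩
        exact (hb₀F x (List.mem_toFinset.1 hx)).2 j hj hx') (by
        have h1 := card_union_le F b₀.toFinset
        have h2 := List.toFinset_card_le b₀
        have h3 := hQ i hiT b₀ hb₀
        rw [mul_add] at hN
        omega)
    have hne : ∀ j ∈ T, j ≠ i := fun j hj h => hi (h ▸ hj)
    have hb' : ∀ j ∈ T, b₀.Disjoint (b j) := fun j hj x hx hx' =>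
      (hb j hj).2 x hx' (mem_union_right _ (List.mem_toFinset.2 hx))
    refine ⟨Function.update b i b₀, ?_, ?_⟩
    · intro j hj
      rcases mem_insert.1 hj with rfl | hj
      · simp only [Function.update_self]
        exact ⟨hb₀, fun x hx => (hb₀F x hx).1⟩
      · rw [Function.update_of_ne (hne j hj)]
        exact ⟨(hb j hj).1, fun x hx hx' => (hb j hj).2 x hx (mem_union_left _ hx')⟩
    · intro j hj j' hj' hjj'
      rcases mem_insert.1 hj with rfl | hjT <;> rcases mem_insert.1 hj' with rfl | hjT'
      · exact absurd rfl hjj'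
      · rw [Function.update_self, Function.update_of_ne (hne j' hjT')]
        exact hb' j' hjT'
      · rw [Function.update_self, Function.update_of_ne (hne j hjT)]
        exact (hb' j hjT).symm
      · rw [Function.update_of_ne (hne j hjT), Function.update_of_ne (hne j' hjT')]
        exact hbd j hjT j' hjT' hjj'

variable [Fintype V] {S A B : Finset V} {k M : ℕ}

namespace Split

theorem large_A (h : Split G S A B k M) : 400 * M ≤ A.card := by
  have h1 := h.cardA
  have h2 := h.M_le
  omega

theorem out_of_mem (h : Split G S A B k M) {v : V} (hv : v ∈ A) : Out G k A v := by
  have h1 := h.card_filter_out hv subset_rfl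
  have h2 := h.large_A
  have h3 := h.large_M
  unfold Out
  omega

theorem in_of_mem (h : Split G S A B k M) {v : V} (hv : v ∈ A) : In G k A v :=
  h.reverse.out_of_mem hv

theorem out_or (h : Split G S A B k M) (v : V) : Out G k A v ∨ Out G k B v := by
  have h3 := h.large_M
  unfold Out
  rcases h.many_out [] (by simp) v with h1 | h1
  · left
    simp only [List.not_mem_nil, not_false_eq_true, filter_true] at h1
    omega
  · right
    simp only [List.not_mem_nil, not_false_eq_true, filter_true] at h1
    omega

theorem in_or (h : Split G S A B k M) (v : V) : In G k A v ∨ In G k B v :=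
  h.reverse.out_or v

theorem conn_of_out_in (h : Split G S A B k M) {u w : V} (hu : Out G k A u) (hw : In G k A w)
    {l : List V} (hl : l.length ≤ 20 * k) :
    Conn G ((A ∪ B).filter (· ∉ l)) (10 * k) u w := by
  intro F hF
  have hM := h.large_M
  have hk := h.three_le
  have hA := h.large_A
  unfold Out at hu
  unfold In at hw
  obtain ⟨a, ha, hal, haF⟩ := exists_mem_avoiding l F (lt_of_lt_of_le (by omega) hu)
  obtain ⟨a', ha', hal', haF'⟩ := exists_mem_avoiding (a :: l) F
    (lt_of_lt_of_le (by rw [List.length_cons]; omega) hw)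
  rw [mem_filter] at ha ha'
  obtain ⟨c, hc, hcl, hac, hca⟩ := h.pick ha.1 ha'.1 subset_rfl (by omega)
    (a :: a' :: (l ++ F.toList)) (by simp; omega)
  simp only [List.mem_cons, List.mem_append, mem_toList, not_or] at hcl hal'
  refine ⟨[a, c, a'], ?_, ?_, by simp, by simp [ha.2, hac, hca, ha'.2]⟩
  · simp only [List.mem_cons, List.not_mem_nil, or_false, mem_filter, mem_union]
    rintro x (rfl | rfl | rfl)
    exacts [⟨⟨Or.inl ha.1, hal⟩, haF⟩, ⟨⟨Or.inl hc, hcl.2.2.1⟩, hcl.2.2.2⟩,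
      ⟨⟨Or.inl ha'.1, hal'.2⟩, haF'⟩]
  · simp only [List.nodup_cons, List.mem_cons, List.not_mem_nil, or_false, not_or,
      not_false_eq_true, List.nodup_nil, and_true]
    exact ⟨⟨Ne.symm hcl.1, Ne.symm hal'.1⟩, hcl.2.1⟩

theorem conn_of_joins (h : Split G S A B k M) {u w : V} (huw : Joins G k A B u w)
    {l : List V} (hl : l.length ≤ 20 * k) :
    Conn G ((A ∪ B).filter (· ∉ l)) (10 * k) u w := by
  rcases huw with ⟨hu, hw⟩ | ⟨hu, hw⟩
  · exact h.conn_of_out_in hu hw hl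
  · rw [union_comm]
    exact h.symm.conn_of_out_in hu hw hl

end Split

end

section

/-- A short walk from `X` to `Y` with an edge inside each of the sets in `W`. -/
def Piece {V : Type*} (G : V → V → Prop) (X Y : Finset V) (W : List (Finset V)) (b : List V) :
    Prop :=
  (∃ x ∈ X, ∃ y ∈ Y, IsWalk G b x y) ∧ b.Nodup ∧ b.length ≤ 11 ∧
    ∀ D ∈ W, ∃ x ∈ D, ∃ y ∈ D, [x, y] <:+: b

variable {V : Type*} [Fintype V] {G : V → V → Prop} {S A B : Finset V} {k M : ℕ}

theorem Split.exists_good_of_requests (h : Split G S A B k M) {σ : ℕ → V} (hσ : σ k = σ 0)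
    (hinj : ∀ i < k, ∀ j < k, σ i = σ j → i = j) (hS : ∀ i < k, σ i ∈ S) {T : Finset ℕ}
    (hT : T ⊆ range k) {X Y R : ℕ → Finset V} {W : ℕ → List (Finset V)}
    (hX : ∀ j ∈ T, (X j = A ∨ X j = B) ∧ Out G k (X j) (σ j))
    (hY : ∀ j ∈ T, (Y j = A ∨ Y j = B) ∧ In G k (Y j) (σ (j + 1)))
    (hJ : ∀ j < k, j ∉ T → Joins G k A B (σ j) (σ (j + 1)))
    (hav : ∀ j ∈ T, Avail (20 * k) (R j) (Piece G (X j) (Y j) (W j)))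
    (hR : ∀ j ∈ T, (R j).card ≤ 2) (hRd : ∀ i ∈ T, ∀ j ∈ T, i ≠ j → Disjoint (R i) (R j))
    (hRS : ∀ j ∈ T, Disjoint S (R j)) (hWA : ∃ j ∈ T, A ∈ W j) (hWB : ∃ j ∈ T, B ∈ W j) :
    ∃ m, Good G A B M (σ 0) ((List.range' 1 (k - 1)).map σ) m := by
  have hk := h.three_le
  have hM := h.large_M
  have hTk : T.card ≤ k := by simpa using card_le_card hT
  obtain ⟨b, hb, hbd⟩ := exists_disjoint_of_avail (c := 11) T R
    (fun j => Piece G (X j) (Y j) (W j)) (fun i _ b hb => hb.2.2.1) hR hRd hav S hRS (by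
      rw [h.cardS]
      omega)
  set D : ℕ → List (List V) := fun j => if j ∈ T then [b j] else [] with hD
  have hDT : ∀ j ∈ T, D j = [b j] := fun j hj => by simp [hD, hj]
  have hDT' : ∀ j, j ∉ T → D j = [] := fun j hj => by simp [hD, hj]
  have hlink : LinkedFrom (Joins G k A B) G (weave D σ (k - 1) 0) (σ 0) (σ 0) := by
    have := linkedFrom_weave (P := Joins G k A B) (G := G) (D := D) (σ := σ) (d := k - 1) (j := 0)
      (fun i _ hi => by
        by_cases hiT : i ∈ T
        · rw [hDT i hiT]
          obtain ⟨x, hx, y, hy, hw⟩ := (hb i hiT).1.1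
          refine ⟨x, y, ?_, hw, ?_⟩
          · obtain ⟨hXi | hXi, ho⟩ := hX i hiT
            · rw [hXi] at hx ho
              exact Or.inl ⟨ho, h.in_of_mem hx⟩
            · rw [hXi] at hx ho
              exact Or.inr ⟨ho, h.symm.in_of_mem hx⟩
          · obtain ⟨hYi | hYi, ho⟩ := hY i hiT
            · rw [hYi] at hy ho
              exact Or.inl ⟨h.out_of_mem hy, ho⟩
            · rw [hYi] at hy ho
              exact Or.inr ⟨h.symm.out_of_mem hy, ho⟩
        · rw [hDT' i hiT]
          exact hJ i (by omega) hiT)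
    rw [show 0 + (k - 1) + 1 = k by omega, hσ] at this
    exact this
  set L := weave D σ (k - 1) 0 with hL
  have hperm := flatten_weave_perm D σ (k - 1) 0
  have hsub := sublist_flatten_weave D σ (k - 1) 0
  rw [← hL, zero_add, show k - 1 + 1 = k by omega] at hperm
  rw [← hL, zero_add] at hsub
  have hDl : ∀ i, (D i).length ≤ 1 := fun i => by
    by_cases hi : i ∈ T
    · simp [hDT i hi]
    · simp [hDT' i hi]
  have hLl := length_weave_le σ hDl (k - 1) 0
  rw [← hL] at hLl
  have hDf : ∀ i, (D i).flatten.length ≤ 11 := fun i => by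
    by_cases hi : i ∈ T
    · simpa [hDT i hi] using (hb i hi).1.2.2.1
    · simp [hDT' i hi]
  have hflat : L.flatten.length ≤ 12 * k := by
    rw [hperm.length_eq, List.length_append, List.length_map, List.length_range',
      List.length_flatMap]
    have : ((List.range' 0 k).map fun i => (D i).flatten.length).sum ≤ k * 11 := by
      refine (List.sum_le_card_nsmul _ 11 ?_).trans (by simp)
      simp only [List.mem_map]
      rintro x ⟨i, -, rfl⟩
      exact hDf i
    omega
  have hσ0 : ∀ x ∈ σ 0 :: L.flatten, x ∈ S ∨ ∃ i ∈ T, x ∈ b i := by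
    intro x hx
    rw [List.mem_cons, hperm.mem_iff, List.mem_append, List.mem_map, List.mem_flatMap] at hx
    rcases hx with rfl | ⟨i, hi, rfl⟩ | ⟨i, hi, hx⟩
    · exact Or.inl (hS 0 (by omega))
    · rw [List.mem_range'_1] at hi
      exact Or.inl (hS i (by omega))
    · by_cases hiT : i ∈ T
      · rw [hDT i hiT] at hx
        exact Or.inr ⟨i, hiT, by simpa using hx⟩
      · rw [hDT' i hiT] at hx
        simp at hx
  have hDS : ∀ i x, x ∈ (D i).flatten → x ∉ S := by
    intro i x hx
    by_cases hiT : i ∈ T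
    · rw [hDT i hiT] at hx
      exact (hb i hiT).2 x (by simpa using hx)
    · rw [hDT' i hiT] at hx
      simp at hx
  have hnd : (σ 0 :: L.flatten).Nodup := by
    rw [(hperm.cons (σ 0)).nodup_iff, ← List.cons_append, ← List.map_cons, List.nodup_append']
    refine ⟨?_, ?_, ?_⟩
    · have : 0 :: List.range' 1 (k - 1) = List.range' 0 k := by
        rw [show k = k - 1 + 1 by omega, List.range'_succ]
        simp
      rw [this, List.nodup_map_iff_inj_on List.nodup_range']
      intro i hi j hj hij
      rw [List.mem_range'_1] at hi hj
      exact hinj i (by omega) j (by omega) hij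
    · rw [List.nodup_flatMap]
      refine ⟨fun i _ => ?_, ?_⟩
      · by_cases hi : i ∈ T
        · simpa [hDT i hi] using (hb i hi).1.2.1
        · simp [hDT' i hi]
      · refine List.Pairwise.imp (fun {i j} hij => ?_) (List.nodup_range' (s := 0) (n := k))
        change (D i).flatten.Disjoint (D j).flatten
        by_cases hi : i ∈ T
        · by_cases hj : j ∈ T
          · rw [hDT i hi, hDT j hj]
            simpa using hbd i hi j hj hij
          · simp [hDT' j hj]
        · simp [hDT' i hi]
    · intro x hx hx'
      rw [List.mem_flatMap] at hx'
      obtain ⟨i, -, hi⟩ := hx'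
      refine hDS i x hi ?_
      rw [List.map_cons, List.mem_cons, List.mem_map] at hx
      rcases hx with rfl | ⟨j, hj, rfl⟩
      · exact hS 0 (by omega)
      · rw [List.mem_range'_1] at hj
        exact hS j (by omega)
  have hlen : (σ 0 :: L.flatten).length ≤ 20 * k := by
    rw [List.length_cons]
    omega
  obtain ⟨a, hca, hla⟩ := hlink.linked fun u w huw => h.conn_of_joins huw hlen
  obtain ⟨m, hm, hms, hmi, -, hml⟩ := hla.exists_isCyc hca hnd (fun x hx hx' =>
    (mem_filter.1 hx').2 hx) (by omega)
  have hedge : ∀ E : Finset V, (∃ j ∈ T, E ∈ W j) → ∃ x ∈ E, ∃ y ∈ E, CycEdge (σ 0) m x y := by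
    rintro E ⟨j, hj, hE⟩
    obtain ⟨x, hx, y, hy, hxy⟩ := (hb j hj).1.2.2.2 E hE
    refine ⟨x, hx, y, hy, (hxy.trans (hmi (b j) ?_)).trans ⟨[σ 0], [σ 0], by simp⟩⟩
    refine mem_weave σ (i := j) (by simp [hDT j hj]) (by omega) ?_
    have := mem_range.1 (hT hj)
    omega
  exact ⟨m, hm, hsub.trans hms, hedge A hWA, hedge B hWB, by omega⟩

end

section

theorem Avail.mono {V : Type*} {N N' : ℕ} {R R' : Finset V} {Q : List V → Prop}
    (h : Avail N R Q) (hN : N' ≤ N) (hR : R ⊆ R') : Avail N' R' Q :=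
  fun F hF hd => h F (hF.trans hN) (hd.mono_right hR)

theorem Avail.imp {V : Type*} {N : ℕ} {R : Finset V} {Q Q' : List V → Prop}
    (h : Avail N R Q) (hQ : ∀ b, Q b → Q' b) : Avail N R Q' :=
  fun F hF hd => let ⟨b, hb, hbF⟩ := h F hF hd; ⟨b, hQ b hb, hbF⟩

/-- A walk from `A` to `B` with at most five vertices, with an edge inside `A` and one inside
`B`. -/
def Crossing {V : Type*} (G : V → V → Prop) (A B : Finset V) (b : List V) : Prop :=
  Piece G A B [A, B] b ∧ b.length ≤ 5

/-- Walks from `A` to `B` are available outside any small set. -/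
def Rich {V : Type*} (G : V → V → Prop) (A B : Finset V) (k : ℕ) : Prop :=
  Avail (30 * k) ∅ (Crossing G A B)

variable {V : Type*} [Fintype V] {G : V → V → Prop} {S A B : Finset V} {k M : ℕ}

/-- The vertices outside `S` through which one can robustly pass from `A` to `B`. -/
noncomputable def mids (G : V → V → Prop) (S : Finset V) (k : ℕ) (A B : Finset V) : Finset V :=
  univ.filter fun v => v ∉ S ∧ In G k A v ∧ Out G k B v

namespace Split

theorem exists_piece (h : Split G S A B k M) {F : Finset V} (hF : F.card ≤ 30 * k) {p q : V}
    {μ : List V} (hp : p ∈ A) (hq : q ∈ B) (hpF : p ∉ F) (hqF : q ∉ F) (hμF : ∀ x ∈ μ, x ∉ F)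
    (hpμ : p ∉ μ) (hqμ : q ∉ μ) (hμ : μ.length ≤ 1) (hc : (p :: (μ ++ [q])).IsChain G) :
    ∃ b, Crossing G A B b ∧ ∀ x ∈ b, x ∉ F := by
  have hM := h.large_M
  have hk := h.three_le
  have hA := h.large_A
  have hB := h.symm.large_A
  have hd := disjoint_left.1 h.disj
  obtain ⟨p₀, hp₀, hp₀l, -, hpp⟩ := h.pick hp hp subset_rfl (by omega)
    (p :: q :: (μ ++ F.toList)) (by simp; omega)
  obtain ⟨q₀, hq₀, hq₀l, hqq, -⟩ := h.symm.pick hq hq subset_rfl (by omega)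
    (p :: q :: (μ ++ F.toList)) (by simp; omega)
  have hμn : μ.Nodup := by
    match μ, hμ with
    | [], _ => simp
    | [x], _ => simp
  simp only [List.mem_cons, List.mem_append, mem_toList, not_or] at hp₀l hq₀l
  have hlast : (p₀ :: p :: (μ ++ [q, q₀])).getLast? = some q₀ := by
    rw [show p₀ :: p :: (μ ++ [q, q₀]) = (p₀ :: p :: (μ ++ [q])) ++ [q₀] by simp,
      List.getLast?_concat]
  have hlen : (p₀ :: p :: (μ ++ [q, q₀])).length ≤ 5 := by
    simp
    omega
  refine ⟨p₀ :: p :: (μ ++ [q, q₀]),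
    ⟨⟨⟨p₀, hp₀, q₀, hq₀, ?_, by simp, hlast⟩, ?_, by omega, ?_⟩, hlen⟩, ?_⟩
  · have : (p₀ :: p :: (μ ++ [q])).IsChain G := List.IsChain.cons_cons hpp hc
    have h2 : p₀ :: p :: (μ ++ [q, q₀]) = (p₀ :: p :: μ) ++ q :: [q₀] := by simp
    rw [h2, List.isChain_split]
    exact ⟨by simpa using this, by simp [hqq]⟩
  · have h1 : p ≠ q := fun h' => hd hp (h' ▸ hq)
    have h2 : p₀ ≠ q₀ := fun h' => hd hp₀ (h' ▸ hq₀)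
    simp only [List.nodup_cons, List.mem_cons, List.mem_append, List.not_mem_nil, or_false,
      not_or, List.nodup_append', hμn, List.Disjoint, List.nodup_nil, not_false_eq_true, and_true,
      true_and]
    refine ⟨⟨hp₀l.1, hp₀l.2.2.1, hp₀l.2.1, h2⟩, ⟨hpμ, h1, Ne.symm hq₀l.1⟩,
      Ne.symm hq₀l.2.1, ?_⟩
    rintro x hx (rfl | rfl)
    exacts [hqμ hx, hq₀l.2.2.1 hx]
  · simp only [List.mem_cons, List.not_mem_nil, or_false]
    rintro D (rfl | rfl)
    · exact ⟨p₀, hp₀, p, hp, [], μ ++ [q, q₀], by simp⟩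
    · exact ⟨q, hq, q₀, hq₀, p₀ :: p :: μ, [], by simp⟩
  · simp only [List.mem_cons, List.mem_append, List.not_mem_nil, or_false]
    rintro x (rfl | rfl | hx | rfl | rfl)
    exacts [hp₀l.2.2.2, hpF, hμF _ hx, hqF, hq₀l.2.2.2]

theorem avail_of_mem_mids (h : Split G S A B k M) {v : V} (hv : v ∈ mids G S k A B) :
    Avail (30 * k) {v} (Crossing G A B) := by
  intro F hF hFv
  obtain ⟨-, hi, ho⟩ := (mem_filter.1 hv).2
  rw [disjoint_singleton_right] at hFv
  unfold In at hi
  unfold Out at ho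
  have hk := h.three_le
  obtain ⟨p, hp, hpv, hpF⟩ := exists_mem_avoiding [v] F (lt_of_lt_of_le (by simp; omega) hi)
  obtain ⟨q, hq, hqv, hqF⟩ := exists_mem_avoiding [v] F (lt_of_lt_of_le (by simp; omega) ho)
  rw [mem_filter] at hp hq
  exact h.exists_piece hF (μ := [v]) hp.1 hq.1 hpF hqF (by simpa using hFv) hpv hqv (by simp)
    (by simp [hp.2, hq.2])

theorem avail_edge (h : Split G S A B k M) : Avail (20 * k) ∅ (Piece G A A [A]) := by
  intro F hF _
  have hM := h.large_M
  have hk := h.three_le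
  have hA := h.large_A
  obtain ⟨x, hx, -, hxF⟩ := exists_mem_avoiding (T := A) [] F (by simp; omega)
  obtain ⟨y, hy, hyF, hxy, -⟩ := h.pick hx hx subset_rfl (by omega) (x :: F.toList)
    (by simp; omega)
  simp only [List.mem_cons, mem_toList, not_or] at hyF
  refine ⟨[x, y], ⟨⟨x, hx, y, hy, by simp [hxy], by simp, by simp⟩, ?_, by simp, ?_⟩, ?_⟩
  · simpa using Ne.symm hyF.1
  · simp only [List.mem_cons, List.not_mem_nil, or_false]
    rintro D rfl
    exact ⟨x, hx, y, hy, List.infix_refl _⟩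
  · simp only [List.mem_cons, List.not_mem_nil, or_false]
    rintro v (rfl | rfl)
    exacts [hxF, hyF.2]

theorem exists_generic (h : Split G S A B k M) {F : Finset V} (hF : F.card ≤ 61 * k) :
    ∃ p ∈ A, p ∉ F ∧ ∀ v ∈ F, (G p v → In G k A v) ∧ (G v p → Out G k A v) := by
  by_contra! hno
  have hsub : A ⊆ F ∪ F.biUnion fun v =>
      (if In G k A v then ∅ else A.filter (G · v)) ∪
        if Out G k A v then ∅ else A.filter (G v ·) := by
    intro p hp
    rw [mem_union]
    by_cases hpF : p ∈ F
    · exact Or.inl hpF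
    · obtain ⟨v, hv, hv'⟩ := hno p hp hpF
      refine Or.inr (mem_biUnion.2 ⟨v, hv, ?_⟩)
      rw [mem_union]
      by_cases h1 : G p v → In G k A v
      · obtain ⟨h2, h3⟩ := hv' h1
        right
        simp [h3, hp, h2]
      · left
        push Not at h1
        simp [h1.1, h1.2, hp]
  have h1 := card_le_card hsub
  have h2 := card_union_le F (F.biUnion fun v =>
      (if In G k A v then ∅ else A.filter (G · v)) ∪ if Out G k A v then ∅ else A.filter (G v ·))
  have h3 : (F.biUnion fun v => (if In G k A v then ∅ else A.filter (G · v)) ∪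
      if Out G k A v then ∅ else A.filter (G v ·)).card ≤ F.card * (400 * k) := by
    refine card_biUnion_le_card_mul _ _ _ fun v _ => (card_union_le _ _).trans ?_
    have h4 : (if In G k A v then (∅ : Finset V) else A.filter (G · v)).card ≤ 200 * k := by
      split_ifs with h'
      · simp
      · exact (not_le.1 h').le
    have h5 : (if Out G k A v then (∅ : Finset V) else A.filter (G v ·)).card ≤ 200 * k := by
      split_ifs with h'
      · simp
      · exact (not_le.1 h').le
    omega
  have h4 := h.large_A
  have h5 := h.le_M
  have h6 := h.three_le
  have h7 : F.card * (400 * k) ≤ 61 * k * (400 * k) := Nat.mul_le_mul_right _ hF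
  nlinarith

theorem not_rich (h : Split G S A B k M) (hr : ¬ Rich G A B k) :
    ∃ F : Finset V, F.card ≤ 30 * k ∧ ∀ p ∈ A, ∀ q ∈ B, p ∉ F → q ∉ F →
      ¬ G p q ∧ ∀ v, G p v → G v q → v ∈ F := by
  unfold Rich Avail at hr
  push Not at hr
  obtain ⟨F, hF, -, hno⟩ := hr
  refine ⟨F, hF, fun p hp q hq hpF hqF => ⟨fun hpq => ?_, fun v hpv hvq => ?_⟩⟩
  · obtain ⟨b, hb, hbF⟩ := h.exists_piece hF (μ := []) hp hq hpF hqF (by simp) (by simp) (by simp)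
      (by simp) (by simpa using hpq)
    obtain ⟨x, hx, hx'⟩ := hno b hb
    exact hbF x hx hx'
  · by_contra hvF
    have h1 : p ≠ v := fun h' => h.irrefl p (by rwa [← h'] at hpv)
    have h2 : q ≠ v := fun h' => h.irrefl q (by rwa [← h'] at hvq)
    obtain ⟨b, hb, hbF⟩ := h.exists_piece hF (μ := [v]) hp hq hpF hqF (by simpa using hvF)
      (by simpa using h1) (by simpa using h2) (by simp) (by simp [hpv, hvq])
    obtain ⟨x, hx, hx'⟩ := hno b hb
    exact hbF x hx hx'

theorem card_mids_of_not_rich (h : Split G S A B k M) (hr : ¬ Rich G A B k) :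
    k ≤ (mids G S k A B).card + (S.filter fun s => In G k A s ∧ Out G k B s).card := by
  obtain ⟨F, hF, hno⟩ := h.not_rich hr
  have hk := h.three_le
  have hFS : (F ∪ S).card ≤ 61 * k := by
    have h1 := card_union_le F S
    have h2 := h.cardS
    omega
  obtain ⟨p, hp, hpF, hpv⟩ := h.exists_generic hFS
  obtain ⟨q, hq, hqF, hqv⟩ := h.symm.exists_generic hFS
  rw [mem_union, not_or] at hpF hqF
  obtain ⟨hpq, hmid⟩ := hno p hp q hq hpF.1 hqF.1
  have hne : p ≠ q := fun h' => disjoint_left.1 h.disj hp (h' ▸ hq)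
  have h1 := card_union_add_card_inter (univ.filter (G p ·)) (univ.filter (G · q))
  have h2 : (univ.filter (G p ·) ∪ univ.filter (G · q)).card + 2 ≤ Fintype.card V := by
    rw [← card_pair hne, ← card_union_of_disjoint]
    · exact card_le_univ _
    · rw [disjoint_left]
      simp only [mem_union, mem_filter, mem_univ, true_and, mem_insert, mem_singleton]
      rintro v (h' | h') (rfl | rfl)
      exacts [h.irrefl _ h', hpq h', hpq h', h.irrefl _ h']
  have h3 : univ.filter (G p ·) ∩ univ.filter (G · q) ⊆
      mids G S k A B ∪ S.filter fun s => In G k A s ∧ Out G k B s := by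
    intro v hv
    simp only [mem_inter, mem_filter, mem_univ, true_and] at hv
    have hvF : v ∈ F ∪ S := mem_union_left _ (hmid v hv.1 hv.2)
    have h4 := (hpv v hvF).1 hv.1
    have h5 := (hqv v hvF).2 hv.2
    simp only [mids, mem_union, mem_filter, mem_univ, true_and]
    tauto
  have h4 := (card_le_card h3).trans (card_union_le _ _)
  have h5 := h.outDeg p
  have h6 := h.inDeg q
  omega

theorem card_mids_of_not_rich_of_not_rich (h : Split G S A B k M) (hr : ¬ Rich G A B k)
    (hr' : ¬ Rich G B A k) :
    4 * k ≤ 2 * (mids G S k A B ∪ mids G S k B A).card +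
      ∑ s ∈ S, ((if Out G k A s then 1 else 0) + (if Out G k B s then 1 else 0) +
        (if In G k A s then 1 else 0) + (if In G k B s then 1 else 0)) := by
  obtain ⟨F, hF, hno⟩ := h.not_rich hr
  obtain ⟨F', hF', hno'⟩ := h.symm.not_rich hr'
  have hFS : (F ∪ F' ∪ S).card ≤ 61 * k := by
    have h1 := card_union_le (F ∪ F') S
    have h1 := card_union_le F F'
    have h2 := h.cardS
    omega
  obtain ⟨p, hp, hpF, hpv⟩ := h.exists_generic hFS
  obtain ⟨q, hq, hqF, hqv⟩ := h.symm.exists_generic hFS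
  simp only [mem_union, not_or] at hpF hqF
  obtain ⟨hpq, hmid⟩ := hno p hp q hq hpF.1.1 hqF.1.1
  obtain ⟨hqp, hmid'⟩ := hno' q hq p hp hqF.1.2 hpF.1.2
  have hne : p ≠ q := fun h' => disjoint_left.1 h.disj hp (h' ▸ hq)
  set w : V → ℕ := fun s => (if Out G k A s then 1 else 0) + (if Out G k B s then 1 else 0) +
        (if In G k A s then 1 else 0) + (if In G k B s then 1 else 0) with hw
  have key : ∀ v, ((if G p v then 1 else 0) + (if G v p then 1 else 0) + (if G q v then 1 else 0) +
      (if G v q then 1 else 0)) + (if v ∈ S then 2 else 0) +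
      (if v ∈ ({p, q} : Finset V) then 2 else 0)
      ≤ 2 + (if v ∈ mids G S k A B ∪ mids G S k B A then 2 else 0) + if v ∈ S then w v else 0 := by
    intro v
    by_cases hvS : v ∈ S
    · have hvF : v ∈ F ∪ F' ∪ S := mem_union_right _ hvS
      have h1 : v ∉ ({p, q} : Finset V) := by
        simp only [mem_insert, mem_singleton, not_or]
        exact ⟨fun h' => hpF.2 (h' ▸ hvS), fun h' => hqF.2 (h' ▸ hvS)⟩
      have h2 := hpv v hvF
      have h3 := hqv v hvF
      have e : ∀ {P Q : Prop}, (P → Q) → (if P then 1 else 0) ≤ if Q then 1 else 0 := by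
        intro P Q hPQ
        by_cases hP : P
        · simp [hP, hPQ hP]
        · simp [hP]
      have e1 := e h2.1
      have e2 := e h2.2
      have e3 := e h3.1
      have e4 := e h3.2
      rw [if_pos hvS, if_pos hvS, if_neg h1, hw]
      simp only
      omega
    · rw [if_neg hvS, if_neg hvS]
      by_cases hvpq : v ∈ ({p, q} : Finset V)
      · rw [if_pos hvpq]
        simp only [mem_insert, mem_singleton] at hvpq
        rcases hvpq with rfl | rfl
        · simp [h.irrefl, hpq, hqp]
        · simp [h.irrefl, hpq, hqp]
      · rw [if_neg hvpq]
        by_cases hvm : v ∈ mids G S k A B ∪ mids G S k B A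
        · rw [if_pos hvm]
          split_ifs <;> omega
        · rw [if_neg hvm]
          simp only [mids, mem_union, mem_filter, mem_univ, true_and, not_or] at hvm
          have h1 : ¬ (G p v ∧ G v q) := fun h' => by
            have hvF : v ∈ F ∪ F' ∪ S :=
              mem_union_left _ (mem_union_left _ (hmid v h'.1 h'.2))
            exact hvm.1 ⟨hvS, (hpv v hvF).1 h'.1, (hqv v hvF).2 h'.2⟩
          have h2 : ¬ (G q v ∧ G v p) := fun h' => by
            have hvF : v ∈ F ∪ F' ∪ S :=
              mem_union_left _ (mem_union_right _ (hmid' v h'.1 h'.2))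
            exact hvm.2 ⟨hvS, (hqv v hvF).1 h'.1, (hpv v hvF).2 h'.2⟩
          split_ifs <;> first | omega | tauto
  have hsum := sum_le_sum fun v (_ : v ∈ (univ : Finset V)) => key v
  simp only [sum_add_distrib, sum_ite_mem, univ_inter, sum_const, smul_eq_mul, card_univ,
    ← card_filter] at hsum
  rw [card_pair hne, h.cardS] at hsum
  have d1 := h.outDeg p
  have d2 := h.inDeg p
  have d3 := h.outDeg q
  have d4 := h.inDeg q
  change 4 * k ≤ 2 * (mids G S k A B ∪ mids G S k B A).card + ∑ s ∈ S, w s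
  omega

end Split

end

section

theorem exists_assignment {V : Type*} {N : ℕ} {Q : List V → Prop} {I : Finset ℕ} {M' : Finset V}
    (hM : ∀ v ∈ M', Avail N {v} Q) (h : Avail N ∅ Q ∨ I.card ≤ M'.card) :
    ∃ R : ℕ → Finset V, (∀ j, R j ⊆ M') ∧ (∀ j, (R j).card ≤ 1) ∧
      (∀ i ∈ I, ∀ j ∈ I, i ≠ j → Disjoint (R i) (R j)) ∧ ∀ j ∈ I, Avail N (R j) Q := by
  obtain h | h := h
  · exact ⟨fun _ => ∅, by simp, by simp, by simp, fun _ _ => h⟩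
  · obtain ⟨f⟩ : Nonempty (I ↪ M') := Function.Embedding.nonempty_of_card_le (by simpa using h)
    refine ⟨fun j => if hj : j ∈ I then {(f ⟨j, hj⟩ : V)} else ∅, fun j => ?_, fun j => ?_,
      fun i hi j hj hij => ?_, fun j hj => ?_⟩
    · by_cases hj : j ∈ I
      · simp [hj]
      · simp [hj]
    · by_cases hj : j ∈ I
      · simp [hj]
      · simp [hj]
    · simpa [hi, hj, Subtype.coe_inj] using hij
    · simpa [hj] using hM _ (f ⟨j, hj⟩).2

theorem exists_disjoint_subsets {V : Type*} {M₁ M₂ : Finset V} {a b : ℕ} (ha : a ≤ M₁.card)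
    (hb : b ≤ M₂.card) (hab : a + b ≤ (M₁ ∪ M₂).card) :
    ∃ N₁ ⊆ M₁, ∃ N₂ ⊆ M₂, Disjoint N₁ N₂ ∧ a ≤ N₁.card ∧ b ≤ N₂.card := by
  obtain h | h := le_total a (M₁ \ M₂).card
  · exact ⟨M₁ \ M₂, sdiff_subset, M₂, subset_rfl, sdiff_disjoint, h, hb⟩
  · obtain ⟨N, h1, h2, h3⟩ := exists_subsuperset_card_eq (sdiff_subset (s := M₁) (t := M₂)) h ha
    refine ⟨N, h2, M₂ \ N, sdiff_subset, disjoint_sdiff, h3.ge, ?_⟩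
    have h4 : M₁ ∪ M₂ ⊆ N ∪ M₂ \ N := by
      intro v hv
      by_cases h5 : v ∈ N
      · exact mem_union_left _ h5
      · by_cases h6 : v ∈ M₂
        · exact mem_union_right _ (mem_sdiff.2 ⟨h6, h5⟩)
        · have h7 : v ∈ M₁ := (mem_union.1 hv).resolve_right h6
          exact absurd (h1 (mem_sdiff.2 ⟨h7, h6⟩)) h5
    have h5 := card_le_card h4
    have h6 := card_union_le N (M₂ \ N)
    omega

theorem exists_assignment₂ {V : Type*} {N : ℕ} {Q₁ Q₂ : List V → Prop} {I₁ I₂ : Finset ℕ}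
    {M₁ M₂ : Finset V} (hI : Disjoint I₁ I₂) (hM₁ : ∀ v ∈ M₁, Avail N {v} Q₁)
    (hM₂ : ∀ v ∈ M₂, Avail N {v} Q₂) (h₁ : Avail N ∅ Q₁ ∨ I₁.card ≤ M₁.card)
    (h₂ : Avail N ∅ Q₂ ∨ I₂.card ≤ M₂.card)
    (h₁₂ : Avail N ∅ Q₁ ∨ Avail N ∅ Q₂ ∨ I₁.card + I₂.card ≤ (M₁ ∪ M₂).card) :
    ∃ R : ℕ → Finset V, (∀ j, R j ⊆ M₁ ∪ M₂) ∧ (∀ j, (R j).card ≤ 1) ∧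
      (∀ i ∈ I₁ ∪ I₂, ∀ j ∈ I₁ ∪ I₂, i ≠ j → Disjoint (R i) (R j)) ∧
      (∀ j ∈ I₁, Avail N (R j) Q₁) ∧ ∀ j ∈ I₂, Avail N (R j) Q₂ := by
  obtain ⟨N₁, hN₁, N₂, hN₂, hd, h1, h2⟩ : ∃ N₁ ⊆ M₁, ∃ N₂ ⊆ M₂, Disjoint N₁ N₂ ∧
      (Avail N ∅ Q₁ ∨ I₁.card ≤ N₁.card) ∧ (Avail N ∅ Q₂ ∨ I₂.card ≤ N₂.card) := by
    by_cases ha : Avail N ∅ Q₁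
    · exact ⟨∅, empty_subset _, M₂, subset_rfl, disjoint_empty_left _, Or.inl ha, h₂⟩
    · by_cases hb : Avail N ∅ Q₂
      · exact ⟨M₁, subset_rfl, ∅, empty_subset _, disjoint_empty_right _, h₁, Or.inl hb⟩
      · obtain ⟨N₁, hN₁, N₂, hN₂, hd, h1, h2⟩ := exists_disjoint_subsets (h₁.resolve_left ha)
          (h₂.resolve_left hb) ((h₁₂.resolve_left ha).resolve_left hb)
        exact ⟨N₁, hN₁, N₂, hN₂, hd, Or.inr h1, Or.inr h2⟩
  obtain ⟨R₁, a1, a2, a3, a4⟩ := exists_assignment (fun v hv => hM₁ v (hN₁ hv)) h1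
  obtain ⟨R₂, b1, b2, b3, b4⟩ := exists_assignment (fun v hv => hM₂ v (hN₂ hv)) h2
  have hI' : ∀ j ∈ I₂, j ∉ I₁ := fun j hj hj' => disjoint_left.1 hI hj' hj
  refine ⟨fun j => if j ∈ I₁ then R₁ j else R₂ j, fun j => ?_, fun j => ?_,
    fun i hi j hj hij => ?_, fun j hj => ?_, fun j hj => ?_⟩
  · simp only
    split_ifs
    exacts [(a1 j).trans (hN₁.trans subset_union_left), (b1 j).trans (hN₂.trans subset_union_right)]
  · simp only
    split_ifs
    exacts [a2 j, b2 j]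
  · simp only
    rw [mem_union] at hi hj
    by_cases hi' : i ∈ I₁ <;> by_cases hj' : j ∈ I₁ <;> simp only [hi', hj', if_true, if_false]
    · exact a3 i hi' j hj' hij
    · exact hd.mono (a1 i) (b1 j)
    · exact (hd.mono (a1 j) (b1 i)).symm
    · exact b3 i (hi.resolve_left hi') j (hj.resolve_left hj') hij
  · simpa [hj] using a4 j hj
  · simpa [hI' j hj] using b4 j hj

/-- The number of the four robust adjacencies of `v` to `A` and `B`. -/
noncomputable def ties {V : Type*} (G : V → V → Prop) (k : ℕ) (A B : Finset V) (v : V) : ℕ :=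
  (if Out G k A v then 1 else 0) + (if Out G k B v then 1 else 0) +
    (if In G k A v then 1 else 0) + (if In G k B v then 1 else 0)

theorem sum_shift {k : ℕ} (f : ℕ → ℕ) (hf : f k = f 0) :
    ∑ j ∈ range k, f (j + 1) = ∑ j ∈ range k, f j := by
  have h1 := sum_range_succ f k
  have h2 := sum_range_succ' f k
  omega

theorem sum_ties {V : Type*} {G : V → V → Prop} {A B : Finset V} {k : ℕ} {σ : ℕ → V}
    (hσ : σ k = σ 0) : ∑ j ∈ range k, ties G k A B (σ j) =
    ∑ j ∈ range k, ((if Out G k A (σ j) then 1 else 0) + (if Out G k B (σ j) then 1 else 0) +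
      (if In G k A (σ (j + 1)) then 1 else 0) + (if In G k B (σ (j + 1)) then 1 else 0)) := by
  simp only [ties, sum_add_distrib]
  rw [sum_shift (fun j => if In G k A (σ j) then 1 else 0) (by simp only [hσ]),
    sum_shift (fun j => if In G k B (σ j) then 1 else 0) (by simp only [hσ])]

variable {V : Type*} [Fintype V] {G : V → V → Prop} {S A B : Finset V} {k M : ℕ} {σ : ℕ → V}

namespace Split

theorem eq_image (h : Split G S A B k M) (hinj : ∀ i < k, ∀ j < k, σ i = σ j → i = j)
    (hS : ∀ i < k, σ i ∈ S) : S = (range k).image σ := by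
  symm
  refine eq_of_subset_of_card_le ?_ ?_
  · rw [image_subset_iff]
    exact fun i hi => hS i (mem_range.1 hi)
  · rw [h.cardS, card_image_of_injOn, card_range]
    exact fun i hi j hj => hinj i (mem_range.1 hi) j (mem_range.1 hj)

theorem exists_supply (h : Split G S A B k M) (hinj : ∀ i < k, ∀ j < k, σ i = σ j → i = j)
    (hS : ∀ i < k, σ i ∈ S) {I₁ I₂ : Finset ℕ} (hI : Disjoint I₁ I₂)
    (h₁ : I₁.card + ((range k).filter fun j => In G k A (σ j) ∧ Out G k B (σ j)).card ≤ k)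
    (h₂ : I₂.card + ((range k).filter fun j => In G k B (σ j) ∧ Out G k A (σ j)).card ≤ k)
    (h₁₂ : 2 * (I₁.card + I₂.card) + ∑ j ∈ range k, ties G k A B (σ j) ≤ 4 * k) :
    ∃ R : ℕ → Finset V, (∀ j, Disjoint S (R j)) ∧ (∀ j, (R j).card ≤ 1) ∧
      (∀ i ∈ I₁ ∪ I₂, ∀ j ∈ I₁ ∪ I₂, i ≠ j → Disjoint (R i) (R j)) ∧
      (∀ j ∈ I₁, Avail (30 * k) (R j) (Crossing G A B)) ∧
      ∀ j ∈ I₂, Avail (30 * k) (R j) (Crossing G B A) := by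
  have hσ : Set.InjOn σ (range k) :=
    fun i hi j hj => hinj i (mem_range.1 hi) j (mem_range.1 hj)
  have hSi := h.eq_image hinj hS
  have hf : ∀ (P : V → Prop) [DecidablePred P],
      (S.filter P).card = ((range k).filter fun j => P (σ j)).card := by
    intro P _
    rw [hSi, filter_image, card_image_of_injOn (hσ.mono (filter_subset _ _))]
  obtain ⟨R, r1, r2, r3, r4, r5⟩ := exists_assignment₂ hI
    (fun v hv => h.avail_of_mem_mids (v := v) hv) (fun v hv => h.symm.avail_of_mem_mids (v := v) hv)
    (by
      by_cases hr : Rich G A B k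
      · exact Or.inl hr
      · have h3 := h.card_mids_of_not_rich hr
        rw [hf fun s => In G k A s ∧ Out G k B s] at h3
        exact Or.inr (by omega))
    (by
      by_cases hr : Rich G B A k
      · exact Or.inl hr
      · have h3 := h.symm.card_mids_of_not_rich hr
        rw [hf fun s => In G k B s ∧ Out G k A s] at h3
        exact Or.inr (by omega))
    (by
      by_cases hr : Rich G A B k
      · exact Or.inl hr
      · by_cases hr' : Rich G B A k
        · exact Or.inr (Or.inl hr')
        · have h3 := h.card_mids_of_not_rich_of_not_rich hr hr'
          change 4 * k ≤ _ + ∑ s ∈ S, ties G k A B s at h3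
          rw [hSi, sum_image hσ, ← hSi] at h3
          exact Or.inr (Or.inr (by omega)))
  refine ⟨R, fun j => disjoint_left.2 fun v hv hvR => ?_, r2, r3, r4, r5⟩
  have := r1 j hvR
  simp only [mids, mem_union, mem_filter, mem_univ, true_and] at this
  tauto

end Split

end

section

variable {V : Type*} [Fintype V] {G : V → V → Prop} {S A B : Finset V} {k M : ℕ} {σ : ℕ → V}

namespace Split

/-- An excursion from `A` to `B` and back. -/
theorem avail_excursion (h : Split G S A B k M) {R₁ R₂ : Finset V} (hd : Disjoint R₁ R₂)
    (h₁ : Avail (30 * k) R₁ (Crossing G A B)) (h₂ : Avail (30 * k) R₂ (Crossing G B A))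
    (hR₂ : R₂.card ≤ 1) : Avail (20 * k) (R₁ ∪ R₂) (Piece G A A [A, B]) := by
  intro F hF hFR
  rw [disjoint_union_right] at hFR
  have hk := h.three_le
  have hM := h.large_M
  have hB := h.symm.large_A
  obtain ⟨b₁, ⟨⟨⟨x₁, hx₁, y₁, hy₁, w₁⟩, n₁, -, e₁⟩, l₁⟩, f₁⟩ := h₁ (F ∪ R₂)
    (by have := card_union_le F R₂; omega) (disjoint_union_left.2 ⟨hFR.1, hd.symm⟩)
  simp only [mem_union, not_or] at f₁
  obtain ⟨b₂, ⟨⟨⟨x₂, hx₂, y₂, hy₂, w₂⟩, n₂, -, -⟩, l₂⟩, f₂⟩ := h₂ (F ∪ b₁.toFinset)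
    (by
      have h1 := card_union_le F b₁.toFinset
      have h2 := List.toFinset_card_le b₁
      omega)
    (disjoint_union_left.2 ⟨hFR.2, disjoint_left.2 fun v hv => (f₁ v (List.mem_toFinset.1 hv)).2⟩)
  simp only [mem_union, not_or, List.mem_toFinset] at f₂
  obtain ⟨c, -, hcl, hc₁, hc₂⟩ := h.symm.pick hy₁ hx₂ subset_rfl (by omega)
    (b₁ ++ (b₂ ++ F.toList)) (by simp; omega)
  simp only [List.mem_append, mem_toList, not_or] at hcl
  refine ⟨b₁ ++ c :: b₂, ⟨⟨x₁, hx₁, y₂, hy₂, ?_, ?_, ?_⟩, ?_, ?_, ?_⟩, ?_⟩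
  · rw [List.isChain_append]
    refine ⟨w₁.1, ?_, ?_⟩
    · rw [List.isChain_cons]
      refine ⟨fun y hy => ?_, w₂.1⟩
      rw [w₂.2.1] at hy
      cases hy
      exact hc₂
    · rw [w₁.2.2]
      simpa using hc₁
  · rw [List.head?_append, w₁.2.1]
    rfl
  · rw [show b₁ ++ c :: b₂ = (b₁ ++ [c]) ++ b₂ by simp, List.getLast?_append, w₂.2.2]
    rfl
  · rw [List.nodup_append', List.nodup_cons]
    refine ⟨n₁, ⟨hcl.2.1, n₂⟩, ?_⟩
    intro v hv hv'
    rw [List.mem_cons] at hv'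
    obtain rfl | hv' := hv'
    exacts [hcl.1 hv, (f₂ v hv').2 hv]
  · simp only [List.length_append, List.length_cons]
    omega
  · intro D hD
    obtain ⟨x, hx, y, hy, hxy⟩ := e₁ D hD
    exact ⟨x, hx, y, hy, hxy.trans ⟨[], c :: b₂, by simp⟩⟩
  · intro v hv
    rw [List.mem_append, List.mem_cons] at hv
    obtain hv | rfl | hv := hv
    exacts [(f₁ v hv).1, hcl.2.2, (f₂ v hv).1]

theorem exists_good_of_crossings (h : Split G S A B k M) (hσ : σ k = σ 0)
    (hinj : ∀ i < k, ∀ j < k, σ i = σ j → i = j) (hS : ∀ i < k, σ i ∈ S) {I₁ I₂ : Finset ℕ}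
    (hI : Disjoint I₁ I₂) (hIk : I₁ ∪ I₂ ⊆ range k) (hne : (I₁ ∪ I₂).Nonempty)
    (h₁ : I₁.card + ((range k).filter fun j => In G k A (σ j) ∧ Out G k B (σ j)).card ≤ k)
    (h₂ : I₂.card + ((range k).filter fun j => In G k B (σ j) ∧ Out G k A (σ j)).card ≤ k)
    (h₁₂ : 2 * (I₁.card + I₂.card) + ∑ j ∈ range k, ties G k A B (σ j) ≤ 4 * k)
    (hA : ∀ j ∈ I₁, Out G k A (σ j) ∧ In G k B (σ (j + 1)))
    (hB : ∀ j ∈ I₂, Out G k B (σ j) ∧ In G k A (σ (j + 1)))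
    (hJ : ∀ j < k, j ∉ I₁ ∪ I₂ → Joins G k A B (σ j) (σ (j + 1))) :
    ∃ m, Good G A B M (σ 0) ((List.range' 1 (k - 1)).map σ) m := by
  obtain ⟨R, r1, r2, r3, r4, r5⟩ := h.exists_supply hinj hS hI h₁ h₂ h₁₂
  obtain ⟨i, hi⟩ := hne
  have hI' : ∀ j ∈ I₁ ∪ I₂, j ∉ I₁ → j ∈ I₂ := fun j hj h' => (mem_union.1 hj).resolve_left h'
  refine h.exists_good_of_requests hσ hinj hS hIk (X := fun j => if j ∈ I₁ then A else B)
    (Y := fun j => if j ∈ I₁ then B else A) (R := R) (W := fun _ => [A, B]) (fun j hj => ?_)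
    (fun j hj => ?_) hJ (fun j hj => ?_) (fun j _ => (r2 j).trans (by omega)) r3
    (fun j _ => r1 j) ⟨i, hi, by simp⟩ ⟨i, hi, by simp⟩
  · by_cases hj' : j ∈ I₁
    · simpa [hj'] using (hA j hj').1
    · simpa [hj'] using (hB j (hI' j hj hj')).1
  · by_cases hj' : j ∈ I₁
    · simpa [hj'] using (hA j hj').2
    · simpa [hj'] using (hB j (hI' j hj hj')).2
  · have hk : 20 * k ≤ 30 * k := by omega
    by_cases hj' : j ∈ I₁
    · simpa only [hj', if_true] using ((r4 j hj').mono hk subset_rfl).imp fun b hb => hb.1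
    · simp only [hj', if_false]
      refine ((r5 j (hI' j hj hj')).mono hk subset_rfl).imp fun b hb => ?_
      exact ⟨hb.1.1, hb.1.2.1, hb.1.2.2.1, fun D hD => hb.1.2.2.2 D (by
        simpa [or_comm] using hD)⟩

theorem exists_good_of_linked (h : Split G S A B k M) (hσ : σ k = σ 0)
    (hinj : ∀ i < k, ∀ j < k, σ i = σ j → i = j) (hS : ∀ i < k, σ i ∈ S)
    (hA : ∀ j < k, Out G k A (σ j) ∧ In G k A (σ (j + 1)))
    (hB : ∀ j < k, ¬ (Out G k B (σ j) ∧ In G k B (σ (j + 1)))) :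
    ∃ m, Good G A B M (σ 0) ((List.range' 1 (k - 1)).map σ) m := by
  have hk := h.three_le
  have hc : ∀ (P : ℕ → Prop) [DecidablePred P], ((range k).filter P).card ≤ k := fun P _ => by
    simpa using card_filter_le (range k) P
  have hc' : ∀ (P : ℕ → Prop) [DecidablePred P] (i), i < k → ¬ P i →
      1 + ((range k).filter P).card ≤ k := by
    intro P _ i hi hP
    have : (range k).filter P ⊆ (range k).erase i := by
      intro j hj
      rw [mem_filter] at hj
      exact mem_erase.2 ⟨fun h' => hP (h' ▸ hj.2), hj.1⟩
    have h1 := card_le_card this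
    rw [card_erase_of_mem (mem_range.2 hi), card_range] at h1
    omega
  have hsum : ∑ j ∈ range k, ties G k A B (σ j) ≤ 3 * k := by
    rw [sum_ties hσ]
    refine (sum_le_card_nsmul _ _ 3 fun j hj => ?_).trans (by simp [mul_comm])
    have := hB j (mem_range.1 hj)
    split_ifs <;> first | omega | tauto
  have hJ : ∀ j < k, Joins G k A B (σ j) (σ (j + 1)) := fun j hj => Or.inl (hA j hj)
  by_cases ha : ∃ j < k, Out G k B (σ j)
  · obtain ⟨j, hj, ho⟩ := ha
    have hi : ¬ In G k B (σ (j + 1)) := fun h' => hB j hj ⟨ho, h'⟩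
    obtain ⟨i, hik, hij⟩ : ∃ i < k, σ (j + 1) = σ i := by
      by_cases h' : j + 1 = k
      · exact ⟨0, by omega, h' ▸ hσ⟩
      · exact ⟨j + 1, by omega, rfl⟩
    refine h.exists_good_of_crossings hσ hinj hS (I₁ := ∅) (I₂ := {j}) (by simp) (by simpa using hj)
      (by simp) (by
        rw [card_empty, zero_add]
        exact hc (fun j => In G k A (σ j) ∧ Out G k B (σ j))) ?_ ?_ (by simp) ?_
      fun j hj _ => hJ j hj
    · rw [card_singleton]
      exact hc' (fun j => In G k B (σ j) ∧ Out G k A (σ j)) i hik fun h' => hi (hij ▸ h'.1)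
    · simp
      omega
    · simp only [mem_singleton]
      rintro _ rfl
      exact ⟨ho, (hA _ hj).2⟩
  by_cases hb : ∃ j < k, In G k B (σ (j + 1))
  · obtain ⟨j, hj, hi⟩ := hb
    have ho : ¬ Out G k B (σ j) := fun h' => hB j hj ⟨h', hi⟩
    refine h.exists_good_of_crossings hσ hinj hS (I₁ := {j}) (I₂ := ∅) (by simp) (by simpa using hj)
      (by simp) ?_ (by
        rw [card_empty, zero_add]
        exact hc (fun j => In G k B (σ j) ∧ Out G k A (σ j))) ?_ ?_ (by simp) fun j hj _ => hJ j hj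
    · rw [card_singleton]
      exact hc' (fun j => In G k A (σ j) ∧ Out G k B (σ j)) j hj fun h' => ho h'.2
    · simp
      omega
    · simp only [mem_singleton]
      rintro _ rfl
      exact ⟨(hA _ hj).1, hi⟩
  push Not at ha hb
  have hb' : ∀ j < k, ¬ In G k B (σ j) := by
    rintro (_ | j) hj
    · have := hb (k - 1) (by omega)
      rwa [show k - 1 + 1 = k by omega, hσ] at this
    · exact hb j (by omega)
  have hsum' : ∑ j ∈ range k, ties G k A B (σ j) ≤ 2 * k := by
    rw [sum_ties hσ]
    refine (sum_le_card_nsmul _ _ 2 fun j hj => ?_).trans (by simp [mul_comm])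
    have h1 := ha j (mem_range.1 hj)
    have h2 := hb j (mem_range.1 hj)
    split_ifs <;> omega
  obtain ⟨R, r1, r2, r3, r4, r5⟩ := h.exists_supply hinj hS (I₁ := {0}) (I₂ := {1}) (by simp)
    (by
      rw [card_singleton]
      exact hc' (fun j => In G k A (σ j) ∧ Out G k B (σ j)) 0 (by omega)
        fun h' => ha 0 (by omega) h'.2)
    (by
      rw [card_singleton]
      exact hc' (fun j => In G k B (σ j) ∧ Out G k A (σ j)) 0 (by omega)
        fun h' => hb' 0 (by omega) h'.1)
    (by simp; omega)
  have hd : Disjoint (R 0) (R 1) := r3 0 (by simp) 1 (by simp) (by simp)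
  refine h.exists_good_of_requests hσ hinj hS (T := {0}) (X := fun _ => A) (Y := fun _ => A)
    (W := fun _ => [A, B]) (R := fun _ => R 0 ∪ R 1) (by simp; omega) ?_ ?_
    (fun j hj _ => hJ j hj) ?_ (fun j _ => ?_) ?_ (fun j _ => ?_) ?_ ?_
  · simpa using (hA 0 (by omega)).1
  · simpa using (hA 0 (by omega)).2
  · intro j _
    exact h.avail_excursion hd (r4 0 (by simp)) (r5 1 (by simp)) (r2 1)
  · have h1 := card_union_le (R 0) (R 1)
    have h2 := r2 0
    have h3 := r2 1
    omega
  · simp only [mem_singleton]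
    rintro i rfl j rfl hij
    exact absurd rfl hij
  · exact disjoint_union_right.2 ⟨r1 0, r1 1⟩
  · simp
  · simp

theorem exists_good_of_both (h : Split G S A B k M) (hσ : σ k = σ 0)
    (hinj : ∀ i < k, ∀ j < k, σ i = σ j → i = j) (hS : ∀ i < k, σ i ∈ S)
    (hJ : ∀ j < k, Joins G k A B (σ j) (σ (j + 1))) {i j : ℕ} (hi : i < k) (hj : j < k)
    (hij : i ≠ j) (hA : Out G k A (σ i) ∧ In G k A (σ (i + 1)))
    (hB : Out G k B (σ j) ∧ In G k B (σ (j + 1))) :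
    ∃ m, Good G A B M (σ 0) ((List.range' 1 (k - 1)).map σ) m := by
  refine h.exists_good_of_requests hσ hinj hS (T := {i, j}) (X := fun l => if l = i then A else B)
    (Y := fun l => if l = i then A else B) (W := fun l => if l = i then [A] else [B])
    (R := fun _ => ∅) ?_ ?_ ?_ (fun j hj _ => hJ j hj) ?_ (by simp) (by simp) (by simp)
    ⟨i, by simp⟩ ⟨j, by simp [hij.symm]⟩
  · simp [insert_subset_iff, hi, hj]
  · simp [hij.symm, hA.1, hB.1]
  · simp [hij.symm, hA.2, hB.2]
  · simp only [mem_insert, mem_singleton]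
    rintro l (rfl | rfl)
    · simpa using h.avail_edge
    · simpa [hij.symm] using h.symm.avail_edge

theorem exists_good (h : Split G S A B k M) (hσ : σ k = σ 0)
    (hinj : ∀ i < k, ∀ j < k, σ i = σ j → i = j) (hS : ∀ i < k, σ i ∈ S) :
    ∃ m, Good G A B M (σ 0) ((List.range' 1 (k - 1)).map σ) m := by
  have hk := h.three_le
  by_cases hJ : ∀ j < k, Joins G k A B (σ j) (σ (j + 1))
  · by_cases h1 : ∃ i < k, ∃ j < k, i ≠ j ∧ (Out G k A (σ i) ∧ In G k A (σ (i + 1))) ∧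
        Out G k B (σ j) ∧ In G k B (σ (j + 1))
    · obtain ⟨i, hi, j, hj, hij, hA, hB⟩ := h1
      exact h.exists_good_of_both hσ hinj hS hJ hi hj hij hA hB
    have h2 : ∀ i < k, ∀ j < k, i ≠ j → (Out G k A (σ i) ∧ In G k A (σ (i + 1))) →
        ¬ (Out G k B (σ j) ∧ In G k B (σ (j + 1))) :=
      fun i hi j hj hij hA hB => h1 ⟨i, hi, j, hj, hij, hA, hB⟩
    have h01 : ∀ j, ∃ i < k, i ≠ j := by
      intro j
      by_cases hj : j = 0
      exacts [⟨1, by omega, by omega⟩, ⟨0, by omega, by omega⟩]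
    have hx : ∀ j < k, ¬ ((Out G k A (σ j) ∧ In G k A (σ (j + 1))) ∧
        Out G k B (σ j) ∧ In G k B (σ (j + 1))) := by
      intro j hj hAB
      obtain ⟨i, hi, hij⟩ := h01 j
      obtain hA | hB := hJ i hi
      exacts [h2 i hi j hj hij hA hAB.2, h2 j hj i hi hij.symm hAB.1 hB]
    by_cases hA : ∃ i < k, Out G k A (σ i) ∧ In G k A (σ (i + 1))
    · obtain ⟨i, hi, hAi⟩ := hA
      have hB : ∀ j < k, ¬ (Out G k B (σ j) ∧ In G k B (σ (j + 1))) := by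
        intro j hj hBj
        by_cases hij : i = j
        · exact hx i hi ⟨hAi, hij ▸ hBj⟩
        · exact h2 i hi j hj hij hAi hBj
      exact h.exists_good_of_linked hσ hinj hS (fun j hj => (hJ j hj).resolve_right (hB j hj)) hB
    · push Not at hA
      have hA' : ∀ j < k, ¬ (Out G k A (σ j) ∧ In G k A (σ (j + 1))) :=
        fun j hj h' => hA j hj h'.1 h'.2
      obtain ⟨m, hm⟩ := h.symm.exists_good_of_linked hσ hinj hS
        (fun j hj => (hJ j hj).resolve_left (hA' j hj)) hA'
      exact ⟨m, hm.symm⟩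
  · obtain ⟨I₁, hI₁⟩ : ∃ I, I = (range k).filter fun j =>
      ¬ Out G k B (σ j) ∧ ¬ In G k A (σ (j + 1)) := ⟨_, rfl⟩
    obtain ⟨I₂, hI₂⟩ : ∃ I, I = (range k).filter fun j =>
      ¬ Out G k A (σ j) ∧ ¬ In G k B (σ (j + 1)) := ⟨_, rfl⟩
    have hm₁ : ∀ j, j ∈ I₁ ↔ j < k ∧ ¬ Out G k B (σ j) ∧ ¬ In G k A (σ (j + 1)) := by simp [hI₁]
    have hm₂ : ∀ j, j ∈ I₂ ↔ j < k ∧ ¬ Out G k A (σ j) ∧ ¬ In G k B (σ (j + 1)) := by simp [hI₂]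
    have hJ' : ∀ j < k, j ∉ I₁ ∪ I₂ → Joins G k A B (σ j) (σ (j + 1)) := by
      intro j hj hjI
      rw [mem_union, hm₁, hm₂] at hjI
      have h1 := h.out_or (σ j)
      have h2 := h.in_or (σ (j + 1))
      unfold Joins
      tauto
    have hI : Disjoint I₁ I₂ := by
      rw [disjoint_left]
      intro j h1 h2
      have h3 := h.out_or (σ j)
      rw [hm₁] at h1
      rw [hm₂] at h2
      tauto
    have hc : ∀ (I : Finset ℕ) (P : ℕ → Prop) [DecidablePred P], I ⊆ range k → (∀ j ∈ I, ¬ P j) →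
        I.card + ((range k).filter P).card ≤ k := by
      intro I P _ hI hP
      rw [← card_union_of_disjoint]
      · simpa using card_le_card (union_subset hI (filter_subset P _))
      · rw [disjoint_left]
        exact fun j hj hj' => hP j hj (mem_filter.1 hj').2
    have hIk₁ : I₁ ⊆ range k := hI₁ ▸ filter_subset _ _
    have hIk₂ : I₂ ⊆ range k := hI₂ ▸ filter_subset _ _
    refine h.exists_good_of_crossings hσ hinj hS hI (union_subset hIk₁ hIk₂) ?_
      (hc I₁ (fun j => In G k A (σ j) ∧ Out G k B (σ j)) hIk₁
        fun j hj h' => ((hm₁ j).1 hj).2.1 h'.2)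
      (hc I₂ (fun j => In G k B (σ j) ∧ Out G k A (σ j)) hIk₂
        fun j hj h' => ((hm₂ j).1 hj).2.1 h'.2) ?_ (fun j hj => ?_) (fun j hj => ?_) hJ'
    · push Not at hJ
      obtain ⟨j, hj, hj'⟩ := hJ
      by_contra hne
      rw [not_nonempty_iff_eq_empty] at hne
      exact hj' (hJ' j hj (by simp [hne]))
    · rw [sum_ties hσ, ← card_union_of_disjoint hI]
      have h1 : 2 * (I₁ ∪ I₂).card = ∑ j ∈ range k, if j ∈ I₁ ∪ I₂ then 2 else 0 := by
        rw [sum_ite_mem, inter_eq_right.2 (union_subset hIk₁ hIk₂)]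
        simp [mul_comm]
      rw [h1, ← sum_add_distrib]
      refine (sum_le_card_nsmul _ _ 4 fun j hj => ?_).trans (by simp [mul_comm])
      by_cases hjI : j ∈ I₁ ∪ I₂
      · rw [if_pos hjI]
        rw [mem_union, hm₁, hm₂] at hjI
        split_ifs <;> first | omega | tauto
      · rw [if_neg hjI]
        split_ifs <;> omega
    · have h1 := (hm₁ j).1 hj
      exact ⟨(h.out_or _).resolve_right h1.2.1, (h.in_or _).resolve_left h1.2.2⟩
    · have h1 := (hm₂ j).1 hj
      exact ⟨(h.out_or _).resolve_left h1.2.1, (h.in_or _).resolve_right h1.2.2⟩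

end Split

end

section

theorem Split.exists_hamilton {V : Type*} [Fintype V] {G : V → V → Prop} {S A B : Finset V}
    {k M : ℕ} {σ : ℕ → V} (h : Split G S A B k M) (hσ : σ k = σ 0)
    (hinj : ∀ i < k, ∀ j < k, σ i = σ j → i = j) (hS : ∀ i < k, σ i ∈ S) :
    ∃ m, IsCyc G (σ 0) m ∧ (∀ v, v ∈ σ 0 :: m) ∧ ((List.range' 1 (k - 1)).map σ).Sublist m := by
  obtain ⟨m, hm⟩ := h.exists_good hσ hinj hS
  exact h.exists_hamilton_of_good le_rfl hm

/-- If almost no edges go from `X` to `Y`, then most of `X \ Y` is almost complete. -/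
theorem exists_almost_complete {V : Type*} [Fintype V] {G : V → V → Prop} {X Y S : Finset V}
    {M : ℕ} (hX : 10 ^ 16 * Fintype.card V ≤ 2 * 10 ^ 16 * X.card + 2 * Fintype.card V)
    (hY : 10 ^ 16 * Fintype.card V ≤ 2 * 10 ^ 16 * Y.card + 2 * Fintype.card V)
    (hXY : 10 ^ 16 * (X ∩ Y).card ≤ Fintype.card V)
    (hG : 10 ^ 16 * ∑ x ∈ X, ∑ y ∈ Y, (if G x y then 1 else 0) ≤ Fintype.card V ^ 2)
    (hdeg : ∀ v, Fintype.card V ≤ 2 * (univ.filter fun x => G v x).card)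
    (hS : 300000 * S.card ≤ M) (hM : 900000 ≤ M) (hM₁ : 1000 * M ≤ Fintype.card V)
    (hM₂ : Fintype.card V < 1000 * (M + 1)) :
    ∃ A ⊆ X \ Y, Disjoint A S ∧ Fintype.card V ≤ 2 * A.card + 2 * M ∧
      (∀ a ∈ A, (A.filter fun x => ¬ G a x).card ≤ M) ∧
      ∀ a ∈ A, (A.filter fun x => ¬ G x a).card ≤ M := by
  obtain ⟨n, hn⟩ : ∃ n, n = Fintype.card V := ⟨_, rfl⟩
  simp only [← hn] at hX hY hXY hG hdeg hM₁ hM₂ ⊢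
  obtain ⟨d, hd₁, hd₂⟩ : ∃ d, 10 ^ 8 * d ≤ n ∧ n < 10 ^ 8 * (d + 1) :=
    ⟨n / 10 ^ 8, by omega, by omega⟩
  simp only [← card_filter] at hG
  obtain ⟨C, hC⟩ : ∃ C, C = X.filter fun v => d < (Y.filter fun y => G v y).card := ⟨_, rfl⟩
  have hCcard : 10 ^ 8 * C.card ≤ n := by
    have h1 : C.card * (d + 1) ≤ ∑ x ∈ X, (Y.filter fun y => G x y).card := by
      rw [← smul_eq_mul]
      refine (card_nsmul_le_sum C _ (d + 1) fun v hv => ?_).trans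
        (sum_le_sum_of_subset (hC ▸ filter_subset _ _))
      rw [hC, mem_filter] at hv
      exact hv.2
    have h2 : 10 ^ 8 * C.card * (10 ^ 8 * (d + 1)) ≤ n * (10 ^ 8 * (d + 1)) := by nlinarith
    exact Nat.le_of_mul_le_mul_right h2 (by positivity)
  obtain ⟨A₀, hA₀⟩ : ∃ A₀, A₀ = (X \ Y) \ C := ⟨_, rfl⟩
  have hmiss : ∀ v ∈ A₀, 10 ^ 8 * (A₀.filter fun x => ¬ G v x).card ≤ 2 * n := by
    intro v hv
    simp only [hA₀, hC, mem_sdiff, mem_filter, not_and, not_lt] at hv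
    have h1 := hv.2 hv.1.1
    have h2 : (A₀.filter fun x => ¬ G v x).card + (univ.filter fun x => G v x).card + Y.card ≤
        n + (Y.filter fun y => G v y).card := by
      have h3 : (A₀.filter fun x => ¬ G v x) ∪ (univ.filter fun x => G v x) ⊆
          Yᶜ ∪ Y.filter fun y => G v y := by
        intro x
        simp only [hA₀, mem_union, mem_filter, mem_sdiff, mem_univ, true_and, mem_compl]
        tauto
      have h4 : Disjoint (A₀.filter fun x => ¬ G v x) (univ.filter fun x => G v x) :=
        disjoint_left.2 fun x hx hx' => (mem_filter.1 hx).2 (mem_filter.1 hx').2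
      have h5 := (card_le_card h3).trans (card_union_le _ _)
      rw [card_union_of_disjoint h4] at h5
      have h6 := card_add_card_compl Y
      omega
    have h3 := hdeg v
    omega
  obtain ⟨D, hD⟩ : ∃ D, D = A₀.filter fun v => M < (A₀.filter fun x => ¬ G x v).card := ⟨_, rfl⟩
  have hDcard : 10 ^ 8 * D.card ≤ 2000 * n := by
    have h1 : D.card * (M + 1) ≤ ∑ v ∈ A₀, (A₀.filter fun x => ¬ G x v).card := by
      rw [← smul_eq_mul]
      refine (card_nsmul_le_sum D _ (M + 1) fun v hv => ?_).trans
        (sum_le_sum_of_subset (hD ▸ filter_subset _ _))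
      rw [hD, mem_filter] at hv
      exact hv.2
    have h2 : ∑ v ∈ A₀, (A₀.filter fun x => ¬ G x v).card =
        ∑ v ∈ A₀, (A₀.filter fun x => ¬ G v x).card := by
      simp only [card_filter]
      exact sum_comm
    have h3 : 10 ^ 8 * ∑ v ∈ A₀, (A₀.filter fun x => ¬ G v x).card ≤ n * (2 * n) := by
      rw [mul_sum]
      refine (sum_le_card_nsmul _ _ _ hmiss).trans ?_
      rw [smul_eq_mul]
      exact Nat.mul_le_mul_right _ (hn ▸ card_le_univ A₀)
    have h4 : 10 ^ 8 * D.card * (M + 1) ≤ 2000 * n * (M + 1) := by nlinarith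
    exact Nat.le_of_mul_le_mul_right h4 (by positivity)
  refine ⟨(A₀ \ D) \ S, ?_, sdiff_disjoint, ?_, fun a ha => ?_, fun a ha => ?_⟩
  · rw [hA₀]
    exact sdiff_subset.trans (sdiff_subset.trans sdiff_subset)
  · have h1 := le_card_sdiff S (A₀ \ D)
    have h2 := le_card_sdiff D A₀
    have h3 := le_card_sdiff C (X \ Y)
    have h4 := card_sdiff_add_card_inter X Y
    rw [← hA₀] at h3
    omega
  · have h1 := hmiss a (mem_sdiff.1 (mem_sdiff.1 ha).1).1
    have h2 : (((A₀ \ D) \ S).filter fun x => ¬ G a x).card ≤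
        (A₀.filter fun x => ¬ G a x).card :=
      card_le_card (filter_subset_filter _ (sdiff_subset.trans sdiff_subset))
    omega
  · have h1 := mem_sdiff.1 (mem_sdiff.1 ha).1
    have h2 : (((A₀ \ D) \ S).filter fun x => ¬ G x a).card ≤
        (A₀.filter fun x => ¬ G x a).card :=
      card_le_card (filter_subset_filter _ (sdiff_subset.trans sdiff_subset))
    rw [hD, mem_filter, not_and, not_lt] at h1
    exact h2.trans (h1.2 h1.1)

theorem exists_split {V : Type*} [Fintype V] {G : V → V → Prop} {S : Finset V} {k : ℕ}
    (hG : ∀ x, ¬ G x x) (hS : S.card = k) (hk : 3 ≤ k)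
    (hout : ∀ v, Fintype.card V + k ≤ 2 * (univ.filter fun x => G v x).card + 2)
    (hin : ∀ v, Fintype.card V + k ≤ 2 * (univ.filter fun x => G x v).card + 2)
    (hn : 100000000 * k ^ 2 ≤ Fintype.card V) (hext : Ext G (10 ^ 16)) :
    ∃ A B M, Split G S A B k M := by
  obtain ⟨X, Y, hX, hY, hXY, he⟩ := hext
  obtain ⟨M, hM⟩ : ∃ M, M = Fintype.card V / 1000 := ⟨_, rfl⟩
  have hMk : 100000 * k ^ 2 ≤ M := by omega
  have h1 : 300000 * k ≤ M := by nlinarith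
  have h2 : 900000 ≤ M := by nlinarith
  have he' : 10 ^ 16 * ∑ x ∈ X, ∑ y ∈ Y, (if G x y then 1 else 0) ≤ Fintype.card V ^ 2 := by
    refine le_trans (le_of_eq ?_) he
    rw [card_filter, sum_product]
  obtain ⟨A, hA, dA, cA, oA, iA⟩ := exists_almost_complete (G := G) (S := S) (M := M) hX hY hXY he'
    (fun v => by have := hout v; omega) (by omega) h2 (by omega) (by omega)
  rw [sum_comm] at he'
  obtain ⟨B, hB, dB, cB, iB, oB⟩ := exists_almost_complete (G := fun x y => G y x) (S := S)
    (M := M) hY hX (by rwa [inter_comm]) he'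
    (fun v => by have := hin v; omega) (by omega) h2 (by omega) (by omega)
  refine ⟨A, B, M, hG, ?_, dA, dB, hS, hk, cA, cB, oA, iA, oB, iB, hout, hin, hMk, by omega⟩
  exact disjoint_left.2 fun v hv hv' => (mem_sdiff.1 (hB hv')).2 (mem_sdiff.1 (hA hv)).1

theorem exists_cyc_of_degree (k : ℕ) (hk : 3 ≤ k) : ∃ n₀ : ℕ, ∀ (V : Type) [Fintype V]
    (G : V → V → Prop), (∀ x, ¬ G x x) → n₀ ≤ Fintype.card V →
    (∀ v, Fintype.card V + k ≤ 2 * (univ.filter fun x => G v x).card + 2) →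
    (∀ v, Fintype.card V + k ≤ 2 * (univ.filter fun x => G x v).card + 2) →
    ∀ σ : ℕ → V, σ k = σ 0 → (∀ i < k, ∀ j < k, σ i = σ j → i = j) →
      ∃ m, IsCyc G (σ 0) m ∧ (∀ v, v ∈ σ 0 :: m) ∧
        ((List.range' 1 (k - 1)).map σ).Sublist m := by
  obtain ⟨n₀, hn₀⟩ := exists_hamilton_of_not_ext (10 ^ 16) k (by norm_num)
  refine ⟨max n₀ (100000000 * k ^ 2), fun V _ G hG hn hout hin σ hσ hinj => ?_⟩
  rw [max_le_iff] at hn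
  by_cases hext : Ext G (10 ^ 16)
  · have hS : ((range k).image σ).card = k := by
      rw [card_image_of_injOn, card_range]
      exact fun i hi j hj => hinj i (mem_range.1 hi) j (mem_range.1 hj)
    obtain ⟨A, B, M, h⟩ := exists_split hG hS hk hout hin hn.2 hext
    exact h.exists_hamilton hσ hinj fun i hi => mem_image_of_mem σ (mem_range.2 hi)
  · obtain ⟨l, rfl⟩ : ∃ l, k = l + 2 := ⟨k - 2, by omega⟩
    have h1 : (List.range' 1 (l + 2 - 1)).map σ = σ 1 :: (List.range' 2 l).map σ := by
      simp [List.range'_succ]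
    have h2 : (σ 0 :: σ 1 :: (List.range' 2 l).map σ) = (List.range' 0 (l + 2)).map σ := by
      simp [List.range'_succ]
    rw [h1]
    refine hn₀ V G hG hn.1 (fun v => by have := hout v; omega) (fun v => by have := hin v; omega)
      hext (σ 0) (σ 1) _ ?_ (by simp)
    rw [h2]
    refine List.Nodup.map_on ?_ List.nodup_range'
    intro x hx y hy
    simp only [List.mem_range'_1] at hx hy
    exact hinj x (by omega) y (by omega)

end

section

theorem exists_zmod_of_cyc {V : Type*} [Fintype V] {G : V → V → Prop} {s₀ : V} {m t : List V}
    (h : IsCyc G s₀ m) (hcov : ∀ v, v ∈ s₀ :: m) (ht : t.Sublist m) :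
    ∃ f : ZMod (Fintype.card V) → V, Function.Bijective f ∧ (∀ i, G (f i) (f (i + 1))) ∧
      ∃ p : Fin (s₀ :: t).length → ZMod (Fintype.card V),
        StrictMono (fun j => (p j).val) ∧ ∀ j, f (p j) = (s₀ :: t).get j := by
  obtain ⟨n, hn⟩ : ∃ n, n = Fintype.card V := ⟨_, rfl⟩
  rw [← hn]
  have hlen : (s₀ :: m).length = n := by
    rw [← List.toFinset_card_of_nodup h.2, hn, ← card_univ]
    congr 1
    ext v
    simpa using hcov v
  have hpos : 0 < n := by
    rw [← hlen]
    simp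
  have : NeZero n := ⟨hpos.ne'⟩
  have hv : ∀ i : ZMod n, i.val < (s₀ :: m).length := fun i =>
    (ZMod.val_lt i).trans_eq hlen.symm
  refine ⟨fun i => (s₀ :: m)[i.val]'(hv i), ⟨fun i j hij => ?_, fun v => ?_⟩, fun i => ?_, ?_⟩
  · exact ZMod.val_injective n ((h.2.getElem_inj_iff).1 hij)
  · obtain ⟨i, hi, rfl⟩ := List.getElem_of_mem (hcov v)
    exact ⟨(i : ZMod n), by simp only [ZMod.val_natCast_of_lt (hi.trans_eq hlen)]⟩
  · have h1 := List.isChain_iff_getElem.1 h.1 i.val (by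
      have := hv i
      simp at this ⊢
      omega)
    have h2 : (s₀ :: (m ++ [s₀]))[i.val]'(by have := hv i; simp at this ⊢; omega) =
        (s₀ :: m)[i.val]'(hv i) := by
      simp only [← List.cons_append]
      exact List.getElem_append_left (hv i)
    have h3 : (s₀ :: (m ++ [s₀]))[i.val + 1]'(by have := hv i; simp at this ⊢; omega) =
        (s₀ :: m)[(i + 1).val]'(hv (i + 1)) := by
      simp only [← List.cons_append]
      by_cases hi : i.val + 1 < n
      · have h4 : (i + 1).val = i.val + 1 := by
          rw [← ZMod.val_natCast_of_lt hi]
          simp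
        simp only [h4]
        exact List.getElem_append_left (hi.trans_eq hlen.symm)
      · have h5 : i.val + 1 = n := by
          have := ZMod.val_lt i
          omega
        have h4 : (i + 1).val = 0 := by
          rw [show i + 1 = ((i.val + 1 : ℕ) : ZMod n) by simp, h5]
          simp
        simp only [h4]
        rw [List.getElem_append_right (by omega)]
        simp
    rw [h2, h3] at h1
    exact h1
  · obtain ⟨g, hg⟩ := List.sublist_iff_exists_fin_orderEmbedding_get_eq.1 (ht.cons_cons s₀)
    have hgn : ∀ j, (g j).val < n := fun j => (g j).2.trans_eq hlen
    refine ⟨fun j => ((g j).val : ZMod n), fun i j hij => ?_, fun j => ?_⟩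
    · simp only [ZMod.val_natCast_of_lt (hgn _)]
      exact g.strictMono hij
    · simp only [ZMod.val_natCast_of_lt (hgn _)]
      exact (hg j).symm

end
end KOrdered

/-- Kühn–Osthus–Young: for every k ≥ 3 there exists n₀ such that every digraph on n ≥ n₀
vertices with minimum semidegree at least ⌈(n + k)/2⌉ − 1 is k-ordered Hamiltonian: for any
distinct vertices s₁, …, s_k there is a Hamilton cycle (a cyclic ordering f of all the
vertices with consecutive edges) encountering s₁, …, s_k in this cyclic order (i.e. they
occur at positions with strictly increasing representatives). -/
theorem k_ordered_hamiltonian_digraph (k : ℕ) (hk : 3 ≤ k) :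
    ∃ n₀ : ℕ, ∀ (V : Type) [Fintype V] (G : V → V → Prop),
      Irreflexive G →
      n₀ ≤ Fintype.card V →
      (∀ x : V, (Fintype.card V + k + 1) / 2 - 1 ≤ outDeg G x ∧
        (Fintype.card V + k + 1) / 2 - 1 ≤ inDeg G x) →
      ∀ s : Fin k → V, Function.Injective s →
        ∃ f : ZMod (Fintype.card V) → V, Function.Bijective f ∧
          (∀ i, G (f i) (f (i + 1))) ∧
          ∃ p : Fin k → ZMod (Fintype.card V),
            StrictMono (fun j => (p j).val) ∧ ∀ j, f (p j) = s j := by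
  classical
  obtain ⟨n₀, hn₀⟩ := KOrdered.exists_cyc_of_degree k hk
  refine ⟨n₀, fun V _ G hG hn hdeg s hs => ?_⟩
  have hout : ∀ v, outDeg G v = (Finset.univ.filter fun x => G v x).card := fun v => by
    rw [outDeg, Nat.card_eq_fintype_card, Fintype.card_subtype]
  have hin : ∀ v, inDeg G v = (Finset.univ.filter fun x => G x v).card := fun v => by
    rw [inDeg, Nat.card_eq_fintype_card, Fintype.card_subtype]
  have hlt : ∀ i, i % k < k := fun i => Nat.mod_lt _ (by omega)
  set σ : ℕ → V := fun i => s ⟨i % k, hlt i⟩ with hσ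
  have hσs : ∀ i : Fin k, σ i = s i := fun i => by simp [hσ, Nat.mod_eq_of_lt i.2]
  obtain ⟨m, hm, hcov, hsub⟩ := hn₀ V G hG hn
    (fun v => by
      have := (hdeg v).1
      rw [hout] at this
      convert (by omega : Fintype.card V + k ≤
        2 * (Finset.univ.filter fun x => G v x).card + 2) using 4)
    (fun v => by
      have := (hdeg v).2
      rw [hin] at this
      convert (by omega : Fintype.card V + k ≤
        2 * (Finset.univ.filter fun x => G x v).card + 2) using 4) σ (by simp [hσ])
    (fun i hi j hj hij => by
      have := hs ((hσs ⟨i, hi⟩).symm.trans (hij.trans (hσs ⟨j, hj⟩)))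
      simpa using this)
  obtain ⟨f, hf, hfG, p, hp, hfp⟩ := KOrdered.exists_zmod_of_cyc hm hcov hsub
  have hlen : (σ 0 :: (List.range' 1 (k - 1)).map σ).length = k := by
    simp
    omega
  refine ⟨f, hf, hfG, fun j => p (j.cast hlen.symm), fun i j hij => hp hij, fun j => ?_⟩
  rw [hfp, ← hσs]
  have h1 : σ 0 :: (List.range' 1 (k - 1)).map σ = (List.range' 0 k).map σ := by
    obtain ⟨l, rfl⟩ : ∃ l, k = l + 1 := ⟨k - 1, by omega⟩
    simp [List.range'_succ]
  simp [h1]
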